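/- Let Ω, Ω′ ⊂ ℝⁿ be bounded domains with Lipschitz boundaries, and let φ_k : Ω → Ω′ be homeomorphisms in W¹_{n−1,loc}(Ω) with J(x,φ_k) ≥ 0 a.e. such that φ_k → φ₀ weakly in W¹_{n−1,loc}(Ω) with J(x,φ₀) ≥ 0 a.e., every φ_k induces a bounded pullback operator φ̃_k* : 𝓛_{n/(n−1)}(Ω′, Λ^{n−1}) → 𝓛_{r/(n−1)}(Ω, Λ^{n−1}) for some n−1 ≤ r ≤ n, and the norms ‖φ̃_k*‖ are uniformly bounded by a constant C (so that each φ_k induces a bounded composition operator φ_k* : L¹_n(Ω′) → L¹_ρ(Ω) with ‖φ_k*‖ ≤ C). Then the limit mapping φ₀ induces a bounded composition operator φ₀* : L¹_n(Ω′) ∩ Lip(Ω′) → L¹_ρ(Ω), with ρ = r/((n−1)² − r(n−2)) ≥ 1, and ‖φ₀*‖ ≤ C. -/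

import Mathlib

open MeasureTheory Set Filter Topology Metric Matrix
open scoped ENNReal NNReal

noncomputable section

/-- Euclidean space `ℝⁿ`. -/
abbrev Ev (n : ℕ) := EuclideanSpace ℝ (Fin n)

/-- `n × n` real matrices. -/
abbrev Mat (n : ℕ) := Matrix (Fin n) (Fin n) ℝ

namespace Paper

variable {n : ℕ}

/-- Frobenius norm of a matrix. -/
def matNorm {n : ℕ} (A : Mat n) : ℝ := Real.sqrt (∑ i, ∑ j, (A i j) ^ 2)

/-- A bounded domain: a nonempty connected open bounded set. -/
def IsBoundedDomain {n : ℕ} (Ω : Set (Ev n)) : Prop :=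
  IsOpen Ω ∧ IsConnected Ω ∧ Bornology.IsBounded Ω

/-- `Ω` has Lipschitz boundary: near each boundary point, in some Cartesian coordinate
system (an affine isometry of `ℝⁿ`), `Ω` is the subgraph of a Lipschitz function of the
remaining `n − 1` coordinates. -/
def HasLipschitzBoundary {n : ℕ} (Ω : Set (Ev n)) : Prop :=
  ∀ x ∈ frontier Ω, ∃ U : Set (Ev n), IsOpen U ∧ x ∈ U ∧
    ∃ (e : Ev n ≃ᵃⁱ[ℝ] Ev n) (i : Fin n) (f : Ev n → ℝ) (L : ℝ≥0),
      LipschitzWith L f ∧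
      (∀ y z : Ev n, (∀ j : Fin n, j ≠ i → y j = z j) → f y = f z) ∧
      Ω ∩ U = {y ∈ U | e y i < f (e y)}

/-- `Df` is the weak (distributional) derivative of `f : Ω → ℝⁿ` on the open set `Ω`. -/
def IsWeakDeriv {n : ℕ} (Ω : Set (Ev n)) (f : Ev n → Ev n) (Df : Ev n → Mat n) : Prop :=
  (∀ i j : Fin n, LocallyIntegrableOn (fun x => Df x i j) Ω) ∧
  ∀ η : Ev n → ℝ, ContDiff ℝ (⊤ : ℕ∞) η → HasCompactSupport η → tsupport η ⊆ Ω →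
    ∀ i j : Fin n,
      ∫ x in Ω, f x i * fderiv ℝ η x (EuclideanSpace.single j 1)
        = - ∫ x in Ω, Df x i j * η x

/-- `Du` is the weak gradient of the scalar function `u` on the open set `Ω`. -/
def IsWeakGrad {n : ℕ} (Ω : Set (Ev n)) (u : Ev n → ℝ) (Du : Ev n → Ev n) : Prop :=
  (∀ j : Fin n, LocallyIntegrableOn (fun x => Du x j) Ω) ∧
  ∀ η : Ev n → ℝ, ContDiff ℝ (⊤ : ℕ∞) η → HasCompactSupport η → tsupport η ⊆ Ω →
    ∀ j : Fin n,
      ∫ x in Ω, u x * fderiv ℝ η x (EuclideanSpace.single j 1)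
        = - ∫ x in Ω, Du x j * η x

/-- Membership in the local Sobolev class `W¹_{p,loc}(Ω)` (for mappings `Ω → ℝⁿ`),
with given weak derivative `Df`. -/
def MemW1loc {n : ℕ} (p : ℝ) (Ω : Set (Ev n)) (f : Ev n → Ev n) (Df : Ev n → Mat n) : Prop :=
  LocallyIntegrableOn f Ω ∧ IsWeakDeriv Ω f Df ∧
  ∀ K : Set (Ev n), IsCompact K → K ⊆ Ω →
    ∫⁻ x in K, ENNReal.ofReal (matNorm (Df x) ^ p) < ⊤

/-- Membership in the Sobolev class `W¹_p(Ω)` (global integrability over `Ω`),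
with given weak derivative `Df`. -/
def MemW1 {n : ℕ} (p : ℝ) (Ω : Set (Ev n)) (f : Ev n → Ev n) (Df : Ev n → Mat n) : Prop :=
  IntegrableOn f Ω volume ∧ IsWeakDeriv Ω f Df ∧
  ∫⁻ x in Ω, ENNReal.ofReal (matNorm (Df x) ^ p) < ⊤

/-- `φ` is a homeomorphism of `Ω` onto `Ω'` with (two-sided) inverse `ψ`. -/
structure IsHomeoOn {n : ℕ} (φ ψ : Ev n → Ev n) (Ω Ω' : Set (Ev n)) : Prop where
  cont : ContinuousOn φ Ω
  cont_inv : ContinuousOn ψ Ω'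
  mapsTo : MapsTo φ Ω Ω'
  mapsTo_inv : MapsTo ψ Ω' Ω
  left_inv : ∀ x ∈ Ω, ψ (φ x) = x
  right_inv : ∀ y ∈ Ω', φ (ψ y) = y

/-- `φ` is a homeomorphism of `Ω` onto `Ω'`. -/
def IsHomeo {n : ℕ} (φ : Ev n → Ev n) (Ω Ω' : Set (Ev n)) : Prop :=
  ∃ ψ : Ev n → Ev n, IsHomeoOn φ ψ Ω Ω'

/-- A mapping (given through its weak derivative `Df`) has finite distortion on `Ω`:
`|Df(x)|ⁿ ≤ K(x)·|J(x,f)|` a.e. with `1 ≤ K(x) < ∞` a.e. -/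
def HasFiniteDistortionOn (n : ℕ) (Ω : Set (Ev n)) (Df : Ev n → Mat n) : Prop :=
  ∃ K : Ev n → ℝ, (∀ᵐ x ∂(volume.restrict Ω), 1 ≤ K x) ∧
    ∀ᵐ x ∂(volume.restrict Ω), matNorm (Df x) ^ n ≤ K x * |(Df x).det|

/-- Finite codistortion: `Adj Df(x) = 0` a.e. on the zero set of the Jacobian. -/
def HasFiniteCodistortionOn (n : ℕ) (Ω : Set (Ev n)) (Df : Ev n → Mat n) : Prop :=
  ∀ᵐ x ∂(volume.restrict Ω), (Df x).det = 0 → (Df x).adjugate = 0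

/-- Outer distortion coefficient `K_O(x,f) = |Df(x)|ⁿ / J(x,f)` (`= 1` off `{0 < J < ∞}`). -/
def KO (n : ℕ) (Df : Ev n → Mat n) (x : Ev n) : ℝ :=
  if 0 < (Df x).det then matNorm (Df x) ^ n / (Df x).det else 1

/-- Inner distortion coefficient `K_I(x,f) = |Adj Df(x)|ⁿ / J(x,f)^{n−1}`
(`= 1` off `{0 < J < ∞}`). -/
def KI (n : ℕ) (Df : Ev n → Mat n) (x : Ev n) : ℝ :=
  if 0 < (Df x).det then matNorm ((Df x).adjugate) ^ n / (Df x).det ^ (n - 1) else 1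

/-- Outer distortion operator function `K_{f,p}(x) = |Df(x)| / |J(x,f)|^{1/p}`,
equal to `0` on the zero set of the Jacobian. -/
def KopOuter (p : ℝ≥0∞) (Df : Ev n → Mat n) (x : Ev n) : ℝ :=
  if (Df x).det = 0 then 0
  else matNorm (Df x) / |(Df x).det| ^ (1 / p.toReal)

/-- Inner distortion operator function `𝒦_{f,p}(x) = |Adj Df(x)| / |J(x,f)|^{(n−1)/p}`,
equal to `0` on the zero set of the Jacobian. -/
def KopInner (n : ℕ) (p : ℝ≥0∞) (Df : Ev n → Mat n) (x : Ev n) : ℝ :=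
  if (Df x).det = 0 then 0
  else matNorm ((Df x).adjugate) / |(Df x).det| ^ (((n : ℝ) - 1) / p.toReal)

/-- The coefficient vector of the pullback `f̃*ω` of an `(n−1)`-form (identified with its
coefficient vector `a`), extended by `0` on the zero set of the Jacobian:
`(f̃*ω)(x) = Adj Dφ(x) ⬝ a(φ(x))`. -/
def pullbackCoeff {n : ℕ} (φ : Ev n → Ev n) (Dφ : Ev n → Mat n) (a : Ev n → Ev n)
    (x : Ev n) : Ev n :=
  if (Dφ x).det = 0 then 0
  else (WithLp.equiv 2 (∀ _ : Fin n, ℝ)).symm ((Dφ x).adjugate.mulVec (fun j => a (φ x) j))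

/-- `φ` induces a pullback operator
`φ̃* : 𝓛_p(Ω', Λ^{n−1}) → 𝓛_q(Ω, Λ^{n−1})` of norm at most `C`. -/
def PullbackBounded {n : ℕ} (Ω Ω' : Set (Ev n)) (φ : Ev n → Ev n) (Dφ : Ev n → Mat n)
    (p q : ℝ≥0∞) (C : ℝ≥0∞) : Prop :=
  ∀ a : Ev n → Ev n, Measurable a →
    eLpNorm (pullbackCoeff φ Dφ a) q (volume.restrict Ω)
      ≤ C * eLpNorm a p (volume.restrict Ω')

/-- The operator norm of the pullback operator `φ̃*` from `𝓛_p(Ω')` to `𝓛_q(Ω)`. -/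
def pullbackOpNorm {n : ℕ} (Ω Ω' : Set (Ev n)) (φ : Ev n → Ev n) (Dφ : Ev n → Mat n)
    (p q : ℝ≥0∞) : ℝ≥0∞ :=
  sInf {C : ℝ≥0∞ | PullbackBounded Ω Ω' φ Dφ p q C}

/-- `φ : Ω → Ω'` induces a bounded composition operator
`φ* : L¹_p(Ω') ∩ Lip_loc(Ω') → L¹_q(Ω)`, `φ*(u) = u ∘ φ`, with norm at most `C`. -/
def CompOpBounded {n : ℕ} (Ω Ω' : Set (Ev n)) (φ : Ev n → Ev n)
    (p q : ℝ≥0∞) (C : ℝ≥0∞) : Prop :=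
  ∀ (u : Ev n → ℝ) (Du : Ev n → Ev n),
    (∀ K : Set (Ev n), IsCompact K → K ⊆ Ω' → ∃ L : ℝ≥0, LipschitzOnWith L u K) →
    IsWeakGrad Ω' u Du →
    eLpNorm Du p (volume.restrict Ω') < ⊤ →
    ∃ Dv : Ev n → Ev n, IsWeakGrad Ω (u ∘ φ) Dv ∧
      eLpNorm Dv q (volume.restrict Ω) ≤ C * eLpNorm Du p (volume.restrict Ω')

/-- The operator norm of the composition operator `φ* : L¹_p(Ω') → L¹_q(Ω)`. -/
def compOpNorm {n : ℕ} (Ω Ω' : Set (Ev n)) (φ : Ev n → Ev n) (p q : ℝ≥0∞) : ℝ≥0∞ :=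
  sInf {C : ℝ≥0∞ | CompOpBounded Ω Ω' φ p q C}

/-- `φ : Ω → Ω'` induces a bounded composition operator
`φ* : L¹_p(Ω') ∩ Lip(Ω') → L¹_q(Ω)` with norm at most `C` (globally Lipschitz test
functions). -/
def CompOpBoundedLip {n : ℕ} (Ω Ω' : Set (Ev n)) (φ : Ev n → Ev n)
    (p q : ℝ≥0∞) (C : ℝ≥0∞) : Prop :=
  ∀ (u : Ev n → ℝ) (Du : Ev n → Ev n) (L : ℝ≥0),
    LipschitzOnWith L u Ω' →
    IsWeakGrad Ω' u Du →
    eLpNorm Du p (volume.restrict Ω') < ⊤ →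
    ∃ Dv : Ev n → Ev n, IsWeakGrad Ω (u ∘ φ) Dv ∧
      eLpNorm Dv q (volume.restrict Ω) ≤ C * eLpNorm Du p (volume.restrict Ω')

/-- Weak convergence `f_k ⇀ f₀` in `W¹_{p,loc}(Ω)`: all the mappings belong to
`W¹_{p,loc}(Ω)`, the `W¹_p`-norms are bounded on compact subsets, and functions and
weak derivatives converge as distributions. -/
def WeakConvW1loc {n : ℕ} (p : ℝ) (Ω : Set (Ev n))
    (f : ℕ → Ev n → Ev n) (Df : ℕ → Ev n → Mat n)
    (f0 : Ev n → Ev n) (Df0 : Ev n → Mat n) : Prop :=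
  (∀ k, MemW1loc p Ω (f k) (Df k)) ∧ MemW1loc p Ω f0 Df0 ∧
  (∀ K : Set (Ev n), IsCompact K → K ⊆ Ω → ∃ C : ℝ,
    ∀ k, (∫⁻ x in K, ENNReal.ofReal (matNorm (Df k x) ^ p)) ≤ ENNReal.ofReal C) ∧
  ∀ θ : Ev n → ℝ, ContDiff ℝ (⊤ : ℕ∞) θ → HasCompactSupport θ → tsupport θ ⊆ Ω →
    (∀ i : Fin n,
      Tendsto (fun k => ∫ x in Ω, θ x * f k x i) atTop (𝓝 (∫ x in Ω, θ x * f0 x i))) ∧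
    (∀ i j : Fin n,
      Tendsto (fun k => ∫ x in Ω, θ x * Df k x i j) atTop (𝓝 (∫ x in Ω, θ x * Df0 x i j)))

/-- `φ` is injective almost everywhere on `Ω`: injective outside some negligible set. -/
def AEInjectiveOn {n : ℕ} (φ : Ev n → Ev n) (Ω : Set (Ev n)) : Prop :=
  ∃ S : Set (Ev n), S ⊆ Ω ∧ volume S = 0 ∧ Set.InjOn φ (Ω \ S)

end Paper

namespace Paper

section Mollifier

open scoped Convolution ContDiff
open ContinuousLinearMap (lsmul)

variable {n : ℕ}

/-- A standard bump function at the origin with outer radius `1 / (m + 1)`. -/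
def mollBump (n m : ℕ) : ContDiffBump (0 : Ev n) where
  rIn := 1 / (2 * ((m : ℝ) + 1))
  rOut := 1 / ((m : ℝ) + 1)
  rIn_pos := by positivity
  rIn_lt_rOut := by
    apply one_div_lt_one_div_of_lt <;> [positivity; linarith [(Nat.cast_nonneg m : (0 : ℝ) ≤ m)]]

/-- The mollifying kernel of radius `1 / (m + 1)`. -/
def mollKer (n m : ℕ) : Ev n → ℝ := (mollBump n m).normed volume

/-- Mollification of `g` at scale `1 / (m + 1)`. -/
def moll {F : Type*} [NormedAddCommGroup F] [NormedSpace ℝ F] (m : ℕ) (g : Ev n → F) :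
    Ev n → F :=
  mollKer n m ⋆[lsmul ℝ ℝ, volume] g

lemma mollKer_nonneg (m : ℕ) (x : Ev n) : 0 ≤ mollKer n m x := (mollBump n m).nonneg_normed x

lemma contDiff_mollKer (m : ℕ) : ContDiff ℝ ∞ (mollKer n m) := (mollBump n m).contDiff_normed

lemma continuous_mollKer (m : ℕ) : Continuous (mollKer n m) := (contDiff_mollKer m).continuous

lemma hasCompactSupport_mollKer (m : ℕ) : HasCompactSupport (mollKer n m) :=
  (mollBump n m).hasCompactSupport_normed

lemma tsupport_mollKer (m : ℕ) : tsupport (mollKer n m) = closedBall 0 (1 / ((m : ℝ) + 1)) :=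
  (mollBump n m).tsupport_normed_eq

lemma integral_mollKer (m : ℕ) : ∫ x, mollKer n m x = 1 := (mollBump n m).integral_normed

lemma integrable_mollKer (m : ℕ) : Integrable (mollKer n m) := (mollBump n m).integrable_normed

lemma lintegral_mollKer (m : ℕ) : ∫⁻ x, ‖mollKer n m x‖ₑ = 1 := by
  have h := ofReal_integral_eq_lintegral_ofReal (integrable_mollKer (n := n) m)
    (ae_of_all _ (mollKer_nonneg m))
  rw [integral_mollKer, ENNReal.ofReal_one] at h
  rw [h]
  exact lintegral_congr fun x => Real.enorm_of_nonneg (mollKer_nonneg m x)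

lemma mollKer_eq_zero {m : ℕ} {x : Ev n} (h : 1 / ((m : ℝ) + 1) < ‖x‖) : mollKer n m x = 0 := by
  apply image_eq_zero_of_notMem_tsupport
  rw [tsupport_mollKer]
  simpa using h

variable {F : Type*} [NormedAddCommGroup F] [NormedSpace ℝ F]

lemma moll_apply (m : ℕ) (g : Ev n → F) (x : Ev n) :
    moll m g x = ∫ y, mollKer n m (x - y) • g y := by
  rw [moll, convolution_eq_swap]
  rfl

lemma moll_congr {m : ℕ} {g g' : Ev n → F} {x : Ev n}
    (h : EqOn g g' (closedBall x (1 / ((m : ℝ) + 1)))) : moll m g x = moll m g' x := by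
  rw [moll_apply, moll_apply]
  refine integral_congr_ae (ae_of_all _ fun y => ?_)
  by_cases hy : y ∈ closedBall x (1 / ((m : ℝ) + 1))
  · simp [h hy]
  · have : mollKer n m (x - y) = 0 := mollKer_eq_zero (by
      rw [mem_closedBall, dist_eq_norm, norm_sub_rev] at hy
      exact not_le.1 hy)
    simp [this]

lemma contDiff_moll (m : ℕ) {g : Ev n → F} (hg : LocallyIntegrable g) :
    ContDiff ℝ ∞ (moll m g) :=
  (hasCompactSupport_mollKer m).contDiff_convolution_left _ (contDiff_mollKer m) hg

lemma continuous_moll (m : ℕ) {g : Ev n → F} (hg : LocallyIntegrable g) :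
    Continuous (moll m g) := (contDiff_moll m hg).continuous

lemma integrable_mollKer_smul (m : ℕ) {g : Ev n → F} (hg : LocallyIntegrable g) (x : Ev n) :
    Integrable fun y => mollKer n m (x - y) • g y := by
  have h := (hasCompactSupport_mollKer m).convolutionExists_left (lsmul ℝ ℝ)
    (continuous_mollKer m) hg x
  have h2 := h.integrable_swap
  exact h2

lemma tendsto_moll_ae [CompleteSpace F] {g : Ev n → F} (hg : LocallyIntegrable g) :
    ∀ᵐ x, Tendsto (fun m => moll m g x) atTop (𝓝 (g x)) := by
  refine ContDiffBump.ae_convolution_tendsto_right_of_locallyIntegrable (K := 2)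
    (φ := fun m => mollBump n m) ?_ ?_ hg
  · exact tendsto_one_div_add_atTop_nhds_zero_nat
  · refine Eventually.of_forall fun m => ?_
    simp only [mollBump]
    apply le_of_eq
    field_simp

lemma gradient_apply (f : Ev n → ℝ) (x : Ev n) (j : Fin n) :
    gradient f x j = fderiv ℝ f x (EuclideanSpace.single j 1) := by
  have h : inner ℝ (gradient f x) (EuclideanSpace.single j 1)
      = fderiv ℝ f x (EuclideanSpace.single j 1) := by
    rw [gradient, InnerProductSpace.toDual_symm_apply]
  rw [← h, EuclideanSpace.inner_single_right]
  simp

lemma norm_gradient (f : Ev n → ℝ) (x : Ev n) : ‖gradient f x‖ = ‖fderiv ℝ f x‖ := by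
  rw [gradient, LinearIsometryEquiv.norm_map]

lemma fderiv_moll_apply (m : ℕ) {g : Ev n → ℝ} (hg : LocallyIntegrable g) (x v : Ev n) :
    fderiv ℝ (moll m g) x v = ∫ y, g y * fderiv ℝ (mollKer n m) (x - y) v := by
  have h := (hasCompactSupport_mollKer m).hasFDerivAt_convolution_left (lsmul ℝ ℝ)
    ((contDiff_mollKer m).of_le (by simp)) hg x
  have hs : HasCompactSupport (fderiv ℝ (mollKer n m)) := (hasCompactSupport_mollKer m).fderiv ℝ
  have hc : Continuous (fderiv ℝ (mollKer n m)) := (contDiff_mollKer m).continuous_fderiv (by simp)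
  have h_integrable := (hs.convolutionExists_left (ContinuousLinearMap.precompL (Ev n) (lsmul ℝ ℝ))
    hc hg x).integrable_swap
  rw [moll, h.fderiv, convolution_eq_swap, ContinuousLinearMap.integral_apply h_integrable]
  refine integral_congr_ae (ae_of_all _ fun y => ?_)
  simp [ContinuousLinearMap.precompL_apply, mul_comm]

/-- Mollification commutes with weak differentiation. -/
lemma gradient_moll {Ω W : Set (Ev n)} (hΩ : MeasurableSet Ω) (hW : MeasurableSet W)
    (hWΩ : W ⊆ Ω) {v : Ev n → ℝ} {G : Ev n → Ev n} (hv : IntegrableOn v W)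
    (hG : IntegrableOn G W) (h : IsWeakGrad Ω v G) {m : ℕ} {x : Ev n}
    (hx : closedBall x (1 / ((m : ℝ) + 1)) ⊆ W) :
    gradient (moll m (W.indicator v)) x = moll m (W.indicator G) x := by
  have hvi : LocallyIntegrable (W.indicator v) :=
    (hv.integrable_indicator hW).locallyIntegrable
  have hGi : LocallyIntegrable (W.indicator G) :=
    (hG.integrable_indicator hW).locallyIntegrable
  ext j
  set e : Ev n := EuclideanSpace.single j 1
  let η : Ev n → ℝ := fun y => mollKer n m (x - y)
  have hηd : ContDiff ℝ ∞ η := (contDiff_mollKer m).comp (contDiff_const.sub contDiff_id)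
  have hηsupp : ∀ y, y ∉ closedBall x (1 / ((m : ℝ) + 1)) → η y = 0 := by
    intro y hy
    apply mollKer_eq_zero
    rw [mem_closedBall, dist_eq_norm, norm_sub_rev] at hy
    exact not_le.1 hy
  have hηt : tsupport η ⊆ closedBall x (1 / ((m : ℝ) + 1)) := by
    apply closure_minimal _ isClosed_closedBall
    intro y hy
    by_contra hc
    exact hy (hηsupp y hc)
  have hηc : HasCompactSupport η :=
    HasCompactSupport.intro (isCompact_closedBall x _) (fun y hy => hηsupp y hy)
  have hηder : ∀ y, fderiv ℝ η y e = - fderiv ℝ (mollKer n m) (x - y) e := by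
    intro y
    have hd : HasFDerivAt (mollKer n m) (fderiv ℝ (mollKer n m) (x - y)) (x - y) :=
      ((contDiff_mollKer m).differentiable (by simp) _).hasFDerivAt
    have := hd.comp y ((hasFDerivAt_id y).const_sub x)
    have h2 : HasFDerivAt η _ y := this
    rw [h2.fderiv]
    simp
  have hηder0 : ∀ y, y ∉ W → fderiv ℝ η y e = 0 := by
    intro y hy
    have : y ∉ tsupport (fderiv ℝ η) := fun hc =>
      hy (hx (hηt (tsupport_fderiv_subset ℝ hc)))
    rw [image_eq_zero_of_notMem_tsupport this]
    simp
  have key := h.2 η hηd hηc (hηt.trans (hx.trans hWΩ)) j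
  rw [gradient_apply, fderiv_moll_apply m hvi, moll_apply]
  have hcoord : (∫ y, mollKer n m (x - y) • W.indicator G y) j
      = ∫ y, (mollKer n m (x - y) • W.indicator G y) j :=
    ((EuclideanSpace.proj j : Ev n →L[ℝ] ℝ).integral_comp_comm
      (integrable_mollKer_smul m hGi x)).symm
  rw [hcoord]
  have h1 : ∫ y, W.indicator v y * fderiv ℝ (mollKer n m) (x - y) e
      = - ∫ y in Ω, v y * fderiv ℝ η y e := by
    rw [← integral_neg, setIntegral_eq_of_subset_of_forall_sdiff_eq_zero (s := W) (t := Ω)]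
    · rw [← integral_indicator hW]
      refine integral_congr_ae (ae_of_all _ fun y => ?_)
      by_cases hy : y ∈ W <;> simp [hy, hηder]
    · exact hΩ
    · exact hWΩ
    · rintro y ⟨-, hy⟩
      simp [hηder0 y hy]
  have h2 : ∫ y, (mollKer n m (x - y) • W.indicator G y) j = ∫ y in Ω, G y j * η y := by
    rw [setIntegral_eq_of_subset_of_forall_sdiff_eq_zero (s := W) (t := Ω) hΩ hWΩ]
    · rw [← integral_indicator hW]
      refine integral_congr_ae (ae_of_all _ fun y => ?_)
      by_cases hy : y ∈ W <;> simp [hy, η, mul_comm]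
    · rintro y ⟨-, hy⟩
      rw [hηsupp y (fun hc => hy (hx hc)), mul_zero]
  rw [h1, key, h2, neg_neg]

end Mollifier

end Paper

namespace Paper

section MollifierNorms

open scoped Convolution ContDiff

variable {n : ℕ} {F : Type*} [NormedAddCommGroup F] [NormedSpace ℝ F]

lemma lintegral_mollKer_sub (m : ℕ) (x : Ev n) : ∫⁻ y, ‖mollKer n m (x - y)‖ₑ = 1 := by
  rw [lintegral_sub_left_eq_self (fun z => ‖mollKer n m z‖ₑ) x, lintegral_mollKer]

lemma enorm_moll_rpow_le (m : ℕ) {g : Ev n → F} (hg : AEStronglyMeasurable g volume) {p : ℝ}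
    (hp : 1 ≤ p) (x : Ev n) :
    ‖moll m g x‖ₑ ^ p ≤ ∫⁻ y, ‖mollKer n m (x - y)‖ₑ * ‖g y‖ₑ ^ p := by
  have hρ : Measurable fun y : Ev n => ‖mollKer n m (x - y)‖ₑ :=
    ((continuous_mollKer m).comp (continuous_const.sub continuous_id)).enorm.measurable
  set μ : Measure (Ev n) := volume.withDensity fun y => ‖mollKer n m (x - y)‖ₑ with hμ
  have hprob : IsProbabilityMeasure μ := ⟨by
    rw [hμ, withDensity_apply _ MeasurableSet.univ, setLIntegral_univ, lintegral_mollKer_sub]⟩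
  have hac : μ ≪ volume := withDensity_absolutelyContinuous _ _
  have hgμ : AEStronglyMeasurable g μ := hg.mono_ac hac
  have hp0 : 0 < p := by linarith
  have h1 : ‖moll m g x‖ₑ ≤ eLpNorm g 1 μ := by
    rw [moll_apply, eLpNorm_one_eq_lintegral_enorm, hμ,
      lintegral_withDensity_eq_lintegral_mul₀ hρ.aemeasurable hg.enorm]
    refine (enorm_integral_le_lintegral_enorm _).trans (le_of_eq (lintegral_congr fun y => ?_))
    rw [enorm_smul]
    rfl
  have h2 : eLpNorm g 1 μ ≤ eLpNorm g (ENNReal.ofReal p) μ :=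
    eLpNorm_le_eLpNorm_of_exponent_le (by simpa using hp) hgμ
  calc ‖moll m g x‖ₑ ^ p ≤ (eLpNorm g (ENNReal.ofReal p) μ) ^ p :=
        ENNReal.rpow_le_rpow (h1.trans h2) hp0.le
    _ = ∫⁻ y, ‖g y‖ₑ ^ p ∂μ := by
        rw [eLpNorm_eq_lintegral_rpow_enorm_toReal (by simpa using hp0) (by simp),
          ENNReal.toReal_ofReal hp0.le, ← ENNReal.rpow_mul, one_div_mul_cancel hp0.ne',
          ENNReal.rpow_one]
    _ = ∫⁻ y, ‖mollKer n m (x - y)‖ₑ * ‖g y‖ₑ ^ p := by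
        rw [hμ, lintegral_withDensity_eq_lintegral_mul₀ hρ.aemeasurable
          (hg.enorm.pow_const p)]
        rfl

lemma lintegral_moll_rpow_le (m : ℕ) {g : Ev n → F} (hg : AEStronglyMeasurable g volume) {p : ℝ}
    (hp : 1 ≤ p) : ∫⁻ x, ‖moll m g x‖ₑ ^ p ≤ ∫⁻ y, ‖g y‖ₑ ^ p := by
  calc ∫⁻ x, ‖moll m g x‖ₑ ^ p
      ≤ ∫⁻ x, ∫⁻ y, ‖mollKer n m (x - y)‖ₑ * ‖g y‖ₑ ^ p :=
        lintegral_mono fun x => enorm_moll_rpow_le m hg hp x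
    _ = ∫⁻ y, ∫⁻ x, ‖mollKer n m (x - y)‖ₑ * ‖g y‖ₑ ^ p := by
        refine lintegral_lintegral_swap ?_
        refine AEMeasurable.mul ?_ ?_
        · exact ((continuous_mollKer m).comp
            (continuous_fst.sub continuous_snd)).enorm.measurable.aemeasurable
        · exact (hg.enorm.pow_const p).comp_quasiMeasurePreserving
            Measure.quasiMeasurePreserving_snd
    _ = ∫⁻ y, ‖g y‖ₑ ^ p := by
        refine lintegral_congr fun y => ?_
        have hmeas : Measurable fun x : Ev n => ‖mollKer n m (x - y)‖ₑ :=
          ((continuous_mollKer m).comp (continuous_id.sub continuous_const)).enorm.measurable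
        rw [lintegral_mul_const _ hmeas,
          lintegral_sub_right_eq_self (fun z => ‖mollKer n m z‖ₑ) y, lintegral_mollKer, one_mul]

lemma lintegral_moll_le (m : ℕ) {g : Ev n → F} (hg : AEStronglyMeasurable g volume) :
    ∫⁻ x, ‖moll m g x‖ₑ ≤ ∫⁻ y, ‖g y‖ₑ := by
  simpa using lintegral_moll_rpow_le m hg le_rfl

lemma norm_moll_le {m : ℕ} {g : Ev n → F} {R : ℝ} (hR : ∀ y, ‖g y‖ ≤ R) (x : Ev n) :
    ‖moll m g x‖ ≤ R := by
  have hR0 : 0 ≤ R := (norm_nonneg _).trans (hR x)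
  have hi : Integrable fun y : Ev n => mollKer n m (x - y) :=
    (integrable_mollKer (n := n) m).comp_sub_left x
  rw [moll_apply]
  calc ‖∫ y, mollKer n m (x - y) • g y‖ ≤ ∫ y, mollKer n m (x - y) * R := by
        refine norm_integral_le_of_norm_le (hi.mul_const R) (ae_of_all _ fun y => ?_)
        rw [norm_smul, Real.norm_of_nonneg (mollKer_nonneg m _)]
        exact mul_le_mul_of_nonneg_left (hR y) (mollKer_nonneg m _)
    _ = R := by
        rw [integral_mul_const, integral_sub_left_eq_self (mollKer n m) volume x,
          integral_mollKer, one_mul]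

/-- Mollifications of an integrable function converge to it in `L¹`. -/
lemma tendsto_lintegral_moll_sub [CompleteSpace F] {g : Ev n → F} (hg : Integrable g) :
    Tendsto (fun m => ∫⁻ x, ‖moll m g x - g x‖ₑ) atTop (𝓝 0) := by
  have hgl := hg.locallyIntegrable
  have hmm : ∀ m, AEStronglyMeasurable (moll m g) volume := fun m =>
    (continuous_moll m hgl).aestronglyMeasurable
  set I := ∫⁻ x, ‖g x‖ₑ with hI
  have hIt : I ≠ ⊤ := hg.2.ne
  have hle : ∀ m, ∫⁻ x, ‖moll m g x‖ₑ ≤ I := fun m => lintegral_moll_le m hg.1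
  have hae := tendsto_moll_ae hgl
  set a : ℕ → ℝ≥0∞ := fun m => ∫⁻ x, ‖moll m g x - g x‖ₑ with ha
  let f : ℕ → Ev n → ℝ≥0∞ := fun m x => ‖moll m g x‖ₑ + ‖g x‖ₑ - ‖moll m g x - g x‖ₑ
  have hpt : ∀ m x, ‖moll m g x - g x‖ₑ ≤ ‖moll m g x‖ₑ + ‖g x‖ₑ := fun m x =>
    enorm_sub_le
  have hfm : ∀ m, AEMeasurable (f m) volume := fun m =>
    ((hmm m).enorm.add hg.1.enorm).sub ((hmm m).sub hg.1).enorm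
  have hfat := lintegral_liminf_le' (μ := volume) (u := atTop) hfm
  have hlim : ∀ᵐ x, liminf (fun m => f m x) atTop = ‖g x‖ₑ + ‖g x‖ₑ := by
    filter_upwards [hae] with x hx
    have h1 : Tendsto (fun m => ‖moll m g x‖ₑ + ‖g x‖ₑ) atTop (𝓝 (‖g x‖ₑ + ‖g x‖ₑ)) :=
      (hx.enorm).add tendsto_const_nhds
    have h2 : Tendsto (fun m => ‖moll m g x - g x‖ₑ) atTop (𝓝 0) := by
      have := (hx.sub_const (g x)).enorm
      simpa using this
    have h3 := ENNReal.Tendsto.sub h1 h2 (Or.inr (by simp))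
    rw [tsub_zero] at h3
    exact h3.liminf_eq
  rw [lintegral_congr_ae hlim, lintegral_add_left' hg.1.enorm] at hfat
  have h_integrable : ∀ m, ∫⁻ x, f m x ≤ I + I - a m := by
    intro m
    have hat : a m ≠ ⊤ := by
      refine ne_top_of_le_ne_top (b := I + I) (by simp [hIt]) ?_
      calc a m ≤ ∫⁻ x, (‖moll m g x‖ₑ + ‖g x‖ₑ) := lintegral_mono (hpt m)
        _ = (∫⁻ x, ‖moll m g x‖ₑ) + I := lintegral_add_left' (hmm m).enorm _
        _ ≤ I + I := by gcongr; exact hle m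
    have hsub : AEMeasurable (fun x => ‖moll m g x - g x‖ₑ) volume := ((hmm m).sub hg.1).enorm
    have heq : ∫⁻ x, f m x = (∫⁻ x, (‖moll m g x‖ₑ + ‖g x‖ₑ)) - a m :=
      lintegral_sub' hsub hat (ae_of_all _ (hpt m))
    rw [heq, lintegral_add_left' (hmm m).enorm]
    gcongr
    exact hle m
  have h4 : I + I ≤ liminf (fun m => I + I - a m) atTop :=
    hfat.trans (liminf_le_liminf (Eventually.of_forall h_integrable))
  rw [ENNReal.tendsto_nhds_zero]
  intro ε hε
  by_cases hI0 : I + I = 0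
  · refine Eventually.of_forall fun m => ?_
    have : a m ≤ I + I := by
      calc a m ≤ ∫⁻ x, (‖moll m g x‖ₑ + ‖g x‖ₑ) := lintegral_mono (hpt m)
        _ = (∫⁻ x, ‖moll m g x‖ₑ) + I := lintegral_add_left' (hmm m).enorm _
        _ ≤ I + I := by gcongr; exact hle m
    exact (this.trans hI0.le).trans zero_le
  · have h5 : I + I - ε < I + I := ENNReal.sub_lt_self (by simp [hIt]) hI0 hε.ne'
    have h6 := eventually_lt_of_lt_liminf (h5.trans_le h4)
    filter_upwards [h6] with m hm
    by_contra hc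
    exact absurd hm (not_lt.2 (tsub_le_tsub_left (not_le.1 hc).le _))

end MollifierNorms

section WeakGradient

open scoped ContDiff

variable {n : ℕ}

lemma tendsto_of_forall_apply {ι : Type*} {l : Filter ι} {f : ι → Ev n} {a : Ev n}
    (h : ∀ j, Tendsto (fun k => f k j) l (𝓝 (a j))) : Tendsto f l (𝓝 a) :=
  ((PiLp.continuous_toLp 2 (fun _ : Fin n => ℝ)).tendsto _).comp (tendsto_pi_nhds.2 h)

lemma IsWeakGrad.locallyIntegrableOn {Ω : Set (Ev n)} {v : Ev n → ℝ} {G : Ev n → Ev n}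
    (h : IsWeakGrad Ω v G) : LocallyIntegrableOn G Ω := by
  have h1 : LocallyIntegrableOn (fun x => ∑ j, (G x j) • (EuclideanSpace.single j (1 : ℝ) : Ev n))
      Ω := by
    intro x hx
    choose! s hs hs' using fun j => h.1 j x hx
    refine ⟨⋂ j, s j, by simpa using hs, ?_⟩
    refine integrable_finsetSum _ fun j _ => ?_
    exact ((hs' j).mono_set (iInter_subset s j)).smul_const _
  convert h1 using 2 with x
  ext i
  simp [Finset.sum_apply, Pi.single_apply]

lemma IsWeakGrad.integrableOn {Ω K : Set (Ev n)} {v : Ev n → ℝ} {G : Ev n → Ev n}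
    (h : IsWeakGrad Ω v G) (hK : IsCompact K) (hKΩ : K ⊆ Ω) : IntegrableOn G K :=
  h.locallyIntegrableOn.integrableOn_compact_subset hKΩ hK

lemma IsWeakGrad.aestronglyMeasurable {Ω : Set (Ev n)} {v : Ev n → ℝ} {G : Ev n → Ev n}
    (h : IsWeakGrad Ω v G) : AEStronglyMeasurable G (volume.restrict Ω) :=
  h.locallyIntegrableOn.aestronglyMeasurable

/-- Integrals over an open set are determined by compact subsets. -/
lemma setLIntegral_le_of_forall_isCompact {Ω : Set (Ev n)} (hΩ : IsOpen Ω)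
    {f : Ev n → ℝ≥0∞} {c : ℝ≥0∞}
    (h : ∀ K, IsCompact K → K ⊆ Ω → ∫⁻ x in K, f x ≤ c) : ∫⁻ x in Ω, f x ≤ c := by
  obtain ⟨F, hFc, hFΩ, hFU, hFm⟩ := hΩ.exists_iUnion_isClosed
  let K : ℕ → Set (Ev n) := fun i => F i ∩ closedBall 0 i
  have hKm : Monotone K := fun i j hij =>
    inter_subset_inter (hFm hij) (closedBall_subset_closedBall (by exact_mod_cast hij))
  have hKU : ⋃ i, K i = Ω := by
    rw [← hFU]
    apply Subset.antisymm (iUnion_mono fun i => inter_subset_left)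
    intro x hx
    obtain ⟨i, hi⟩ := mem_iUnion.1 hx
    obtain ⟨j, hj⟩ := exists_nat_ge ‖x‖
    refine mem_iUnion.2 ⟨max i j, hFm (le_max_left i j) hi, ?_⟩
    simp only [mem_closedBall, dist_zero_right]
    exact hj.trans (by exact_mod_cast le_max_right i j)
  rw [← hKU, setLIntegral_iUnion_of_directed f (directed_of_isDirected_le hKm)]
  exact iSup_le fun i => h _ ((isCompact_closedBall 0 _).inter_left (hFc i))
    (inter_subset_left.trans (hFΩ i))

/-- The pairing of a weak gradient with a mollifying kernel is determined by the function. -/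
lemma exists_test_moll {Ω W : Set (Ev n)} (hΩ : MeasurableSet Ω) (hW : MeasurableSet W)
    (hWΩ : W ⊆ Ω) {m : ℕ} {x : Ev n} (hx : closedBall x (1 / ((m : ℝ) + 1)) ⊆ W) (j : Fin n) :
    ∃ θ : Ev n → ℝ, ContDiff ℝ (⊤ : ℕ∞) θ ∧ HasCompactSupport θ ∧ tsupport θ ⊆ Ω ∧
      ∀ (v : Ev n → ℝ) (G : Ev n → Ev n), IsWeakGrad Ω v G → IntegrableOn G W →
        moll m (W.indicator G) x j = ∫ y in Ω, v y * θ y := by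
  set e : Ev n := EuclideanSpace.single j 1
  let η : Ev n → ℝ := fun y => mollKer n m (x - y)
  have hηd : ContDiff ℝ ∞ η := (contDiff_mollKer m).comp (contDiff_const.sub contDiff_id)
  have hηsupp : ∀ y, y ∉ closedBall x (1 / ((m : ℝ) + 1)) → η y = 0 := by
    intro y hy
    apply mollKer_eq_zero
    rw [mem_closedBall, dist_eq_norm, norm_sub_rev] at hy
    exact not_le.1 hy
  have hηt : tsupport η ⊆ closedBall x (1 / ((m : ℝ) + 1)) := by
    apply closure_minimal _ isClosed_closedBall
    intro y hy
    by_contra hc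
    exact hy (hηsupp y hc)
  have hηc : HasCompactSupport η :=
    HasCompactSupport.intro (isCompact_closedBall x _) (fun y hy => hηsupp y hy)
  have hηΩ : tsupport η ⊆ Ω := hηt.trans (hx.trans hWΩ)
  have hsupp : Function.support (fun y => -fderiv ℝ η y e) ⊆ Function.support (fderiv ℝ η) :=
    fun y hy hc => hy (by simp [hc])
  have hts : tsupport (fun y => -fderiv ℝ η y e) ⊆ tsupport η :=
    (closure_mono hsupp).trans (tsupport_fderiv_subset ℝ)
  refine ⟨fun y => - fderiv ℝ η y e, ?_, ?_, hts.trans hηΩ, ?_⟩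
  · exact ((hηd.fderiv_right (m := ∞) (by simp)).clm_apply contDiff_const).neg
  · exact hηc.mono' ((subset_tsupport _).trans hts)
  intro v G h hG
  have hGi : LocallyIntegrable (W.indicator G) :=
    (hG.integrable_indicator hW).locallyIntegrable
  have key := h.2 η hηd hηc hηΩ j
  rw [moll_apply]
  have hcoord : (∫ y, mollKer n m (x - y) • W.indicator G y) j
      = ∫ y, (mollKer n m (x - y) • W.indicator G y) j :=
    ((EuclideanSpace.proj j : Ev n →L[ℝ] ℝ).integral_comp_comm
      (integrable_mollKer_smul m hGi x)).symm
  rw [hcoord]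
  have h2 : ∫ y, (mollKer n m (x - y) • W.indicator G y) j = ∫ y in Ω, G y j * η y := by
    rw [setIntegral_eq_of_subset_of_forall_sdiff_eq_zero (s := W) (t := Ω) hΩ hWΩ]
    · rw [← integral_indicator hW]
      refine integral_congr_ae (ae_of_all _ fun y => ?_)
      by_cases hy : y ∈ W <;> simp [hy, η, mul_comm]
    · rintro y ⟨-, hy⟩
      rw [hηsupp y (fun hc => hy (hx hc)), mul_zero]
  simp only [mul_neg, integral_neg]
  rw [h2, key, neg_neg]

/-- Lower semicontinuity of the `L_p` norm of weak gradients under distributional convergence. -/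
lemma IsWeakGrad.eLpNorm_le_of_tendsto {Ω : Set (Ev n)} (hΩ : IsOpen Ω) {p : ℝ} (hp : 1 ≤ p)
    {v : ℕ → Ev n → ℝ} {G : ℕ → Ev n → Ev n} {v0 : Ev n → ℝ} {G0 : Ev n → Ev n}
    (hG : ∀ k, IsWeakGrad Ω (v k) (G k)) (hG0 : IsWeakGrad Ω v0 G0)
    (hconv : ∀ θ : Ev n → ℝ, ContDiff ℝ (⊤ : ℕ∞) θ → HasCompactSupport θ → tsupport θ ⊆ Ω →
      Tendsto (fun k => ∫ x in Ω, v k x * θ x) atTop (𝓝 (∫ x in Ω, v0 x * θ x)))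
    {M : ℝ≥0∞} (hM : ∀ k, eLpNorm (G k) (ENNReal.ofReal p) (volume.restrict Ω) ≤ M) :
    eLpNorm G0 (ENNReal.ofReal p) (volume.restrict Ω) ≤ M := by
  have hp0 : 0 < p := by linarith
  have hconvE : ∀ (H : Ev n → Ev n) (S : Set (Ev n)),
      eLpNorm H (ENNReal.ofReal p) (volume.restrict S) ≤ M ↔ ∫⁻ x in S, ‖H x‖ₑ ^ p ≤ M ^ p := by
    intro H S
    rw [eLpNorm_eq_lintegral_rpow_enorm_toReal (by simpa using hp0) (by simp),
      ENNReal.toReal_ofReal hp0.le, one_div, ENNReal.rpow_inv_le_iff hp0]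
  rw [hconvE]
  refine setLIntegral_le_of_forall_isCompact hΩ fun K hK hKΩ => ?_
  obtain ⟨δ, hδ, hδΩ⟩ := hK.exists_cthickening_subset_open hΩ hKΩ
  set W := cthickening δ K
  have hWc : IsCompact W := hK.cthickening
  have hWm : MeasurableSet W := hWc.measurableSet
  have hi : ∀ k, IntegrableOn (G k) W := fun k => (hG k).integrableOn hWc hδΩ
  have hi0 : IntegrableOn G0 W := hG0.integrableOn hWc hδΩ
  obtain ⟨m0, hm0⟩ := exists_nat_one_div_lt hδ
  have hball : ∀ m ≥ m0, ∀ x ∈ K, closedBall x (1 / ((m : ℝ) + 1)) ⊆ W := by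
    intro m hm x hx
    refine (closedBall_subset_closedBall ?_).trans (closedBall_subset_cthickening hx δ)
    refine le_trans ?_ hm0.le
    apply one_div_le_one_div_of_le (by positivity)
    have : (m0 : ℝ) ≤ m := by exact_mod_cast hm
    linarith
  have hfat : ∀ {f : ℕ → Ev n → Ev n} {g : Ev n → Ev n}, (∀ k, Continuous (f k)) →
      (∀ᵐ x ∂(volume.restrict K), Tendsto (fun k => f k x) atTop (𝓝 (g x))) →
      (∀ᶠ k in atTop, ∫⁻ x in K, ‖f k x‖ₑ ^ p ≤ M ^ p) → ∫⁻ x in K, ‖g x‖ₑ ^ p ≤ M ^ p := by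
    intro f g hf hfg hb
    calc ∫⁻ x in K, ‖g x‖ₑ ^ p = ∫⁻ x in K, liminf (fun k => ‖f k x‖ₑ ^ p) atTop := by
          refine lintegral_congr_ae ?_
          filter_upwards [hfg] with x hx
          exact ((ENNReal.continuous_rpow_const.tendsto _).comp hx.enorm).liminf_eq.symm
      _ ≤ liminf (fun k => ∫⁻ x in K, ‖f k x‖ₑ ^ p) atTop :=
          lintegral_liminf_le' fun k => ((hf k).enorm.measurable.pow_const p).aemeasurable
      _ ≤ liminf (fun _ => M ^ p) atTop := liminf_le_liminf hb
      _ = M ^ p := by simp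
  have hLI : ∀ {H : Ev n → Ev n}, IntegrableOn H W → LocallyIntegrable (W.indicator H) :=
    fun h => (h.integrable_indicator hWm).locallyIntegrable
  have hstep : ∀ m ≥ m0, ∫⁻ x in K, ‖moll m (W.indicator G0) x‖ₑ ^ p ≤ M ^ p := by
    intro m hm
    refine hfat (f := fun k => moll m (W.indicator (G k))) (fun k => continuous_moll m (hLI (hi k)))
      ?_ (Eventually.of_forall fun k => ?_)
    · refine ae_restrict_of_forall_mem hK.measurableSet fun x hx => ?_
      refine tendsto_of_forall_apply fun j => ?_
      obtain ⟨θ, h1, h2, h3, h4⟩ := exists_test_moll hΩ.measurableSet hWm hδΩ (hball m hm x hx) j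
      simp_rw [h4 _ _ (hG _) (hi _), h4 _ _ hG0 hi0]
      exact hconv θ h1 h2 h3
    · calc ∫⁻ x in K, ‖moll m (W.indicator (G k)) x‖ₑ ^ p
          ≤ ∫⁻ x, ‖moll m (W.indicator (G k)) x‖ₑ ^ p := setLIntegral_le_lintegral _ _
        _ ≤ ∫⁻ x, ‖W.indicator (G k) x‖ₑ ^ p :=
            lintegral_moll_rpow_le m ((hi k).integrable_indicator hWm).1 hp
        _ = ∫⁻ x in W, ‖G k x‖ₑ ^ p := by
            rw [← lintegral_indicator hWm]
            refine lintegral_congr fun x => ?_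
            by_cases hx : x ∈ W <;> simp [hx, hp0]
        _ ≤ ∫⁻ x in Ω, ‖G k x‖ₑ ^ p := lintegral_mono_set hδΩ
        _ ≤ M ^ p := (hconvE _ _).1 (hM k)
  refine hfat (f := fun m => moll m (W.indicator G0)) (fun m => continuous_moll m (hLI hi0)) ?_
    (eventually_atTop.2 ⟨m0, hstep⟩)
  filter_upwards [ae_restrict_of_ae (tendsto_moll_ae (hLI hi0)),
    ae_restrict_mem hK.measurableSet] with x hx hxK
  rwa [indicator_of_mem (self_subset_cthickening K hxK)] at hx

end WeakGradient

end Paper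

namespace Paper

section Translation

open scoped ContDiff

variable {n : ℕ}

lemma enorm_add_sub_le_lintegral_gradient {f : Ev n → ℝ} (hf : ContDiff ℝ ∞ f) (x h : Ev n) :
    ‖f (x + h) - f x‖ₑ ≤ ‖h‖ₑ * ∫⁻ t in Icc (0 : ℝ) 1, ‖gradient f (x + t • h)‖ₑ := by
  have hd : ∀ t : ℝ, HasDerivAt (fun s : ℝ => f (x + s • h)) (fderiv ℝ f (x + t • h) h) t := by
    intro t
    have h1 : HasDerivAt (fun s : ℝ => x + s • h) h t := by
      simpa using ((hasDerivAt_id t).smul_const h).const_add x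
    exact ((hf.differentiable (by simp) _).hasFDerivAt).comp_hasDerivAt t h1
  have hcont : Continuous fun t : ℝ => fderiv ℝ f (x + t • h) h :=
    ((hf.continuous_fderiv (by simp)).comp (by fun_prop)).clm_apply continuous_const
  have hftc := intervalIntegral.integral_eq_sub_of_hasDerivAt (a := 0) (b := 1)
    (fun t _ => hd t) (hcont.intervalIntegrable _ _)
  simp only [one_smul, zero_smul, add_zero] at hftc
  rw [← hftc, intervalIntegral.integral_of_le zero_le_one, ← integral_Icc_eq_integral_Ioc]
  refine (enorm_integral_le_lintegral_enorm _).trans ?_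
  rw [← lintegral_const_mul' _ _ enorm_ne_top]
  refine lintegral_mono fun t => ?_
  have h2 : ‖gradient f (x + t • h)‖ₑ = ‖fderiv ℝ f (x + t • h)‖ₑ := by
    rw [← ofReal_norm, ← ofReal_norm, norm_gradient]
  rw [h2, mul_comm]
  exact ContinuousLinearMap.le_opENorm _ _

/-- Translations are controlled in `L¹` by the weak gradient. -/
lemma IsWeakGrad.lintegral_translate_le {Ω U K : Set (Ev n)} (hΩ : MeasurableSet Ω)
    (hU : MeasurableSet U) (hUΩ : U ⊆ Ω) (hK : MeasurableSet K) {v : Ev n → ℝ} {G : Ev n → Ev n}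
    (hv : IntegrableOn v U) (hG : IntegrableOn G U) (hw : IsWeakGrad Ω v G) {δ : ℝ} (hδ : 0 < δ)
    {h : Ev n} (hseg : ∀ x ∈ K, ∀ t ∈ Icc (0 : ℝ) 1, closedBall (x + t • h) δ ⊆ U) :
    ∫⁻ x in K, ‖v (x + h) - v x‖ₑ ≤ ‖h‖ₑ * ∫⁻ x in U, ‖G x‖ₑ := by
  have hvi := hv.integrable_indicator hU
  have hGi := hG.integrable_indicator hU
  have hvl : LocallyIntegrable (U.indicator v) := hvi.locallyIntegrable
  have hGl : LocallyIntegrable (U.indicator G) := hGi.locallyIntegrable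
  obtain ⟨m0, hm0⟩ := exists_nat_one_div_lt hδ
  have hm : ∀ m ≥ m0, 1 / ((m : ℝ) + 1) ≤ δ := by
    intro m hm
    refine le_trans ?_ hm0.le
    apply one_div_le_one_div_of_le (by positivity)
    have : (m0 : ℝ) ≤ m := by exact_mod_cast hm
    linarith
  set V : ℕ → Ev n → ℝ := fun m => moll m (U.indicator v) with hV
  have hVc : ∀ m, Continuous (V m) := fun m => continuous_moll m hvl
  have hbound : ∀ m ≥ m0, ∫⁻ x in K, ‖V m (x + h) - V m x‖ₑ ≤ ‖h‖ₑ * ∫⁻ x in U, ‖G x‖ₑ := by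
    intro m hmm
    have hmG : Continuous (moll m (U.indicator G)) := continuous_moll m hGl
    calc ∫⁻ x in K, ‖V m (x + h) - V m x‖ₑ
        ≤ ∫⁻ x in K, ‖h‖ₑ * ∫⁻ t in Icc (0 : ℝ) 1, ‖moll m (U.indicator G) (x + t • h)‖ₑ := by
          refine setLIntegral_mono' hK fun x hx => ?_
          refine (enorm_add_sub_le_lintegral_gradient (contDiff_moll m hvl) x h).trans ?_
          gcongr ‖h‖ₑ * ?_
          refine setLIntegral_mono' (measurableSet_Icc (a := (0 : ℝ)) (b := 1)) fun t ht => ?_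
          rw [gradient_moll hΩ hU hUΩ hv hG hw
            ((closedBall_subset_closedBall (hm m hmm)).trans (hseg x hx t ht))]
      _ = ‖h‖ₑ * ∫⁻ x in K, ∫⁻ t in Icc (0 : ℝ) 1, ‖moll m (U.indicator G) (x + t • h)‖ₑ :=
          lintegral_const_mul' _ _ enorm_ne_top
      _ = ‖h‖ₑ * ∫⁻ t in Icc (0 : ℝ) 1, ∫⁻ x in K, ‖moll m (U.indicator G) (x + t • h)‖ₑ := by
          rw [lintegral_lintegral_swap]
          refine (Continuous.measurable ?_).aemeasurable
          exact (hmG.comp (by fun_prop)).enorm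
      _ ≤ ‖h‖ₑ * ∫⁻ t in Icc (0 : ℝ) 1, ∫⁻ x in U, ‖G x‖ₑ := by
          gcongr ‖h‖ₑ * ?_
          refine lintegral_mono fun t => ?_
          calc ∫⁻ x in K, ‖moll m (U.indicator G) (x + t • h)‖ₑ
              ≤ ∫⁻ x, ‖moll m (U.indicator G) (x + t • h)‖ₑ := setLIntegral_le_lintegral _ _
            _ = ∫⁻ x, ‖moll m (U.indicator G) x‖ₑ :=
                lintegral_add_right_eq_self (fun x => ‖moll m (U.indicator G) x‖ₑ) (t • h)
            _ ≤ ∫⁻ x, ‖U.indicator G x‖ₑ := lintegral_moll_le m hGi.1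
            _ = ∫⁻ x in U, ‖G x‖ₑ := by
                rw [← lintegral_indicator hU]
                refine lintegral_congr fun x => ?_
                by_cases hx : x ∈ U <;> simp [hx]
      _ = ‖h‖ₑ * ∫⁻ x in U, ‖G x‖ₑ := by simp
  have hae := tendsto_moll_ae hvl
  have hae2 : ∀ᵐ x, Tendsto (fun m => V m (x + h)) atTop (𝓝 (U.indicator v (x + h))) :=
    (measurePreserving_add_right volume h).quasiMeasurePreserving.ae hae
  calc ∫⁻ x in K, ‖v (x + h) - v x‖ₑ
      = ∫⁻ x in K, liminf (fun m => ‖V m (x + h) - V m x‖ₑ) atTop := by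
        refine lintegral_congr_ae ?_
        filter_upwards [ae_restrict_of_ae hae, ae_restrict_of_ae hae2, ae_restrict_mem hK]
          with x h1 h2 hx
        have hx0 : x ∈ U := by
          have := hseg x hx 0 (by simp) (mem_closedBall_self hδ.le)
          simpa using this
        have hx1 : x + h ∈ U := by
          have := hseg x hx 1 (by simp) (mem_closedBall_self hδ.le)
          simpa using this
        rw [indicator_of_mem hx0] at h1
        rw [indicator_of_mem hx1] at h2
        exact (h2.sub h1).enorm.liminf_eq.symm
    _ ≤ liminf (fun m => ∫⁻ x in K, ‖V m (x + h) - V m x‖ₑ) atTop :=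
        lintegral_liminf_le' fun m => (Continuous.measurable
          (((hVc m).comp (by fun_prop)).sub (hVc m)).enorm).aemeasurable
    _ ≤ liminf (fun _ : ℕ => ‖h‖ₑ * ∫⁻ x in U, ‖G x‖ₑ) atTop :=
        liminf_le_liminf (eventually_atTop.2 ⟨m0, hbound⟩)
    _ = ‖h‖ₑ * ∫⁻ x in U, ‖G x‖ₑ := by simp

/-- A Poincaré-type inequality on balls for weak gradients. -/
lemma IsWeakGrad.lintegral_ball_ball_le {Ω : Set (Ev n)} (hΩ : MeasurableSet Ω)
    {v : Ev n → ℝ} {G : Ev n → Ev n} (hw : IsWeakGrad Ω v G) {x : Ev n} {r : ℝ} (hr : 0 < r)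
    (hball : ball x (2 * r) ⊆ Ω) (hv : IntegrableOn v (ball x (2 * r)))
    (hG : IntegrableOn G (ball x (2 * r))) :
    ∫⁻ y in ball x r, ∫⁻ z in ball x r, ‖v z - v y‖ₑ ≤
      volume (ball (0 : Ev n) (2 * r)) *
        (ENNReal.ofReal (2 * r) * ∫⁻ y in ball x (2 * r), ‖G y‖ₑ) := by
  set B := ball x r with hB
  have hBm : MeasurableSet B := measurableSet_ball
  have hBsub : B ⊆ ball x (2 * r) := ball_subset_ball (by linarith)
  set V := (ball x (2 * r)).indicator v with hV
  have hVm : AEStronglyMeasurable V volume := (hv.integrable_indicator measurableSet_ball).1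
  let K : Ev n → Set (Ev n) := fun h => B ∩ (fun y => y + h) ⁻¹' B
  have hKm : ∀ h, MeasurableSet (K h) := fun h => hBm.inter (measurable_add_const h hBm)
  let f : Ev n → Ev n → ℝ≥0∞ := fun y h =>
    B.indicator 1 y * (B.indicator 1 (y + h) * ‖V (y + h) - V y‖ₑ)
  have hfm : AEMeasurable (Function.uncurry f) ((volume : Measure (Ev n)).prod volume) := by
    have hq : Measure.QuasiMeasurePreserving (fun z : Ev n × Ev n => z.1 + z.2)
        ((volume : Measure (Ev n)).prod volume) volume :=
      Measure.quasiMeasurePreserving_snd.comp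
        (measurePreserving_prod_add (volume : Measure (Ev n)) volume).quasiMeasurePreserving
    have hind : Measurable (B.indicator (1 : Ev n → ℝ≥0∞)) := measurable_one.indicator hBm
    refine AEMeasurable.mul (hind.comp measurable_fst).aemeasurable (AEMeasurable.mul ?_ ?_)
    · exact (hind.comp (measurable_fst.add measurable_snd)).aemeasurable
    · exact ((hVm.comp_quasiMeasurePreserving hq).sub
        (hVm.comp_quasiMeasurePreserving Measure.quasiMeasurePreserving_fst)).enorm
  calc ∫⁻ y in B, ∫⁻ z in B, ‖v z - v y‖ₑ
      = ∫⁻ y, ∫⁻ h, f y h := by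
        rw [← lintegral_indicator hBm]
        refine lintegral_congr fun y => ?_
        by_cases hy : y ∈ B
        · rw [indicator_of_mem hy, ← lintegral_indicator hBm,
            ← lintegral_add_left_eq_self _ y]
          refine lintegral_congr fun h => ?_
          simp only [f, indicator_of_mem hy, Pi.one_apply, one_mul]
          by_cases hyh : y + h ∈ B
          · simp [hyh, hV, hBsub hy, hBsub hyh]
          · simp [hyh]
        · simp [f, hy]
    _ = ∫⁻ h, ∫⁻ y, f y h := lintegral_lintegral_swap hfm
    _ ≤ ∫⁻ h, (ball (0 : Ev n) (2 * r)).indicator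
          (fun _ => ENNReal.ofReal (2 * r) * ∫⁻ y in ball x (2 * r), ‖G y‖ₑ) h := by
        refine lintegral_mono fun h => ?_
        have h1 : ∫⁻ y, f y h = ∫⁻ y in K h, ‖v (y + h) - v y‖ₑ := by
          rw [← lintegral_indicator (hKm h)]
          refine lintegral_congr fun y => ?_
          by_cases hy : y ∈ B
          · by_cases hyh : y + h ∈ B
            · simp [f, K, hyh, hy, hV, hBsub hy, hBsub hyh]
            · simp [f, K, hyh]
          · simp [f, K, hy]
        rw [h1]
        by_cases hh : h ∈ ball (0 : Ev n) (2 * r)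
        · rw [indicator_of_mem hh]
          have hseg : ∀ y ∈ K h, ∀ t ∈ Icc (0 : ℝ) 1, closedBall (y + t • h) r ⊆ ball x (2 * r) := by
            rintro y ⟨hy, hyh⟩ t ht
            have hmem : y + t • h ∈ B := by
              have := (convex_ball x r).add_smul_sub_mem hy hyh ht
              rwa [add_sub_cancel_left] at this
            refine closedBall_subset_ball' ?_
            rw [mem_ball] at hmem
            linarith
          refine (hw.lintegral_translate_le hΩ measurableSet_ball hball (hKm h) hv hG hr hseg).trans ?_
          gcongr
          rw [← ofReal_norm]
          apply ENNReal.ofReal_le_ofReal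
          simpa using (mem_ball_zero_iff.1 hh).le
        · rw [indicator_of_notMem hh]
          have : K h = ∅ := by
            apply eq_empty_of_forall_notMem
            rintro y ⟨hy, hyh⟩
            apply hh
            rw [mem_ball_zero_iff]
            have h2 : dist (y + h) y ≤ dist (y + h) x + dist y x := dist_triangle_right _ _ _
            rw [mem_ball] at hy
            have h3 : dist (y + h) x < r := hyh
            simp only [dist_self_add_left] at h2
            linarith
          simp [this]
    _ = _ := by
        rw [lintegral_indicator measurableSet_ball, setLIntegral_const, mul_comm]

end Translation

end Paper

namespace Paper

section Rellich

open scoped ContDiff Convolution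
open ContinuousLinearMap (lsmul)

variable {n : ℕ}

lemma enorm_moll_sub_le (m : ℕ) {g : Ev n → ℝ} (hg : LocallyIntegrable g) (x : Ev n) :
    ‖moll m g x - g x‖ₑ ≤ ∫⁻ h, ‖mollKer n m h‖ₑ * ‖g (x + -h) - g x‖ₑ := by
  have h1 : moll m g x = ∫ h, mollKer n m h • g (x + -h) := by
    rw [moll, convolution_def]
    simp [sub_eq_add_neg]
  have hi1 : Integrable fun h => mollKer n m h • g (x + -h) := by
    have h := (hasCompactSupport_mollKer m).convolutionExists_left (lsmul ℝ ℝ)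
      (continuous_mollKer m) hg x
    have h2 := h.integrable
    simpa [sub_eq_add_neg] using h2
  have hi2 : Integrable fun h => mollKer n m h • g x := (integrable_mollKer m).smul_const _
  have h2 : ∫ h, mollKer n m h • g x = g x := by
    rw [integral_smul_const, integral_mollKer, one_smul]
  have h3 : moll m g x - g x = ∫ h, mollKer n m h * (g (x + -h) - g x) := by
    have h4 := integral_sub hi1 hi2
    rw [h2, ← h1] at h4
    simp only [← h4, smul_eq_mul, mul_sub]
  rw [h3]
  refine (enorm_integral_le_lintegral_enorm _).trans (lintegral_mono fun h => ?_)
  rw [enorm_mul]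

/-- The `L¹` distance from a function to its mollification is controlled by the weak gradient. -/
lemma IsWeakGrad.lintegral_moll_sub_le {Ω W K : Set (Ev n)} (hΩ : MeasurableSet Ω)
    (hW : MeasurableSet W) (hWΩ : W ⊆ Ω) (hK : MeasurableSet K) {v : Ev n → ℝ} {G : Ev n → Ev n}
    (hv : IntegrableOn v W) (hG : IntegrableOn G W) (hw : IsWeakGrad Ω v G) {δ : ℝ}
    (hδ : 0 < δ) (hKW : cthickening (2 * δ) K ⊆ W) {m : ℕ} (hm : 1 / ((m : ℝ) + 1) ≤ δ) :
    ∫⁻ x in K, ‖moll m (W.indicator v) x - W.indicator v x‖ₑ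
      ≤ ENNReal.ofReal (1 / ((m : ℝ) + 1)) * ∫⁻ x in W, ‖G x‖ₑ := by
  have hvi := hv.integrable_indicator hW
  have hsubW : ∀ x ∈ K, ∀ y, dist y x ≤ 2 * δ → y ∈ W := fun x hx y hy =>
    hKW (closedBall_subset_cthickening hx _ hy)
  calc ∫⁻ x in K, ‖moll m (W.indicator v) x - W.indicator v x‖ₑ
      ≤ ∫⁻ x in K, ∫⁻ h, ‖mollKer n m h‖ₑ * ‖W.indicator v (x + -h) - W.indicator v x‖ₑ :=
        lintegral_mono fun x => enorm_moll_sub_le m hvi.locallyIntegrable x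
    _ = ∫⁻ h, ∫⁻ x in K, ‖mollKer n m h‖ₑ * ‖W.indicator v (x + -h) - W.indicator v x‖ₑ := by
        refine lintegral_lintegral_swap ?_
        have hprod : (volume.restrict K).prod (volume : Measure (Ev n))
            = ((volume : Measure (Ev n)).prod volume).restrict (K ×ˢ univ) := by
          rw [← Measure.prod_restrict, Measure.restrict_univ]
        rw [hprod]
        refine AEMeasurable.restrict ?_
        have hq : Measure.QuasiMeasurePreserving (fun z : Ev n × Ev n => z.1 + -z.2)
            ((volume : Measure (Ev n)).prod volume) volume := by
          simp_rw [← sub_eq_add_neg]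
          exact quasiMeasurePreserving_sub volume volume
        have hρ : Measurable fun z : Ev n × Ev n => ‖mollKer n m z.2‖ₑ :=
          ((continuous_mollKer m).comp continuous_snd).enorm.measurable
        exact hρ.aemeasurable.mul ((hvi.1.comp_quasiMeasurePreserving hq).sub
            (hvi.1.comp_quasiMeasurePreserving Measure.quasiMeasurePreserving_fst)).enorm
    _ ≤ ∫⁻ h, ‖mollKer n m h‖ₑ * (ENNReal.ofReal (1 / ((m : ℝ) + 1)) * ∫⁻ x in W, ‖G x‖ₑ) := by
        refine lintegral_mono fun h => ?_
        rw [lintegral_const_mul' _ _ enorm_ne_top]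
        by_cases hh : ‖h‖ ≤ 1 / ((m : ℝ) + 1)
        · gcongr ‖mollKer n m h‖ₑ * ?_
          have hle : ∫⁻ x in K, ‖W.indicator v (x + -h) - W.indicator v x‖ₑ
              = ∫⁻ x in K, ‖v (x + -h) - v x‖ₑ := by
            refine setLIntegral_congr_fun hK fun x hx => ?_
            rw [indicator_of_mem (hsubW x hx _ ?_), indicator_of_mem (hsubW x hx _ ?_)]
            · simp [hδ.le]
            · simp only [dist_self_add_left, norm_neg]
              linarith
          rw [hle]
          refine (hw.lintegral_translate_le hΩ hW hWΩ hK hv hG hδ ?_).trans ?_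
          · intro x hx t ht y hy
            apply hsubW x hx
            have h1 : dist (x + t • -h) x ≤ δ := by
              simp only [dist_self_add_left, norm_smul, norm_neg, Real.norm_eq_abs]
              calc |t| * ‖h‖ ≤ 1 * ‖h‖ := by
                    gcongr
                    exact abs_le.2 ⟨by linarith [ht.1], ht.2⟩
                _ ≤ δ := by linarith
            have h2 := dist_triangle y (x + t • -h) x
            rw [mem_closedBall] at hy
            linarith
          · gcongr
            rw [← ofReal_norm, norm_neg]
            exact ENNReal.ofReal_le_ofReal hh
        · rw [mollKer_eq_zero (not_le.1 hh)]
          simp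
    _ = _ := by
        rw [lintegral_mul_const _ (continuous_mollKer m).enorm.measurable, lintegral_mollKer,
          one_mul]

lemma exists_test_moll_fun {Ω W : Set (Ev n)} (hΩ : MeasurableSet Ω) (hW : MeasurableSet W)
    (hWΩ : W ⊆ Ω) {m : ℕ} {x : Ev n} (hx : closedBall x (1 / ((m : ℝ) + 1)) ⊆ W) :
    ∃ θ : Ev n → ℝ, ContDiff ℝ (⊤ : ℕ∞) θ ∧ HasCompactSupport θ ∧ tsupport θ ⊆ Ω ∧
      ∀ v : Ev n → ℝ, moll m (W.indicator v) x = ∫ y in Ω, v y * θ y := by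
  let η : Ev n → ℝ := fun y => mollKer n m (x - y)
  have hηd : ContDiff ℝ ∞ η := (contDiff_mollKer m).comp (contDiff_const.sub contDiff_id)
  have hηsupp : ∀ y, y ∉ closedBall x (1 / ((m : ℝ) + 1)) → η y = 0 := by
    intro y hy
    apply mollKer_eq_zero
    rw [mem_closedBall, dist_eq_norm, norm_sub_rev] at hy
    exact not_le.1 hy
  have hηt : tsupport η ⊆ closedBall x (1 / ((m : ℝ) + 1)) := by
    apply closure_minimal _ isClosed_closedBall
    intro y hy
    by_contra hc
    exact hy (hηsupp y hc)
  have hηc : HasCompactSupport η :=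
    HasCompactSupport.intro (isCompact_closedBall x _) (fun y hy => hηsupp y hy)
  refine ⟨η, hηd, hηc, hηt.trans (hx.trans hWΩ), fun v => ?_⟩
  rw [moll_apply, setIntegral_eq_of_subset_of_forall_sdiff_eq_zero (s := W) (t := Ω) hΩ hWΩ]
  · rw [← integral_indicator hW]
    refine integral_congr_ae (ae_of_all _ fun y => ?_)
    by_cases hy : y ∈ W <;> simp [hy, η, mul_comm]
  · rintro y ⟨-, hy⟩
    rw [hηsupp y (fun hc => hy (hx hc)), mul_zero]

/-- Rellich-type compactness: distributional convergence of bounded functions with weak gradients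
bounded in `L¹` is strong in `L¹` on compact sets. -/
lemma tendsto_setLIntegral_sub_of_weakGrad {Ω : Set (Ev n)} (hΩ : IsOpen Ω)
    {v : ℕ → Ev n → ℝ} {G : ℕ → Ev n → Ev n} {v0 : Ev n → ℝ}
    (hv : ∀ k, AEStronglyMeasurable (v k) (volume.restrict Ω)) {R : ℝ}
    (hR : ∀ k, ∀ x ∈ Ω, ‖v k x‖ ≤ R)
    (hG : ∀ k, IsWeakGrad Ω (v k) (G k)) (hv0 : LocallyIntegrableOn v0 Ω)
    (hconv : ∀ θ : Ev n → ℝ, ContDiff ℝ (⊤ : ℕ∞) θ → HasCompactSupport θ → tsupport θ ⊆ Ω →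
      Tendsto (fun k => ∫ x in Ω, v k x * θ x) atTop (𝓝 (∫ x in Ω, v0 x * θ x)))
    {M : ℝ≥0∞} (hMt : M ≠ ⊤) (hM : ∀ k, ∫⁻ x in Ω, ‖G k x‖ₑ ≤ M)
    {K : Set (Ev n)} (hK : IsCompact K) (hKΩ : K ⊆ Ω) :
    Tendsto (fun k => ∫⁻ x in K, ‖v k x - v0 x‖ₑ) atTop (𝓝 0) := by
  rcases K.eq_empty_or_nonempty with rfl | ⟨x₀, hx₀⟩
  · simp
  have hR0 : 0 ≤ R := (norm_nonneg _).trans (hR 0 x₀ (hKΩ hx₀))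
  obtain ⟨δ', hδ', hδΩ'⟩ := hK.exists_cthickening_subset_open hΩ hKΩ
  obtain ⟨δ, rfl⟩ : ∃ δ, δ' = 2 * δ := ⟨δ' / 2, by ring⟩
  have hδ : 0 < δ := by linarith
  set W := cthickening (2 * δ) K with hWdef
  have hWc : IsCompact W := hK.cthickening
  have hWm : MeasurableSet W := hWc.measurableSet
  have hKW : K ⊆ W := self_subset_cthickening K
  have hi0 : IntegrableOn v0 W := hv0.integrableOn_compact_subset hδΩ' hWc
  have hiG : ∀ k, IntegrableOn (G k) W := fun k => (hG k).integrableOn hWc hδΩ'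
  have hi : ∀ k, IntegrableOn (v k) W := fun k =>
    IntegrableOn.of_bound hWc.measure_lt_top ((hv k).mono_set hδΩ') R
      (ae_restrict_of_forall_mem hWm fun x hx => hR k x (hδΩ' hx))
  have hI0 := hi0.integrable_indicator hWm
  have hI := fun k => (hi k).integrable_indicator hWm
  have hball : ∀ m : ℕ, 1 / ((m : ℝ) + 1) ≤ δ → ∀ x ∈ K, closedBall x (1 / ((m : ℝ) + 1)) ⊆ W :=
    fun m hm x hx => (closedBall_subset_closedBall (by linarith)).trans
      (closedBall_subset_cthickening hx (2 * δ))
  have hlimk : ∀ m : ℕ, 1 / ((m : ℝ) + 1) ≤ δ →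
      Tendsto (fun k => ∫⁻ x in K, ‖moll m (W.indicator (v k)) x - moll m (W.indicator v0) x‖ₑ)
        atTop (𝓝 0) := by
    intro m hm
    have hc0 : Continuous (moll m (W.indicator v0)) := continuous_moll m hI0.locallyIntegrable
    have hck := fun k => continuous_moll m (hI k).locallyIntegrable
    have := tendsto_lintegral_of_dominated_convergence' (μ := volume.restrict K)
      (F := fun k x => ‖moll m (W.indicator (v k)) x - moll m (W.indicator v0) x‖ₑ)
      (f := fun _ => 0) (fun x => ENNReal.ofReal R + ‖moll m (W.indicator v0) x‖ₑ)
      (fun k => ((hck k).sub hc0).enorm.measurable.aemeasurable)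
      (fun k => ae_of_all _ fun x => ?_) ?_ ?_
    · simpa using this
    · refine enorm_sub_le.trans (add_le_add ?_ le_rfl)
      rw [← ofReal_norm]
      refine ENNReal.ofReal_le_ofReal (norm_moll_le (fun y => ?_) x)
      by_cases hy : y ∈ W
      · rw [indicator_of_mem hy]
        exact hR k y (hδΩ' hy)
      · simpa [hy] using hR0
    · rw [lintegral_add_left measurable_const]
      have h2 : ∫⁻ x in K, ‖moll m (W.indicator v0) x‖ₑ < ⊤ :=
        (hc0.continuousOn.integrableOn_compact hK).2
      simp [h2.ne, hK.measure_lt_top.ne, ENNReal.mul_eq_top]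
    · refine ae_restrict_of_forall_mem hK.measurableSet fun x hx => ?_
      obtain ⟨θ, h1, h2, h3, h4⟩ := exists_test_moll_fun hΩ.measurableSet hWm hδΩ' (hball m hm x hx)
      have h5 := hconv θ h1 h2 h3
      simp_rw [← h4] at h5
      simpa using (h5.sub_const (moll m (W.indicator v0) x)).enorm
  rw [ENNReal.tendsto_nhds_zero]
  intro ε hε
  have hε3 : 0 < ε / 3 := ENNReal.div_pos hε.ne' (by simp)
  have hsmall : Tendsto (fun m : ℕ => 1 / ((m : ℝ) + 1)) atTop (𝓝 0) :=
    tendsto_one_div_add_atTop_nhds_zero_nat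
  have hsmallM : Tendsto (fun m : ℕ => ENNReal.ofReal (1 / ((m : ℝ) + 1)) * M) atTop (𝓝 0) := by
    have := ENNReal.Tendsto.mul_const (ENNReal.tendsto_ofReal hsmall) (b := M) (Or.inr hMt)
    simpa using this
  obtain ⟨m, hm1, hm2, hm3⟩ := ((hsmall.eventually_le_const hδ).and
    (((ENNReal.tendsto_nhds_zero.1 hsmallM) _ hε3).and
      ((ENNReal.tendsto_nhds_zero.1 (tendsto_lintegral_moll_sub hI0)) _ hε3))).exists
  filter_upwards [(ENNReal.tendsto_nhds_zero.1 (hlimk m hm1)) _ hε3] with k hk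
  have hA : ∫⁻ x in K, ‖moll m (W.indicator (v k)) x - W.indicator (v k) x‖ₑ ≤ ε / 3 := by
    refine ((hG k).lintegral_moll_sub_le hΩ.measurableSet hWm hδΩ' hK.measurableSet (hi k) (hiG k)
      hδ Subset.rfl hm1).trans (le_trans ?_ hm2)
    gcongr
    exact (lintegral_mono_set hδΩ').trans (hM k)
  have hC : ∫⁻ x in K, ‖moll m (W.indicator v0) x - W.indicator v0 x‖ₑ ≤ ε / 3 :=
    (setLIntegral_le_lintegral _ _).trans hm3
  have hm0 : AEStronglyMeasurable (moll m (W.indicator v0)) (volume.restrict K) :=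
    (continuous_moll m hI0.locallyIntegrable).aestronglyMeasurable
  have hmk : AEStronglyMeasurable (moll m (W.indicator (v k))) (volume.restrict K) :=
    (continuous_moll m (hI k).locallyIntegrable).aestronglyMeasurable
  calc ∫⁻ x in K, ‖v k x - v0 x‖ₑ
      ≤ ∫⁻ x in K, (‖moll m (W.indicator (v k)) x - W.indicator (v k) x‖ₑ
          + ‖moll m (W.indicator (v k)) x - moll m (W.indicator v0) x‖ₑ
          + ‖moll m (W.indicator v0) x - W.indicator v0 x‖ₑ) := by
        refine setLIntegral_mono' hK.measurableSet fun x hx => ?_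
        rw [indicator_of_mem (hKW hx), indicator_of_mem (hKW hx)]
        simp only [← edist_eq_enorm_sub]
        rw [edist_comm _ (v k x)]
        exact (edist_triangle4 _ _ _ _)
    _ = _ + _ + _ := by
        rw [lintegral_add_left', lintegral_add_left']
        · exact (hmk.sub (hI k).1.restrict).enorm
        · exact ((hmk.sub (hI k).1.restrict).enorm).add ((hmk.sub hm0).enorm)
    _ ≤ ε / 3 + ε / 3 + ε / 3 := by gcongr
    _ = ε := ENNReal.add_thirds ε

/-- Vector-valued Rellich compactness, as almost everywhere convergence of a subsequence. -/
lemma exists_subseq_tendsto_ae_of_weakGrad {Ω : Set (Ev n)} (hΩ : IsOpen Ω)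
    (hΩb : Bornology.IsBounded Ω)
    {f : ℕ → Ev n → Ev n} {G : ℕ → Fin n → Ev n → Ev n} {f0 : Ev n → Ev n}
    (hf : ∀ k, AEStronglyMeasurable (f k) (volume.restrict Ω)) {R : ℝ}
    (hR : ∀ k, ∀ x ∈ Ω, ‖f k x‖ ≤ R)
    (hG : ∀ k i, IsWeakGrad Ω (fun x => f k x i) (G k i)) (hf0 : LocallyIntegrableOn f0 Ω)
    (hconv : ∀ θ : Ev n → ℝ, ContDiff ℝ (⊤ : ℕ∞) θ → HasCompactSupport θ → tsupport θ ⊆ Ω →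
      ∀ i, Tendsto (fun k => ∫ x in Ω, f k x i * θ x) atTop (𝓝 (∫ x in Ω, f0 x i * θ x)))
    {M : ℝ≥0∞} (hMt : M ≠ ⊤) (hM : ∀ k i, ∫⁻ x in Ω, ‖G k i x‖ₑ ≤ M) :
    ∃ ns : ℕ → ℕ, StrictMono ns ∧
      ∀ᵐ x ∂(volume.restrict Ω), Tendsto (fun k => f (ns k) x) atTop (𝓝 (f0 x)) := by
  have hproj : ∀ i, Continuous fun y : Ev n => y i := fun i => by fun_prop
  have hfi : ∀ k i, AEStronglyMeasurable (fun x => f k x i) (volume.restrict Ω) := fun k i =>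
    (hproj i).comp_aestronglyMeasurable (hf k)
  have hf0m : AEStronglyMeasurable f0 (volume.restrict Ω) := hf0.aestronglyMeasurable
  have hf0i : ∀ i, LocallyIntegrableOn (fun x => f0 x i) Ω := by
    intro i x hx
    obtain ⟨s, hs, hs'⟩ := hf0 x hx
    exact ⟨s, hs, (EuclideanSpace.proj i : Ev n →L[ℝ] ℝ).integrable_comp hs'⟩
  have hKconv : ∀ K, IsCompact K → K ⊆ Ω →
      Tendsto (fun k => ∫⁻ x in K, ‖f k x - f0 x‖ₑ) atTop (𝓝 0) := by
    intro K hK hKΩ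
    have hsum : Tendsto (fun k => ∑ i, ∫⁻ x in K, ‖f k x i - f0 x i‖ₑ) atTop (𝓝 0) := by
      have := tendsto_finsetSum (Finset.univ : Finset (Fin n)) fun i _ =>
        tendsto_setLIntegral_sub_of_weakGrad hΩ (fun k => hfi k i)
          (fun k x hx => (PiLp.norm_apply_le (f k x) i).trans (hR k x hx)) (fun k => hG k i)
          (hf0i i) (fun θ h1 h2 h3 => hconv θ h1 h2 h3 i) hMt (fun k => hM k i) hK hKΩ
      simpa using this
    refine tendsto_of_tendsto_of_tendsto_of_le_of_le tendsto_const_nhds hsum (fun _ => zero_le)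
      fun k => ?_
    simp only
    have hsm : ∀ i ∈ (Finset.univ : Finset (Fin n)),
        AEMeasurable (fun x => ‖f k x i - f0 x i‖ₑ) (volume.restrict K) := fun i _ =>
      (((hfi k i).mono_set hKΩ).sub
        ((hproj i).comp_aestronglyMeasurable (hf0m.mono_set hKΩ))).enorm
    rw [← lintegral_finsetSum' _ hsm]
    refine lintegral_mono fun x => ?_
    have h1 : f k x - f0 x = ∑ i, EuclideanSpace.single i (f k x i - f0 x i) := by
      ext j
      simp [Finset.sum_apply, Pi.single_apply]
    rw [h1]
    refine (enorm_sum_le _ _).trans (le_of_eq (Finset.sum_congr rfl fun i _ => ?_))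
    rw [← ofReal_norm, ← ofReal_norm, PiLp.norm_single]
  have hmeas : TendstoInMeasure (volume.restrict Ω) f atTop f0 := by
    rw [tendstoInMeasure_iff_enorm]
    intro ε hε hεt
    rw [ENNReal.tendsto_nhds_zero]
    intro η hη
    have hη2 : η / 2 ≠ 0 := (ENNReal.half_pos hη.ne').ne'
    obtain ⟨K, hKΩ, hK, hKη⟩ := hΩ.measurableSet.exists_isCompact_sdiff_lt
      (μ := (volume : Measure (Ev n))) hΩb.measure_lt_top.ne hη2
    have hpos : 0 < ε * (η / 2) := ENNReal.mul_pos hε.ne' hη2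
    filter_upwards [(ENNReal.tendsto_nhds_zero.1 (hKconv K hK hKΩ)) _ hpos] with k hk
    have hcov : (volume.restrict Ω) {x | ε ≤ ‖f k x - f0 x‖ₑ}
        ≤ (volume.restrict K) {x | ε ≤ ‖f k x - f0 x‖ₑ} + volume (Ω \ K) := by
      have : volume.restrict Ω ≤ volume.restrict K + volume.restrict (Ω \ K) := by
        refine le_trans ?_ (Measure.restrict_union_le K (Ω \ K))
        exact Measure.restrict_mono (by rw [union_sdiff_cancel hKΩ]) le_rfl
      refine (this _).trans ?_
      rw [Measure.add_apply]
      exact add_le_add le_rfl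
        ((measure_mono (subset_univ _)).trans_eq (Measure.restrict_apply_univ _))
    refine hcov.trans ?_
    have hmk : AEMeasurable (fun x => ‖f k x - f0 x‖ₑ) (volume.restrict K) :=
      (((hf k).mono_set hKΩ).sub (hf0m.mono_set hKΩ)).enorm
    have hmarkov := mul_meas_ge_le_lintegral₀ hmk ε
    have h2 : (volume.restrict K) {x | ε ≤ ‖f k x - f0 x‖ₑ} ≤ η / 2 := by
      have := hmarkov.trans hk
      exact (ENNReal.mul_le_mul_iff_right hε.ne' hεt).1 this
    calc _ ≤ η / 2 + η / 2 := add_le_add h2 hKη.le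
      _ = η := ENNReal.add_halves η
  exact hmeas.exists_seq_tendsto_ae

end Rellich

end Paper

namespace Paper

section ChainRule

open scoped ContDiff

variable {n : ℕ}

/-- Products of boundedly convergent and `L¹`-convergent sequences converge in integral. -/
lemma tendsto_integral_mul_of_bounded {α : Type*} [MeasurableSpace α] {μ : Measure α}
    {a : ℕ → α → ℝ} {a0 : α → ℝ} {g : ℕ → α → ℝ} {g0 : α → ℝ} {A : ℝ}
    (ham : ∀ m, AEStronglyMeasurable (a m) μ) (hA : ∀ m x, ‖a m x‖ ≤ A)
    (ha : ∀ᵐ x ∂μ, Tendsto (fun m => a m x) atTop (𝓝 (a0 x)))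
    (hg : ∀ m, Integrable (g m) μ) (hg0 : Integrable g0 μ)
    (hlim : Tendsto (fun m => ∫⁻ x, ‖g m x - g0 x‖ₑ ∂μ) atTop (𝓝 0)) :
    Tendsto (fun m => ∫ x, a m x * g m x ∂μ) atTop (𝓝 (∫ x, a0 x * g0 x ∂μ)) := by
  have h1 : Tendsto (fun m => ∫ x, a m x * g0 x ∂μ) atTop (𝓝 (∫ x, a0 x * g0 x ∂μ)) := by
    refine tendsto_integral_of_dominated_convergence (fun x => A * ‖g0 x‖)
      (fun m => (ham m).mul hg0.1) (hg0.norm.const_mul A)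
      (fun m => ae_of_all _ fun x => ?_) ?_
    · rw [norm_mul]
      gcongr
      exact hA m x
    · filter_upwards [ha] with x hx
      exact hx.mul_const _
  have h2 : Tendsto (fun m => ∫ x, a m x * (g m x - g0 x) ∂μ) atTop (𝓝 0) := by
    rw [tendsto_zero_iff_enorm_tendsto_zero]
    have h3 : Tendsto (fun m => ENNReal.ofReal A * ∫⁻ x, ‖g m x - g0 x‖ₑ ∂μ) atTop (𝓝 0) := by
      simpa using ENNReal.Tendsto.const_mul hlim (a := ENNReal.ofReal A) (Or.inr (by simp))
    refine tendsto_of_tendsto_of_tendsto_of_le_of_le tendsto_const_nhds h3 (fun _ => zero_le)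
      fun m => ?_
    simp only
    rw [← lintegral_const_mul' _ _ (by simp)]
    refine (enorm_integral_le_lintegral_enorm _).trans (lintegral_mono fun x => ?_)
    rw [enorm_mul]
    gcongr
    rw [← ofReal_norm]
    exact ENNReal.ofReal_le_ofReal (hA m x)
  have h4 := h1.add h2
  rw [add_zero] at h4
  refine h4.congr fun m => ?_
  have hi : ∀ {h : α → ℝ}, Integrable h μ → Integrable (fun x => a m x * h x) μ := fun hh =>
    hh.bdd_mul (ham m) (ae_of_all _ (hA m))
  have hsub : Integrable (fun x => a m x * (g m x - g0 x)) μ := hi ((hg m).sub hg0)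
  rw [← integral_add (hi hg0) hsub]
  exact integral_congr_ae (ae_of_all _ fun x => by ring)

/-- The formal gradient of `u ∘ f` given the weak gradients `R i` of the components of `f`. -/
def chainGrad (u : Ev n → ℝ) (f : Ev n → Ev n) (R : Fin n → Ev n → Ev n) (x : Ev n) : Ev n :=
  ∑ i, (fderiv ℝ u (f x) (EuclideanSpace.single i 1)) • R i x

lemma LocallyIntegrableOn.coord {Ω : Set (Ev n)} {f : Ev n → Ev n}
    (hf : LocallyIntegrableOn f Ω) (i : Fin n) : LocallyIntegrableOn (fun x => f x i) Ω := by
  intro x hx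
  obtain ⟨s, hs, hs'⟩ := hf x hx
  exact ⟨s, hs, (EuclideanSpace.proj i : Ev n →L[ℝ] ℝ).integrable_comp hs'⟩

lemma bounded_fderiv_of_hasCompactSupport {u : Ev n → ℝ} (hu : ContDiff ℝ ∞ u)
    (hus : HasCompactSupport u) : ∃ A, ∀ y, ‖fderiv ℝ u y‖ ≤ A :=
  (hus.fderiv ℝ).exists_bound_of_continuous (hu.continuous_fderiv (by simp))

/-- The chain rule for smooth compactly supported outer functions. -/
lemma isWeakGrad_comp {Ω : Set (Ev n)} (hΩ : IsOpen Ω) {f : Ev n → Ev n}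
    {R : Fin n → Ev n → Ev n} (hf : LocallyIntegrableOn f Ω)
    (hR : ∀ i, IsWeakGrad Ω (fun x => f x i) (R i)) {u : Ev n → ℝ} (hu : ContDiff ℝ ∞ u)
    (hus : HasCompactSupport u) : IsWeakGrad Ω (u ∘ f) (chainGrad u f R) := by
  obtain ⟨A, hA⟩ := bounded_fderiv_of_hasCompactSupport hu hus
  obtain ⟨B, hB⟩ := hus.exists_bound_of_continuous hu.continuous
  have hA0 : 0 ≤ A := (norm_nonneg _).trans (hA 0)
  have hB0 : 0 ≤ B := (norm_nonneg _).trans (hB 0)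
  let e : Fin n → Ev n := fun i => EuclideanSpace.single i 1
  let D : Fin n → Ev n → ℝ := fun i y => fderiv ℝ u y (e i)
  have hDc : ∀ i, Continuous (D i) := fun i =>
    (hu.continuous_fderiv (by simp)).clm_apply continuous_const
  have hDA : ∀ i y, ‖D i y‖ ≤ A := by
    intro i y
    refine ((fderiv ℝ u y).le_opNorm _).trans ?_
    have : ‖e i‖ = 1 := by simp [e]
    rw [this, mul_one]
    exact hA y
  have hfm : AEStronglyMeasurable f (volume.restrict Ω) := hf.aestronglyMeasurable
  have hcoord : ∀ x j, chainGrad u f R x j = ∑ i, D i (f x) * R i x j := by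
    intro x j
    simp [chainGrad, D, e, Finset.sum_apply]
  refine ⟨fun j => ?_, ?_⟩
  · simp_rw [hcoord]
    intro x hx
    choose! s hs hs' using fun i => (hR i).1 j x hx
    refine ⟨(⋂ i, s i) ∩ Ω, inter_mem (by simpa using hs) self_mem_nhdsWithin, ?_⟩
    refine integrable_finsetSum _ fun i _ => ?_
    refine Integrable.bdd_mul (c := A) ?_ ?_ (ae_of_all _ fun y => hDA i (f y))
    · exact (hs' i).mono_set (inter_subset_left.trans (iInter_subset s i))
    · exact (hDc i).comp_aestronglyMeasurable (hfm.mono_set inter_subset_right)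
  intro η hη hηc hηΩ j
  set S := tsupport η with hS
  have hSc : IsCompact S := hηc
  obtain ⟨δ, hδ, hδΩ⟩ := hSc.exists_cthickening_subset_open hΩ hηΩ
  set W := cthickening δ S with hW
  have hWc : IsCompact W := hSc.cthickening
  have hWm : MeasurableSet W := hWc.measurableSet
  have hSW : S ⊆ W := self_subset_cthickening S
  have hfW : ∀ i, IntegrableOn (fun x => f x i) W := fun i =>
    (LocallyIntegrableOn.coord hf i).integrableOn_compact_subset hδΩ hWc
  have hRW : ∀ i, IntegrableOn (R i) W := fun i => (hR i).integrableOn hWc hδΩ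
  have hfl : ∀ i, LocallyIntegrable (W.indicator fun x => f x i) := fun i =>
    ((hfW i).integrable_indicator hWm).locallyIntegrable
  have hRi : ∀ i, Integrable (W.indicator (R i)) := fun i => (hRW i).integrable_indicator hWm
  have hRl : ∀ i, LocallyIntegrable (W.indicator (R i)) := fun i => (hRi i).locallyIntegrable
  obtain ⟨m0, hm0⟩ := exists_nat_one_div_lt hδ
  have hball : ∀ m, ∀ x ∈ S, closedBall x (1 / (((m + m0 : ℕ) : ℝ) + 1)) ⊆ W := by
    intro m x hx
    refine (closedBall_subset_closedBall ?_).trans (closedBall_subset_cthickening hx δ)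
    refine le_trans ?_ hm0.le
    apply one_div_le_one_div_of_le (by positivity)
    push_cast
    linarith [(Nat.cast_nonneg m : (0 : ℝ) ≤ m)]
  let F : ℕ → Ev n → Ev n := fun m x =>
    WithLp.toLp 2 fun i => moll (m + m0) (W.indicator fun x => f x i) x
  have hFs : ∀ m, ContDiff ℝ ∞ (F m) := fun m => by
    rw [contDiff_euclidean]
    exact fun i => contDiff_moll _ (hfl i)
  have hFae : ∀ᵐ x, Tendsto (fun m => F m x) atTop
      (𝓝 (WithLp.toLp 2 fun i => W.indicator (fun x => f x i) x)) := by
    filter_upwards [ae_all_iff.2 fun i => tendsto_moll_ae (hfl i)] with x hx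
    exact tendsto_of_forall_apply fun i => (tendsto_add_atTop_iff_nat m0).2 (hx i)
  have hηs : ∀ x, x ∉ S → η x = 0 := fun x hx => image_eq_zero_of_notMem_tsupport hx
  have hηds : ∀ x, x ∉ S → fderiv ℝ η x (e j) = 0 := fun x hx => by
    rw [image_eq_zero_of_notMem_tsupport fun hc => hx (tsupport_fderiv_subset ℝ hc)]
    simp
  have hηcont : Continuous η := hη.continuous
  have hηdc : Continuous fun x => fderiv ℝ η x (e j) :=
    (hη.continuous_fderiv (by simp)).clm_apply continuous_const
  have hηi : Integrable η := hηcont.integrable_of_hasCompactSupport hηc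
  have hηdcs : HasCompactSupport fun x => fderiv ℝ η x (e j) :=
    HasCompactSupport.intro hSc hηds
  have hηdi : Integrable fun x => fderiv ℝ η x (e j) :=
    hηdc.integrable_of_hasCompactSupport hηdcs
  obtain ⟨Cη, hCη⟩ := hηc.exists_bound_of_continuous hηcont
  have hCη0 : 0 ≤ Cη := (norm_nonneg _).trans (hCη 0)
  -- integration by parts for the mollified functions
  have hibp : ∀ m, ∫ x, u (F m x) * fderiv ℝ η x (e j)
      = - ∑ i, ∫ x, (D i (F m x) * η x) * moll (m + m0) (W.indicator (R i)) x j := by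
    intro m
    have huF : ContDiff ℝ ∞ (fun x => u (F m x)) := hu.comp (hFs m)
    have huFc : Continuous fun x => u (F m x) := huF.continuous
    have huFd : Continuous fun x => fderiv ℝ (fun x => u (F m x)) x (e j) :=
      (huF.continuous_fderiv (by simp)).clm_apply continuous_const
    have h1 := integral_mul_fderiv_eq_neg_fderiv_mul_of_integrable (μ := (volume : Measure (Ev n)))
      (𝕜 := ℝ) (f := fun x => u (F m x)) (g := η) (v := e j)
      ((huFd.mul hηcont).integrable_of_hasCompactSupport hηc.mul_left)
      ((huFc.mul hηdc).integrable_of_hasCompactSupport hηdcs.mul_left)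
      ((huFc.mul hηcont).integrable_of_hasCompactSupport hηc.mul_left)
      (fun x _ => huF.differentiable (by simp) x) (fun x _ => hη.differentiable (by simp) x)
    rw [h1, ← integral_finsetSum]
    · congr 1
      refine integral_congr_ae (ae_of_all _ fun x => ?_)
      by_cases hx : x ∈ S
      · simp only
        have hd : HasFDerivAt (fun x => u (F m x))
            ((fderiv ℝ u (F m x)).comp (fderiv ℝ (F m) x)) x :=
          ((hu.differentiable (by simp) _).hasFDerivAt).comp x
            (((hFs m).differentiable (by simp) _).hasFDerivAt)
        have hFj : ∀ i, (fderiv ℝ (F m) x (e j)) i = moll (m + m0) (W.indicator (R i)) x j := by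
          intro i
          have h2 := gradient_moll hΩ.measurableSet hWm hδΩ (hfW i) (hRW i) (hR i) (hball m x hx)
          rw [← h2, gradient_apply]
          have h3 : HasFDerivAt (fun x => F m x i)
              ((EuclideanSpace.proj i : Ev n →L[ℝ] ℝ).comp (fderiv ℝ (F m) x)) x :=
            (EuclideanSpace.proj i : Ev n →L[ℝ] ℝ).hasFDerivAt.comp x
              (((hFs m).differentiable (by simp) _).hasFDerivAt)
          have h4 : (fun x => F m x i) = moll (m + m0) (W.indicator fun x => f x i) := rfl
          rw [← h4, h3.fderiv]
          rfl
        have hsum : fderiv ℝ (F m) x (e j)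
            = ∑ i, (moll (m + m0) (W.indicator (R i)) x j) • e i := by
          ext i
          rw [hFj]
          simp [e, Finset.sum_apply, Pi.single_apply]
        rw [hd.fderiv, ContinuousLinearMap.comp_apply, hsum, map_sum, Finset.sum_mul]
        refine Finset.sum_congr rfl fun i _ => ?_
        simp only [map_smul, smul_eq_mul, D]
        ring
      · simp [hηs x hx]
    · intro i _
      refine Continuous.integrable_of_hasCompactSupport ?_ ?_
      · exact (((hDc i).comp (hFs m).continuous).mul hηcont).mul
          (((EuclideanSpace.proj j : Ev n →L[ℝ] ℝ).continuous).comp (continuous_moll _ (hRl i)))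
      · exact (hηc.mul_left).mul_right
  let f' : Ev n → Ev n := fun x => WithLp.toLp 2 fun i => W.indicator (fun x => f x i) x
  have hf' : ∀ x ∈ S, f' x = f x := by
    intro x hx
    ext i
    simp [f', hSW hx]
  have hlhs : Tendsto (fun m => ∫ x, u (F m x) * fderiv ℝ η x (e j)) atTop
      (𝓝 (∫ x, u (f' x) * fderiv ℝ η x (e j))) := by
    refine tendsto_integral_mul_of_bounded (A := B)
      (fun m => (hu.continuous.comp (hFs m).continuous).aestronglyMeasurable)
      (fun m x => hB _) ?_ (fun _ => hηdi) hηdi (by simp)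
    filter_upwards [hFae] with x hx
    exact (hu.continuous.tendsto _).comp hx
  have hrhs : Tendsto (fun m => ∑ i, ∫ x, (D i (F m x) * η x) *
      moll (m + m0) (W.indicator (R i)) x j) atTop
      (𝓝 (∑ i, ∫ x, (D i (f' x) * η x) * W.indicator (R i) x j)) := by
    refine tendsto_finsetSum _ fun i _ => ?_
    have hproj : ∀ {g : Ev n → Ev n}, Integrable g → Integrable fun x => g x j := fun hg =>
      (EuclideanSpace.proj j : Ev n →L[ℝ] ℝ).integrable_comp hg
    refine tendsto_integral_mul_of_bounded (A := A * Cη) (fun m => ?_) (fun m x => ?_) ?_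
      (fun m => hproj ?_) (hproj (hRi i)) ?_
    · exact (((hDc i).comp (hFs m).continuous).mul hηcont).aestronglyMeasurable
    · rw [norm_mul]
      exact mul_le_mul (hDA i _) (hCη x) (norm_nonneg _) hA0
    · filter_upwards [hFae] with x hx
      exact (((hDc i).tendsto _).comp hx).mul_const _
    · refine ⟨(continuous_moll _ (hRl i)).aestronglyMeasurable, ?_⟩
      exact (lintegral_moll_le _ (hRi i).1).trans_lt (hRi i).2
    · refine tendsto_of_tendsto_of_tendsto_of_le_of_le tendsto_const_nhds
        ((tendsto_add_atTop_iff_nat m0).2 (tendsto_lintegral_moll_sub (hRi i)))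
        (fun _ => zero_le) fun m => ?_
      refine lintegral_mono fun x => ?_
      rw [← ofReal_norm, ← ofReal_norm]
      apply ENNReal.ofReal_le_ofReal
      exact PiLp.norm_apply_le (moll (m + m0) (W.indicator (R i)) x - W.indicator (R i) x) j
  have hfinal := tendsto_nhds_unique hlhs ((hrhs.neg).congr fun m => (hibp m).symm)
  have hL : ∫ x in Ω, (u ∘ f) x * fderiv ℝ η x (e j) = ∫ x, u (f' x) * fderiv ℝ η x (e j) := by
    rw [← integral_indicator hΩ.measurableSet]
    refine integral_congr_ae (ae_of_all _ fun x => ?_)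
    by_cases hx : x ∈ S
    · simp [hηΩ hx, hf' x hx]
    · by_cases hxΩ : x ∈ Ω <;> simp [hxΩ, hηds x hx]
  have hRr : ∫ x in Ω, chainGrad u f R x j * η x
      = ∑ i, ∫ x, (D i (f' x) * η x) * W.indicator (R i) x j := by
    rw [← integral_indicator hΩ.measurableSet, ← integral_finsetSum]
    · refine integral_congr_ae (ae_of_all _ fun x => ?_)
      by_cases hx : x ∈ S
      · simp only [indicator_of_mem (hηΩ hx), indicator_of_mem (hSW hx), hf' x hx, hcoord,
          Finset.sum_mul]
        refine Finset.sum_congr rfl fun i _ => ?_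
        ring
      · by_cases hxΩ : x ∈ Ω <;> simp [hxΩ, hηs x hx]
    · intro i _
      have hf'm : AEStronglyMeasurable f' volume := by
        refine aestronglyMeasurable_of_tendsto_ae atTop
          (fun m => (hFs m).continuous.aestronglyMeasurable) hFae
      refine Integrable.bdd_mul (c := A * Cη)
        ((EuclideanSpace.proj j : Ev n →L[ℝ] ℝ).integrable_comp (hRi i)) ?_
        (ae_of_all _ fun x => ?_)
      · exact ((hDc i).comp_aestronglyMeasurable hf'm).mul hηcont.aestronglyMeasurable
      · rw [norm_mul]
        exact mul_le_mul (hDA i _) (hCη x) (norm_nonneg _) hA0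
  rw [hL, hRr, hfinal]

end ChainRule

end Paper

namespace Paper

section Oscillation

open scoped ContDiff

variable {n : ℕ}

lemma hasFDerivAt_mul_comp_coord {g : Ev n → ℝ} (hg : ContDiff ℝ ∞ g) {ψ ψ' : ℝ → ℝ}
    (hψ : ∀ t, HasDerivAt ψ (ψ' t) t) {l : ℝ} (hl : l ≠ 0) (i : Fin n) (y : Ev n) :
    HasFDerivAt (fun y : Ev n => g y * (ψ (l * y i) / l))
      ((ψ (l * y i) / l) • fderiv ℝ g y
        + (g y * ψ' (l * y i)) • (EuclideanSpace.proj i : Ev n →L[ℝ] ℝ)) y := by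
  have h1 : HasFDerivAt (fun y : Ev n => l * y i) (l • (EuclideanSpace.proj i : Ev n →L[ℝ] ℝ)) y :=
    (EuclideanSpace.proj i : Ev n →L[ℝ] ℝ).hasFDerivAt.const_mul l
  have h2 := ((hψ (l * y i)).comp_hasFDerivAt y h1).mul_const l⁻¹
  have h3 := ((hg.differentiable (by simp) y).hasFDerivAt).mul h2
  refine h3.congr_fderiv ?_
  ext v
  simp only [_root_.add_apply, _root_.smul_apply, smul_eq_mul,
    Function.comp_apply]
  field_simp
  ring

lemma measurable_chainGrad {f : Ev n → Ev n} {R : Fin n → Ev n → Ev n}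
    (hf : Measurable f) (hR : ∀ i, Measurable (R i)) {g : Ev n → ℝ} (hg : ContDiff ℝ ∞ g) :
    Measurable (chainGrad g f R) := by
  unfold chainGrad
  refine Finset.measurable_sum _ fun j _ => ?_
  have h : Measurable fun x => fderiv ℝ g (f x) (EuclideanSpace.single j 1) :=
    (((hg.continuous_fderiv (by simp)).clm_apply continuous_const).measurable).comp hf
  exact h.smul (hR j)

lemma lintegral_comp_mul_deriv_le {Ω Ω' : Set (Ev n)} {f : Ev n → Ev n} {R : Fin n → Ev n → Ev n}
    (hf : Measurable f) (hR : ∀ i, Measurable (R i)) {C₁ : ℝ≥0∞} (hn : 1 ≤ n)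
    (hK : ∀ u : Ev n → ℝ, ContDiff ℝ ∞ u → HasCompactSupport u →
      ∫⁻ x in Ω, ‖chainGrad u f R x‖ₑ ≤ C₁ * eLpNorm (gradient u) n (volume.restrict Ω'))
    {g : Ev n → ℝ} (hg : ContDiff ℝ ∞ g) (hgs : HasCompactSupport g) {ψ ψ' : ℝ → ℝ}
    (hψs : ContDiff ℝ ∞ ψ) (hψ : ∀ t, HasDerivAt ψ (ψ' t) t) (hψ1 : ∀ t, |ψ t| ≤ 1)
    (hψ2 : ∀ t, |ψ' t| ≤ 1) {l : ℝ} (hl : 0 < l) (i : Fin n) :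
    ∫⁻ x in Ω, ‖g (f x)‖ₑ * ‖ψ' (l * f x i)‖ₑ * ‖R i x‖ₑ
      ≤ C₁ * eLpNorm g n (volume.restrict Ω')
        + 2 * (ENNReal.ofReal l⁻¹ * (C₁ * eLpNorm (gradient g) n (volume.restrict Ω'))) := by
  set u : Ev n → ℝ := fun y => g y * (ψ (l * y i) / l) with hu
  have hD := hasFDerivAt_mul_comp_coord hg hψ hl.ne' i
  have hpr : ContDiff ℝ ∞ fun y : Ev n => y i := (EuclideanSpace.proj i : Ev n →L[ℝ] ℝ).contDiff
  have hus : ContDiff ℝ ∞ u := hg.mul ((hψs.comp (contDiff_const.mul hpr)).div_const l)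
  have huc : HasCompactSupport u := hgs.mul_right
  have hsm : ∀ t, ‖ψ t / l‖ₑ ≤ ENNReal.ofReal l⁻¹ := by
    intro t
    rw [← ofReal_norm]
    apply ENNReal.ofReal_le_ofReal
    rw [norm_div, Real.norm_eq_abs, Real.norm_eq_abs, abs_of_pos hl, ← one_div]
    gcongr
    exact hψ1 t
  have hcg : ∀ x, (g (f x) * ψ' (l * f x i)) • R i x
      = chainGrad u f R x - (ψ (l * f x i) / l) • chainGrad g f R x := by
    intro x
    simp only [chainGrad]
    rw [Finset.smul_sum, ← Finset.sum_sub_distrib, (hD (f x)).fderiv]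
    rw [Finset.sum_eq_single i]
    · simp only [_root_.add_apply, _root_.smul_apply, smul_eq_mul]
      simp [add_smul, mul_smul]
    · intro j _ hj
      simp [hj.symm, mul_smul]
    · simp
  have hpt : ∀ x, ‖g (f x)‖ₑ * ‖ψ' (l * f x i)‖ₑ * ‖R i x‖ₑ
      ≤ ‖chainGrad u f R x‖ₑ + ENNReal.ofReal l⁻¹ * ‖chainGrad g f R x‖ₑ := by
    intro x
    rw [← enorm_mul, ← enorm_smul, hcg]
    refine (enorm_sub_le).trans ?_
    rw [enorm_smul]
    gcongr
    exact hsm _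
  have hgrad : ∀ y, gradient u y
      = (ψ (l * y i) / l) • gradient g y
        + (g y * ψ' (l * y i)) • (EuclideanSpace.single i (1 : ℝ) : Ev n) := by
    intro y
    ext j
    rw [gradient_apply, (hD y).fderiv]
    simp only [_root_.add_apply, _root_.smul_apply, smul_eq_mul,
      PiLp.add_apply, PiLp.smul_apply, gradient_apply]
    congr 2
    simp [eq_comm]
  have hgc : Continuous (gradient g) :=
    (LinearIsometryEquiv.continuous _).comp (hg.continuous_fderiv (by simp))
  have hN : eLpNorm (gradient u) n (volume.restrict Ω')
      ≤ ENNReal.ofReal l⁻¹ * eLpNorm (gradient g) n (volume.restrict Ω')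
        + eLpNorm g n (volume.restrict Ω') := by
    have h1 : eLpNorm (gradient u) n (volume.restrict Ω')
        ≤ eLpNorm (fun y => l⁻¹ * ‖gradient g y‖ + ‖g y‖) n (volume.restrict Ω') := by
      refine eLpNorm_mono_real fun y => ?_
      rw [hgrad]
      refine (norm_add_le _ _).trans ?_
      rw [norm_smul, norm_smul, norm_mul, PiLp.norm_single, norm_one, mul_one, norm_div,
        Real.norm_eq_abs, Real.norm_eq_abs l, abs_of_pos hl, div_eq_inv_mul]
      have := hψ1 (l * y i)
      have h2 : ‖ψ' (l * y i)‖ ≤ 1 := hψ2 (l * y i)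
      have h3 : l⁻¹ * |ψ (l * y i)| ≤ l⁻¹ := mul_le_of_le_one_right (by positivity) this
      have h4 : ‖g y‖ * ‖ψ' (l * y i)‖ ≤ ‖g y‖ := mul_le_of_le_one_right (norm_nonneg _) h2
      gcongr
    refine h1.trans ((eLpNorm_add_le (hgc.norm.const_smul l⁻¹).aestronglyMeasurable
      hg.continuous.norm.aestronglyMeasurable (by exact_mod_cast hn)).trans ?_)
    gcongr
    · rw [eLpNorm_const_smul, eLpNorm_norm, ← ofReal_norm, Real.norm_of_nonneg (by positivity)]
    · rw [eLpNorm_norm]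
  have hcm : Measurable (chainGrad g f R) := measurable_chainGrad hf hR hg
  calc ∫⁻ x in Ω, ‖g (f x)‖ₑ * ‖ψ' (l * f x i)‖ₑ * ‖R i x‖ₑ
      ≤ ∫⁻ x in Ω, (‖chainGrad u f R x‖ₑ + ENNReal.ofReal l⁻¹ * ‖chainGrad g f R x‖ₑ) :=
        lintegral_mono hpt
    _ = (∫⁻ x in Ω, ‖chainGrad u f R x‖ₑ)
        + ENNReal.ofReal l⁻¹ * ∫⁻ x in Ω, ‖chainGrad g f R x‖ₑ := by
        rw [lintegral_add_right _ (hcm.enorm.const_mul _), lintegral_const_mul _ hcm.enorm]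
    _ ≤ C₁ * (ENNReal.ofReal l⁻¹ * eLpNorm (gradient g) n (volume.restrict Ω')
          + eLpNorm g n (volume.restrict Ω'))
        + ENNReal.ofReal l⁻¹ * (C₁ * eLpNorm (gradient g) n (volume.restrict Ω')) := by
        gcongr
        · exact (hK u hus huc).trans (by gcongr)
        · exact hK g hg hgs
    _ = _ := by ring

/-- Testing with rapidly oscillating functions controls `∫ |g ∘ f| ‖R i‖` by the norm of `g`. -/
lemma lintegral_comp_mul_le {Ω Ω' : Set (Ev n)} {f : Ev n → Ev n} {R : Fin n → Ev n → Ev n}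
    (hf : Measurable f) (hR : ∀ i, Measurable (R i)) {C₁ : ℝ≥0∞} (hC₁ : C₁ ≠ ⊤) (hn : 1 ≤ n)
    (hK : ∀ u : Ev n → ℝ, ContDiff ℝ ∞ u → HasCompactSupport u →
      ∫⁻ x in Ω, ‖chainGrad u f R x‖ₑ ≤ C₁ * eLpNorm (gradient u) n (volume.restrict Ω'))
    {g : Ev n → ℝ} (hg : ContDiff ℝ ∞ g) (hgs : HasCompactSupport g) (i : Fin n) :
    ∫⁻ x in Ω, ‖g (f x)‖ₑ * ‖R i x‖ₑ ≤ 2 * (C₁ * eLpNorm g n (volume.restrict Ω')) := by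
  set a := C₁ * eLpNorm g n (volume.restrict Ω')
  set b := C₁ * eLpNorm (gradient g) n (volume.restrict Ω') with hb
  have hgc : Continuous (gradient g) :=
    (LinearIsometryEquiv.continuous _).comp (hg.continuous_fderiv (by simp))
  have hgcs : HasCompactSupport (gradient g) := (hgs.fderiv ℝ).comp_left (map_zero _)
  have hbt : b ≠ ⊤ := by
    refine ENNReal.mul_ne_top hC₁ ?_
    exact ((hgc.memLp_of_hasCompactSupport (μ := volume) hgcs).restrict Ω').2.ne
  have hgm : Measurable fun x => ‖g (f x)‖ₑ := (hg.continuous.measurable.comp hf).enorm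
  have hfi : Measurable fun x => f x i :=
    ((EuclideanSpace.proj i : Ev n →L[ℝ] ℝ).continuous.measurable).comp hf
  have key : ∀ m : ℕ, ∫⁻ x in Ω, ‖g (f x)‖ₑ * ‖R i x‖ₑ
      ≤ 2 * a + 4 * (ENNReal.ofReal ((m : ℝ) + 1)⁻¹ * b) := by
    intro m
    have hl : (0 : ℝ) < (m : ℝ) + 1 := by positivity
    have h1 := lintegral_comp_mul_deriv_le hf hR hn hK hg hgs Real.contDiff_sin
      Real.hasDerivAt_sin Real.abs_sin_le_one Real.abs_cos_le_one hl i
    have h2 := lintegral_comp_mul_deriv_le hf hR hn hK hg hgs Real.contDiff_cos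
      Real.hasDerivAt_cos Real.abs_cos_le_one (fun t => by rw [abs_neg]; exact Real.abs_sin_le_one t)
      hl i
    have hcm : Measurable fun x => ‖g (f x)‖ₑ * ‖Real.cos (((m : ℝ) + 1) * f x i)‖ₑ * ‖R i x‖ₑ :=
      (hgm.mul (Real.measurable_cos.comp (hfi.const_mul _)).enorm).mul (hR i).enorm
    calc ∫⁻ x in Ω, ‖g (f x)‖ₑ * ‖R i x‖ₑ
        ≤ ∫⁻ x in Ω, (‖g (f x)‖ₑ * ‖Real.cos (((m : ℝ) + 1) * f x i)‖ₑ * ‖R i x‖ₑ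
          + ‖g (f x)‖ₑ * ‖-Real.sin (((m : ℝ) + 1) * f x i)‖ₑ * ‖R i x‖ₑ) := by
          refine lintegral_mono fun x => ?_
          rw [← add_mul, ← mul_add]
          gcongr
          refine le_mul_of_one_le_right zero_le ?_
          set t := ((m : ℝ) + 1) * f x i
          rw [enorm_neg, ← ofReal_norm, ← ofReal_norm, ← ENNReal.ofReal_add (norm_nonneg _)
            (norm_nonneg _), ← ENNReal.ofReal_one]
          apply ENNReal.ofReal_le_ofReal
          rw [Real.norm_eq_abs, Real.norm_eq_abs]
          nlinarith [Real.abs_cos_le_one t, Real.abs_sin_le_one t, abs_nonneg (Real.cos t),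
            abs_nonneg (Real.sin t), sq_abs (Real.cos t), sq_abs (Real.sin t),
            Real.sin_sq_add_cos_sq t]
      _ = _ := lintegral_add_left hcm _
      _ ≤ _ := add_le_add h1 h2
      _ = _ := by ring
  have hlim : Tendsto (fun m : ℕ => 2 * a + 4 * (ENNReal.ofReal ((m : ℝ) + 1)⁻¹ * b)) atTop
      (𝓝 (2 * a)) := by
    have h0 : Tendsto (fun m : ℕ => ENNReal.ofReal ((m : ℝ) + 1)⁻¹) atTop (𝓝 0) := by
      have := tendsto_one_div_add_atTop_nhds_zero_nat (𝕜 := ℝ)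
      simpa [one_div, Function.comp_def] using (ENNReal.continuous_ofReal.tendsto 0).comp this
    have h1 := ENNReal.Tendsto.mul_const h0 (b := b) (Or.inr hbt)
    have h2 := ENNReal.Tendsto.const_mul h1 (a := 4) (Or.inr (by simp))
    simpa using h2.const_add (2 * a)
  exact ge_of_tendsto' hlim key

end Oscillation

end Paper

namespace Paper

section ImageMeasure

open scoped ContDiff

variable {n : ℕ}

lemma lintegral_le_of_forall_smooth {ν μ : Measure (Ev n)} [IsFiniteMeasure ν] [IsFiniteMeasure μ]
    (hn : 1 ≤ n) {C : ℝ≥0∞} (hC : C ≠ ⊤)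
    (h : ∀ g : Ev n → ℝ, ContDiff ℝ ∞ g → HasCompactSupport g →
      ∫⁻ y, ‖g y‖ₑ ∂ν ≤ C * eLpNorm g n μ)
    {G : Ev n → ℝ} (hG : Measurable G) {b : ℝ} (hb : ∀ y, ‖G y‖ ≤ b) :
    ∫⁻ y, ‖G y‖ₑ ∂ν ≤ C * eLpNorm G n μ := by
  have h1n : (1 : ℝ≥0∞) ≤ n := by exact_mod_cast hn
  have hGm : MemLp G n (ν + μ) := MemLp.of_bound hG.aestronglyMeasurable b (ae_of_all _ hb)
  set K : ℝ≥0∞ := ν univ ^ (1 / (1 : ℝ≥0∞).toReal - 1 / (n : ℝ≥0∞).toReal) with hK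
  have hKt : K ≠ ⊤ := by
    refine ENNReal.rpow_ne_top_of_nonneg ?_ (measure_ne_top _ _)
    have : (1 : ℝ) ≤ n := by exact_mod_cast hn
    simp only [ENNReal.toReal_one, ENNReal.toReal_natCast, sub_nonneg]
    exact one_div_le_one_div_of_le one_pos this
  have key : ∀ m : ℕ, ∫⁻ y, ‖G y‖ₑ ∂ν
      ≤ C * eLpNorm G n μ + (K + C) * ENNReal.ofReal (1 / ((m : ℝ) + 1)) := by
    intro m
    obtain ⟨g, hgs, hg, hgG⟩ := hGm.exist_eLpNorm_sub_le (by simp) h1n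
      (ε := 1 / ((m : ℝ) + 1)) (by positivity)
    have hgm : Measurable g := hg.continuous.measurable
    have hle : ∀ {τ : Measure (Ev n)}, τ ≤ ν + μ →
        eLpNorm (G - g) n τ ≤ ENNReal.ofReal (1 / ((m : ℝ) + 1)) := fun hτ =>
      (eLpNorm_mono_measure _ hτ).trans hgG
    have h1 : ∫⁻ y, ‖(G - g) y‖ₑ ∂ν ≤ ENNReal.ofReal (1 / ((m : ℝ) + 1)) * K := by
      rw [← eLpNorm_one_eq_lintegral_enorm]
      refine (eLpNorm_le_eLpNorm_mul_rpow_measure_univ h1n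
        (hG.sub hgm).aestronglyMeasurable).trans ?_
      exact mul_le_mul' (hle (Measure.le_add_right le_rfl)) le_rfl
    have h2 : eLpNorm g n μ ≤ eLpNorm G n μ + ENNReal.ofReal (1 / ((m : ℝ) + 1)) := by
      calc eLpNorm g n μ = eLpNorm (G - (G - g)) n μ := by rw [sub_sub_cancel]
        _ ≤ eLpNorm G n μ + eLpNorm (G - g) n μ := eLpNorm_sub_le hG.aestronglyMeasurable
          (hG.sub hgm).aestronglyMeasurable h1n
        _ ≤ _ := add_le_add le_rfl (hle (Measure.le_add_left le_rfl))
    calc ∫⁻ y, ‖G y‖ₑ ∂ν ≤ ∫⁻ y, (‖g y‖ₑ + ‖(G - g) y‖ₑ) ∂ν := by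
          refine lintegral_mono fun y => ?_
          refine le_trans (le_of_eq ?_) (enorm_add_le _ _)
          simp
      _ = ∫⁻ y, ‖g y‖ₑ ∂ν + ∫⁻ y, ‖(G - g) y‖ₑ ∂ν := lintegral_add_left hgm.enorm _
      _ ≤ C * (eLpNorm G n μ + ENNReal.ofReal (1 / ((m : ℝ) + 1)))
          + ENNReal.ofReal (1 / ((m : ℝ) + 1)) * K :=
          add_le_add ((h g hg hgs).trans (mul_le_mul' le_rfl h2)) h1
      _ = _ := by ring
  have hlim : Tendsto (fun m : ℕ => C * eLpNorm G n μ
      + (K + C) * ENNReal.ofReal (1 / ((m : ℝ) + 1))) atTop (𝓝 (C * eLpNorm G n μ)) := by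
    have h0 : Tendsto (fun m : ℕ => ENNReal.ofReal (1 / ((m : ℝ) + 1))) atTop (𝓝 0) := by
      simpa [Function.comp_def] using (ENNReal.continuous_ofReal.tendsto 0).comp
        (tendsto_one_div_add_atTop_nhds_zero_nat (𝕜 := ℝ))
    have h2 := ENNReal.Tendsto.const_mul h0 (a := K + C) (Or.inr (by finiteness))
    simpa using h2.const_add (C * eLpNorm G n μ)
  exact ge_of_tendsto' hlim key

lemma rpow_le_of_le_mul_rpow {T C : ℝ≥0∞} {a : ℝ} (hT : T ≠ ⊤)
    (h : T ≤ C * T ^ a) (ha1 : a < 1) : T ^ (1 - a) ≤ C := by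
  rcases eq_or_ne T 0 with rfl | hT0
  · rw [ENNReal.zero_rpow_of_pos (by linarith)]
    exact zero_le
  · rw [ENNReal.rpow_sub _ _ hT0 hT, ENNReal.rpow_one]
    exact ENNReal.div_le_of_le_mul h

/-- A measure bounded by the `L_n` norm has a density with a power-integrability property. -/
lemma exists_density_of_le_eLpNorm {ν μ : Measure (Ev n)} [IsFiniteMeasure ν] [IsFiniteMeasure μ]
    (hn : 2 ≤ n) {C : ℝ≥0∞} (hC : C ≠ ⊤)
    (h : ∀ G : Ev n → ℝ, Measurable G → ∀ b : ℝ, (∀ y, ‖G y‖ ≤ b) →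
      ∫⁻ y, ‖G y‖ₑ ∂ν ≤ C * eLpNorm G n μ) :
    ∃ ρ : Ev n → ℝ≥0∞, Measurable ρ ∧ ν = μ.withDensity ρ ∧ (∀ᵐ y ∂μ, ρ y ≠ ⊤) ∧
      ∫⁻ y, ρ y ^ (1 / ((n : ℝ) - 1)) ∂ν ≠ ⊤ := by
  have hn2 : (2 : ℝ) ≤ n := by exact_mod_cast hn
  have hn1 : (0 : ℝ) < (n : ℝ) - 1 := by linarith
  have hnn : (n : ℝ≥0∞) ≠ 0 := by
    simp only [ne_eq, Nat.cast_eq_zero]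
    omega
  have hac : ν ≪ μ := by
    refine Measure.AbsolutelyContinuous.mk fun D hD hD0 => ?_
    have h1 := h (D.indicator 1) (measurable_one.indicator hD) 1 fun y => by
      by_cases hy : y ∈ D <;> simp [hy]
    have h2 : eLpNorm (D.indicator (1 : Ev n → ℝ)) n μ = 0 := by
      rw [eLpNorm_eq_zero_iff (measurable_one.indicator hD).aestronglyMeasurable hnn]
      have : ∀ᵐ y ∂μ, y ∉ D := measure_eq_zero_iff_ae_notMem.1 hD0
      filter_upwards [this] with y hy
      simp [hy]
    rw [h2, mul_zero] at h1
    have h3 : ∫⁻ y, ‖D.indicator (1 : Ev n → ℝ) y‖ₑ ∂ν = ν D := by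
      rw [← lintegral_indicator_one hD]
      refine lintegral_congr fun y => ?_
      by_cases hy : y ∈ D <;> simp [hy]
    rw [h3] at h1
    exact le_antisymm h1 zero_le
  have : ν.HaveLebesgueDecomposition μ := Measure.haveLebesgueDecomposition_of_sigmaFinite ν μ
  set ρ := ν.rnDeriv μ with hρ
  have hρm : Measurable ρ := Measure.measurable_rnDeriv ν μ
  have hν : ν = μ.withDensity ρ := (Measure.withDensity_rnDeriv_eq ν μ hac).symm
  refine ⟨ρ, hρm, hν, ?_, ?_⟩
  · filter_upwards [Measure.rnDeriv_lt_top ν μ] with y hy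
    exact hy.ne
  set s : ℝ := 1 / ((n : ℝ) - 1) with hs
  have hs0 : 0 < s := by positivity
  have hsn : s * n = s + 1 := by
    rw [hs]
    field_simp
    ring
  let q : ℕ → Ev n → ℝ≥0∞ := fun M y => min (ρ y) M ^ s
  have hqm : ∀ M, Measurable (q M) := fun M => (hρm.min measurable_const).pow_const s
  have hqM : ∀ M y, q M y ≤ (M : ℝ≥0∞) ^ s := fun M y =>
    ENNReal.rpow_le_rpow (min_le_right _ _) hs0.le
  have hMt : ∀ M : ℕ, (M : ℝ≥0∞) ^ s ≠ ⊤ := fun M =>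
    ENNReal.rpow_ne_top_of_nonneg hs0.le (by simp)
  have hqt : ∀ M y, q M y ≠ ⊤ := fun M y => ne_top_of_le_ne_top (hMt M) (hqM M y)
  have hbound : ∀ M, ∫⁻ y, q M y ∂ν ≤ C ^ (1 / (1 - 1 / (n : ℝ))) := by
    intro M
    have hn1' : 1 / (n : ℝ) < 1 := by
      rw [div_lt_one (by linarith)]
      linarith
    have h1 := h (fun y => (q M y).toReal) (hqm M).ennreal_toReal ((M : ℝ≥0∞) ^ s).toReal
      fun y => by
        rw [Real.norm_of_nonneg ENNReal.toReal_nonneg]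
        exact ENNReal.toReal_mono (hMt M) (hqM M y)
    have he : ∀ y, ‖(q M y).toReal‖ₑ = q M y := fun y => by
      rw [Real.enorm_of_nonneg ENNReal.toReal_nonneg, ENNReal.ofReal_toReal (hqt M y)]
    rw [eLpNorm_eq_lintegral_rpow_enorm_toReal hnn (by simp)] at h1
    simp only [he, ENNReal.toReal_natCast] at h1
    have h2 : ∫⁻ y, q M y ^ (n : ℝ) ∂μ ≤ ∫⁻ y, q M y ∂ν := by
      conv_rhs => rw [hν, lintegral_withDensity_eq_lintegral_mul _ hρm (hqm M)]
      refine lintegral_mono fun y => ?_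
      simp only [q, Pi.mul_apply]
      rw [← ENNReal.rpow_mul, hsn, ENNReal.rpow_add_of_nonneg _ _ hs0.le zero_le_one,
        ENNReal.rpow_one, mul_comm]
      gcongr
      exact min_le_left _ _
    have hT : ∫⁻ y, q M y ∂ν ≠ ⊤ := by
      refine ne_top_of_le_ne_top ?_ (lintegral_mono (hqM M))
      rw [lintegral_const]
      exact ENNReal.mul_ne_top (hMt M) (measure_ne_top _ _)
    have h3 : ∫⁻ y, q M y ∂ν ≤ C * (∫⁻ y, q M y ∂ν) ^ (1 / (n : ℝ)) :=
      h1.trans (by gcongr)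
    have h4 := rpow_le_of_le_mul_rpow hT h3 hn1'
    rw [one_div, ENNReal.le_rpow_inv_iff (by linarith)]
    exact h4
  have hfat : ∫⁻ y, ρ y ^ s ∂ν ≤ C ^ (1 / (1 - 1 / (n : ℝ))) := by
    have hpt : ∀ y, Tendsto (fun M => q M y) atTop (𝓝 (ρ y ^ s)) := by
      intro y
      have h1 : Tendsto (fun M : ℕ => min (ρ y) (M : ℝ≥0∞)) atTop (𝓝 (min (ρ y) ⊤)) :=
        tendsto_const_nhds.min ENNReal.tendsto_nat_nhds_top
      rw [min_eq_left le_top] at h1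
      exact (ENNReal.continuous_rpow_const.tendsto _).comp h1
    calc ∫⁻ y, ρ y ^ s ∂ν = ∫⁻ y, liminf (fun M => q M y) atTop ∂ν :=
          lintegral_congr fun y => ((hpt y).liminf_eq).symm
      _ ≤ liminf (fun M => ∫⁻ y, q M y ∂ν) atTop := lintegral_liminf_le hqm
      _ ≤ _ := liminf_le_of_le (by isBoundedDefault) fun b hb => by
          obtain ⟨M, hM⟩ := hb.exists
          exact hM.trans (hbound M)
  refine ne_top_of_le_ne_top (ENNReal.rpow_ne_top_of_nonneg ?_ hC) hfat
  have : 1 / (n : ℝ) ≤ 1 := by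
    rw [div_le_one (by linarith)]
    linarith
  exact div_nonneg zero_le_one (by linarith)

/-- Hölder's inequality against the density of an image measure. -/
lemma measure_le_rpow_mul_rpow_of_map_eq_withDensity {μ τ : Measure (Ev n)} {f : Ev n → Ev n}
    (hf : Measurable f) (hn : 2 ≤ n) {ρ : Ev n → ℝ≥0∞} (hρ : Measurable ρ)
    (hmap : μ.map f = τ.withDensity ρ) (hρt : ∀ᵐ y ∂τ, ρ y ≠ ⊤) {A D : Set (Ev n)}
    (hD : MeasurableSet D) (hAD : A ⊆ f ⁻¹' D) :
    μ A ≤ (∫⁻ x in A, ρ (f x) ^ (1 / ((n : ℝ) - 1)) ∂μ) ^ (((n : ℝ) - 1) / n)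
      * τ D ^ (1 / (n : ℝ)) := by
  have hn2 : (2 : ℝ) ≤ n := by exact_mod_cast hn
  have hn1 : (0 : ℝ) < (n : ℝ) - 1 := by linarith
  have hpq : Real.HolderConjugate ((n : ℝ) / ((n : ℝ) - 1)) n := by
    rw [Real.holderConjugate_comm, Real.holderConjugate_iff]
    refine ⟨by linarith, ?_⟩
    field_simp
    ring
  have hae : ∀ᵐ x ∂μ, ρ (f x) ≠ 0 ∧ ρ (f x) ≠ ⊤ := by
    have h1 : ∀ᵐ y ∂(μ.map f), ρ y ≠ 0 ∧ ρ y ≠ ⊤ := by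
      rw [hmap, ae_withDensity_iff hρ]
      filter_upwards [hρt] with y hy h0
      exact ⟨h0, hy⟩
    exact ae_of_ae_map hf.aemeasurable h1
  have hρf : Measurable fun x => ρ (f x) := hρ.comp hf
  set a : Ev n → ℝ≥0∞ := fun x => ρ (f x) ^ (1 / (n : ℝ)) with ha
  set b : Ev n → ℝ≥0∞ := fun x => (ρ (f x))⁻¹ ^ (1 / (n : ℝ)) with hb
  have hab : μ A = ∫⁻ x in A, (a * b) x ∂μ := by
    rw [← setLIntegral_one]
    refine lintegral_congr_ae (ae_restrict_of_ae ?_)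
    filter_upwards [hae] with x hx
    simp only [a, b, Pi.mul_apply]
    rw [← ENNReal.mul_rpow_of_nonneg _ _ (by positivity), ENNReal.mul_inv_cancel hx.1 hx.2,
      ENNReal.one_rpow]
  rw [hab]
  refine (ENNReal.lintegral_mul_le_Lp_mul_Lq _ hpq (hρf.pow_const _).aemeasurable
    (hρf.inv.pow_const _).aemeasurable).trans ?_
  have e1 : (1 : ℝ) / ((n : ℝ) / ((n : ℝ) - 1)) = ((n : ℝ) - 1) / n := by rw [one_div_div]
  rw [e1]
  refine mul_le_mul' (le_of_eq ?_) (ENNReal.rpow_le_rpow ?_ (by positivity))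
  · congr 1
    refine lintegral_congr fun x => ?_
    rw [← ENNReal.rpow_mul]
    congr 1
    field_simp
  · calc ∫⁻ x in A, b x ^ (n : ℝ) ∂μ = ∫⁻ x in A, (ρ (f x))⁻¹ ∂μ := by
          refine lintegral_congr fun x => ?_
          simp only [b]
          rw [← ENNReal.rpow_mul, one_div, inv_mul_cancel₀ (by positivity), ENNReal.rpow_one]
      _ ≤ ∫⁻ x in f ⁻¹' D, (ρ (f x))⁻¹ ∂μ := lintegral_mono_set hAD
      _ = ∫⁻ y in D, (ρ y)⁻¹ ∂(μ.map f) := (setLIntegral_map hD hρ.inv hf).symm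
      _ = ∫⁻ y in D, ρ y * (ρ y)⁻¹ ∂τ := by
          rw [hmap, restrict_withDensity hD]
          exact lintegral_withDensity_eq_lintegral_mul _ hρ hρ.inv
      _ ≤ ∫⁻ _ in D, 1 ∂τ := lintegral_mono fun y => ENNReal.mul_inv_le_one _
      _ = τ D := setLIntegral_one D

end ImageMeasure

end Paper

namespace Paper

section LevelSets

open scoped ContDiff

variable {n : ℕ}

/-- The measure on `Ω` whose density is the sum of the norms of the gradients `R i`. -/
def gradMeasure (Ω : Set (Ev n)) (R : Fin n → Ev n → Ev n) : Measure (Ev n) :=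
  (volume.restrict Ω).withDensity fun x => ∑ i, ‖R i x‖ₑ

lemma measurable_sum_enorm {R : Fin n → Ev n → Ev n} (hR : ∀ i, Measurable (R i)) :
    Measurable fun x => ∑ i, ‖R i x‖ₑ :=
  Finset.measurable_sum _ fun i _ => (hR i).enorm

lemma isFiniteMeasure_gradMeasure {Ω : Set (Ev n)} {R : Fin n → Ev n → Ev n}
    (hR : ∀ i, Measurable (R i)) (hRi : ∀ i, IntegrableOn (R i) Ω) :
    IsFiniteMeasure (gradMeasure Ω R) := by
  refine isFiniteMeasure_withDensity ?_
  rw [lintegral_finsetSum _ fun i _ => (hR i).enorm]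
  exact (ENNReal.sum_lt_top.2 fun i _ => (hRi i).2).ne

/-- A finite measure controlling the gradients of `f` by the volume of the image. -/
lemma exists_controlling_measure {Ω Ω' : Set (Ev n)} {f : Ev n → Ev n}
    {R : Fin n → Ev n → Ev n} (hn : 2 ≤ n) (hΩ'b : Bornology.IsBounded Ω')
    (hf : Measurable f) (hR : ∀ i, Measurable (R i)) (hRi : ∀ i, IntegrableOn (R i) Ω)
    {C₁ : ℝ≥0∞} (hC₁ : C₁ ≠ ⊤)
    (hK : ∀ u : Ev n → ℝ, ContDiff ℝ ∞ u → HasCompactSupport u →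
      ∫⁻ x in Ω, ‖chainGrad u f R x‖ₑ ≤ C₁ * eLpNorm (gradient u) n (volume.restrict Ω')) :
    ∃ κ : Measure (Ev n), IsFiniteMeasure κ ∧
      (∀ N, MeasurableSet N → volume (N ∩ Ω') = 0 → gradMeasure Ω R (f ⁻¹' N) = 0) ∧
      κ ≪ gradMeasure Ω R ∧
      ∀ A D, MeasurableSet D → A ⊆ f ⁻¹' D →
        gradMeasure Ω R A ≤ κ A ^ (((n : ℝ) - 1) / n) * volume D ^ (1 / (n : ℝ)) := by
  have hfin := isFiniteMeasure_gradMeasure hR hRi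
  set μ := gradMeasure Ω R with hμ
  have : IsFiniteMeasure (volume.restrict Ω') := ⟨by
    rw [Measure.restrict_apply_univ]
    exact hΩ'b.measure_lt_top⟩
  have h_integrable : ∀ G : Ev n → ℝ, Measurable G →
      ∫⁻ y, ‖G y‖ₑ ∂(μ.map f) = ∑ i, ∫⁻ x in Ω, ‖G (f x)‖ₑ * ‖R i x‖ₑ := by
    intro G hG
    have hGf : Measurable fun x => ‖G (f x)‖ₑ := (hG.comp hf).enorm
    rw [lintegral_map hG.enorm hf, hμ, gradMeasure,
      lintegral_withDensity_eq_lintegral_mul _ (measurable_sum_enorm hR) hGf]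
    have hm : ∀ i ∈ Finset.univ, Measurable fun x => ‖G (f x)‖ₑ * ‖R i x‖ₑ :=
      fun i _ => hGf.mul (hR i).enorm
    rw [← lintegral_finsetSum _ hm]
    refine lintegral_congr fun x => ?_
    rw [Pi.mul_apply, Finset.sum_mul]
    exact Finset.sum_congr rfl fun i _ => mul_comm _ _
  have hsm : ∀ g : Ev n → ℝ, ContDiff ℝ ∞ g → HasCompactSupport g →
      ∫⁻ y, ‖g y‖ₑ ∂(μ.map f) ≤ (n * (2 * C₁)) * eLpNorm g n (volume.restrict Ω') := by
    intro g hg hgs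
    rw [h_integrable g hg.continuous.measurable]
    refine (Finset.sum_le_sum fun i _ => lintegral_comp_mul_le hf hR hC₁ (by omega) hK hg hgs
      i).trans_eq ?_
    rw [Finset.sum_const, Finset.card_univ, Fintype.card_fin, nsmul_eq_mul]
    ring
  have hC₂ : (n * (2 * C₁) : ℝ≥0∞) ≠ ⊤ := by finiteness
  obtain ⟨ρ, hρ, hmap, hρt, hρi⟩ := exists_density_of_le_eLpNorm hn hC₂
    fun G hG b hb => lintegral_le_of_forall_smooth (by omega) hC₂ hsm hG hb
  have hρf : Measurable fun x => ρ (f x) ^ (1 / ((n : ℝ) - 1)) := (hρ.comp hf).pow_const _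
  refine ⟨μ.withDensity fun x => ρ (f x) ^ (1 / ((n : ℝ) - 1)), ?_, ?_,
    withDensity_absolutelyContinuous _ _, ?_⟩
  · refine isFiniteMeasure_withDensity ?_
    rwa [lintegral_map (hρ.pow_const _) hf] at hρi
  · intro N hN hN0
    rw [← Measure.map_apply hf hN, hmap]
    refine withDensity_absolutelyContinuous _ _ ?_
    rwa [Measure.restrict_apply hN]
  · intro A D hD hAD
    refine (measure_le_rpow_mul_rpow_of_map_eq_withDensity hf hn hρ hmap hρt hD hAD).trans ?_
    have hn2 : (2 : ℝ) ≤ n := by exact_mod_cast hn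
    refine mul_le_mul' (ENNReal.rpow_le_rpow (withDensity_apply_le _ _) ?_)
      (ENNReal.rpow_le_rpow (Measure.restrict_apply_le _ _) (by positivity))
    exact div_nonneg (by linarith) (by linarith)

/-- Cutoff functions adapted to balls. -/
lemma exists_cutoff (n : ℕ) : ∃ c : ℝ, 0 ≤ c ∧ ∀ (p : Ev n) (δ : ℝ), 0 < δ →
    ∃ u : Ev n → ℝ, ContDiff ℝ ∞ u ∧ HasCompactSupport u ∧ (∀ y, ‖u y‖ ≤ 1) ∧
      (∀ y ∈ closedBall p δ, u y = 1) ∧ (∀ y ∉ closedBall p (2 * δ), u y = 0) ∧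
      (∀ y ∉ closedBall p (2 * δ), fderiv ℝ u y = 0) ∧ ∀ y, ‖fderiv ℝ u y‖ ≤ c / δ := by
  let b : ContDiffBump (0 : Ev n) := ⟨1, 2, one_pos, one_lt_two⟩
  have hb : ContDiff ℝ ∞ b := b.contDiff
  obtain ⟨c, hc⟩ := bounded_fderiv_of_hasCompactSupport hb b.hasCompactSupport
  refine ⟨c, (norm_nonneg _).trans (hc 0), fun p δ hδ => ?_⟩
  have hD : ∀ y, HasFDerivAt (fun y => b (δ⁻¹ • (y - p)))
      ((fderiv ℝ b (δ⁻¹ • (y - p))).comp (δ⁻¹ • ContinuousLinearMap.id ℝ (Ev n))) y := by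
    intro y
    have h1 : HasFDerivAt (fun y : Ev n => δ⁻¹ • (y - p)) (δ⁻¹ • ContinuousLinearMap.id ℝ (Ev n))
      y := ((hasFDerivAt_id y).sub_const p).const_smul δ⁻¹
    exact ((hb.differentiable (by simp) _).hasFDerivAt).comp y h1
  have hnorm : ∀ y, ‖δ⁻¹ • (y - p)‖ = dist y p / δ := by
    intro y
    rw [norm_smul, norm_inv, Real.norm_of_nonneg hδ.le, dist_eq_norm, div_eq_inv_mul]
  have hout : ∀ y ∉ closedBall p (2 * δ), δ⁻¹ • (y - p) ∉ closedBall (0 : Ev n) 2 := by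
    intro y hy
    rw [mem_closedBall_zero_iff, hnorm, div_le_iff₀ hδ]
    exact hy
  have hz : ∀ y ∉ closedBall p (2 * δ), b (δ⁻¹ • (y - p)) = 0 := fun y hy =>
    b.zero_of_le_dist (not_le.1 (hout y hy)).le
  refine ⟨fun y => b (δ⁻¹ • (y - p)), ?_, ?_, ?_, ?_, hz, ?_, ?_⟩
  · exact hb.comp ((contDiff_id.sub contDiff_const).const_smul δ⁻¹)
  · exact HasCompactSupport.intro (isCompact_closedBall p (2 * δ)) hz
  · intro y
    rw [Real.norm_of_nonneg b.nonneg]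
    exact b.le_one
  · intro y hy
    refine b.one_of_mem_closedBall ?_
    rw [mem_closedBall_zero_iff, hnorm, div_le_iff₀ hδ]
    simpa [b] using hy
  · intro y hy
    have h0 : fderiv ℝ b (δ⁻¹ • (y - p)) = 0 := by
      refine image_eq_zero_of_notMem_tsupport fun h => ?_
      have := tsupport_fderiv_subset ℝ h
      rw [b.tsupport_eq] at this
      exact hout y hy this
    rw [(hD y).fderiv, h0, ContinuousLinearMap.zero_comp]
  · intro y
    rw [(hD y).fderiv]
    refine (ContinuousLinearMap.opNorm_comp_le _ _).trans ?_
    rw [div_eq_mul_inv]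
    refine mul_le_mul (hc _) ?_ (norm_nonneg _) ((norm_nonneg _).trans (hc 0))
    rw [norm_smul, norm_inv, Real.norm_of_nonneg hδ.le]
    exact mul_le_of_le_one_right (by positivity) ContinuousLinearMap.norm_id_le

lemma enorm_chainGrad_le {u : Ev n → ℝ} {f : Ev n → Ev n} {R : Fin n → Ev n → Ev n} {x : Ev n}
    {c : ℝ} (h : ‖fderiv ℝ u (f x)‖ ≤ c) :
    ‖chainGrad u f R x‖ₑ ≤ ENNReal.ofReal c * ∑ i, ‖R i x‖ₑ := by
  rw [chainGrad, Finset.mul_sum]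
  refine (enorm_sum_le _ _).trans (Finset.sum_le_sum fun i _ => ?_)
  rw [enorm_smul, ← ofReal_norm]
  gcongr
  refine (ContinuousLinearMap.le_opNorm _ _).trans ?_
  simpa using h

/-- Separated level sets of `f` in a ball are controlled by the gradients of `f`. -/
lemma exists_volume_mul_volume_le (n : ℕ) : ∃ c : ℝ, 0 ≤ c ∧ ∀ {Ω : Set (Ev n)} {f : Ev n → Ev n}
    {R : Fin n → Ev n → Ev n}, IsOpen Ω → Measurable f → (∀ i, Measurable (R i)) →
    LocallyIntegrableOn f Ω → (∀ i, IsWeakGrad Ω (fun x => f x i) (R i)) →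
    (∀ i, IntegrableOn (R i) Ω) → ∀ (x : Ev n) {r : ℝ}, 0 < r → ball x (2 * r) ⊆ Ω →
    ∀ (p : Ev n) {δ : ℝ}, 0 < δ →
      volume (ball x r ∩ f ⁻¹' closedBall p δ) * volume (ball x r \ f ⁻¹' closedBall p (2 * δ))
        ≤ volume (ball (0 : Ev n) (2 * r)) * (ENNReal.ofReal (2 * r) * (ENNReal.ofReal (c / δ) *
          gradMeasure Ω R (ball x (2 * r) ∩ f ⁻¹' closedBall p (2 * δ)))) := by
  obtain ⟨c, hc0, hc⟩ := exists_cutoff n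
  refine ⟨c, hc0, ?_⟩
  intro Ω f R hΩ hf hR hfl hw hRi x r hr hball p δ hδ
  obtain ⟨u, hu, hus, hu1, hu1', hu0, hdu0, hdu⟩ := hc p δ hδ
  have hg := isWeakGrad_comp hΩ hfl hw hu hus
  have hcm := measurable_chainGrad hf hR hu
  have hum : Measurable (u ∘ f) := hu.continuous.measurable.comp hf
  set P := f ⁻¹' closedBall p δ with hP
  set Q := f ⁻¹' closedBall p (2 * δ) with hQ
  have hPm : MeasurableSet P := hf measurableSet_closedBall
  have hQm : MeasurableSet Q := hf measurableSet_closedBall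
  have hpt : ∀ y, ‖chainGrad u f R y‖ₑ
      ≤ Q.indicator (fun y => ENNReal.ofReal (c / δ) * ∑ i, ‖R i y‖ₑ) y := by
    intro y
    by_cases hy : y ∈ Q
    · rw [indicator_of_mem hy]
      exact enorm_chainGrad_le (hdu _)
    · rw [indicator_of_notMem hy]
      refine (enorm_chainGrad_le (c := 0) ?_).trans (by simp)
      rw [hdu0 _ hy, norm_zero]
  have hGle : ∀ S : Set (Ev n), MeasurableSet S → S ⊆ Ω → ∫⁻ y in S, ‖chainGrad u f R y‖ₑ
      ≤ ENNReal.ofReal (c / δ) * gradMeasure Ω R (S ∩ Q) := by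
    intro S hS hSΩ
    calc ∫⁻ y in S, ‖chainGrad u f R y‖ₑ
        ≤ ∫⁻ y in S, Q.indicator (fun y => ENNReal.ofReal (c / δ) * ∑ i, ‖R i y‖ₑ) y :=
          lintegral_mono hpt
      _ = ∫⁻ y in S ∩ Q, ENNReal.ofReal (c / δ) * ∑ i, ‖R i y‖ₑ := by
          rw [lintegral_indicator hQm, Measure.restrict_restrict hQm, inter_comm]
      _ = _ := by
          rw [lintegral_const_mul _ (measurable_sum_enorm hR), gradMeasure,
            withDensity_apply _ (hS.inter hQm), Measure.restrict_restrict (hS.inter hQm),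
            inter_eq_self_of_subset_left (inter_subset_left.trans hSΩ)]
  have hfin := isFiniteMeasure_gradMeasure hR hRi
  have hvi : IntegrableOn (u ∘ f) (ball x (2 * r)) := by
    refine IntegrableOn.of_bound measure_ball_lt_top hum.aestronglyMeasurable 1
      (ae_of_all _ fun y => hu1 _)
  have hGi : IntegrableOn (chainGrad u f R) (ball x (2 * r)) := by
    refine ⟨hcm.aestronglyMeasurable, (hGle _ measurableSet_ball hball).trans_lt ?_⟩
    exact ENNReal.mul_lt_top ENNReal.ofReal_lt_top (measure_lt_top _ _)
  have hmain := hg.lintegral_ball_ball_le hΩ.measurableSet hr hball hvi hGi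
  refine le_trans ?_ (hmain.trans ?_)
  · have hBP : MeasurableSet (ball x r ∩ P) := measurableSet_ball.inter hPm
    have hBQ : MeasurableSet (ball x r \ Q) := measurableSet_ball.diff hQm
    calc volume (ball x r ∩ P) * volume (ball x r \ Q)
        = ∫⁻ y in ball x r ∩ P, ∫⁻ _ in ball x r \ Q, 1 := by
          rw [setLIntegral_one, setLIntegral_const, mul_comm]
      _ ≤ ∫⁻ y in ball x r ∩ P, ∫⁻ z in ball x r, ‖(u ∘ f) z - (u ∘ f) y‖ₑ := by
          refine setLIntegral_mono' hBP fun y hy => ?_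
          refine le_trans ?_ (lintegral_mono_set (sdiff_subset (t := Q)))
          refine setLIntegral_mono' hBQ fun z hz => ?_
          have e1 : (u ∘ f) y = 1 := hu1' _ hy.2
          have e2 : (u ∘ f) z = 0 := hu0 _ hz.2
          rw [e1, e2]
          simp
      _ ≤ _ := lintegral_mono_set inter_subset_left
  · gcongr
    exact hGle _ measurableSet_ball hball

end LevelSets

end Paper

namespace Paper

section Dichotomy

open scoped ContDiff

variable {n : ℕ}

lemma exists_finset_cover_closedBall (n : ℕ) : ∃ t : Finset (Ev n), t.Nonempty ∧
    closedBall (0 : Ev n) 1 ⊆ ⋃ z ∈ t, closedBall z (1 / 4) := by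
  obtain ⟨t, -, ht, hc⟩ := (isCompact_closedBall (0 : Ev n) 1).finite_cover_balls
    (e := 1 / 4) (by norm_num)
  have hsub : closedBall (0 : Ev n) 1 ⊆ ⋃ z ∈ ht.toFinset, closedBall z (1 / 4) := by
    refine hc.trans ?_
    simp only [Set.Finite.mem_toFinset]
    exact iUnion₂_mono fun z _ => ball_subset_closedBall
  refine ⟨ht.toFinset, ?_, hsub⟩
  have h0 := hsub (mem_closedBall_self zero_le_one)
  simp only [mem_iUnion] at h0
  obtain ⟨z, hz, -⟩ := h0
  exact ⟨z, hz⟩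

/-- A compactly supported finite measure which never splits into two separated large pieces
has an atom. -/
lemma exists_measure_singleton_ne_zero (n : ℕ) : ∃ N : ℕ, 0 < N ∧
    ∀ (m : Measure (Ev n)) [IsFiniteMeasure m], m univ ≠ 0 → ∀ T : ℝ, m (closedBall 0 T)ᶜ = 0 →
      (∀ p δ, 0 < δ → m.real (closedBall p δ) * m.real (closedBall p (2 * δ))ᶜ
        ≤ m.real univ ^ 2 / (4 * N)) → ∃ p, m {p} ≠ 0 := by
  obtain ⟨t, ht, hcov⟩ := exists_finset_cover_closedBall n
  refine ⟨t.card, ht.card_pos, ?_⟩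
  intro m _ hm T₀ hT₀ hsplit
  obtain ⟨T, hT, hmT⟩ : ∃ T : ℝ, 0 < T ∧ m (closedBall 0 T)ᶜ = 0 :=
    ⟨max T₀ 1, by positivity, measure_mono_null
      (compl_subset_compl.2 (closedBall_subset_closedBall (le_max_left _ _))) hT₀⟩
  have hN : (0 : ℝ) < t.card := by exact_mod_cast ht.card_pos
  set M := m.real univ with hMdef
  have hM : 0 < M := ENNReal.toReal_pos hm (measure_ne_top _ _)
  have hcompl : ∀ p ρ, m.real (closedBall p ρ)ᶜ = M - m.real (closedBall p ρ) := fun p ρ =>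
    measureReal_compl measurableSet_closedBall
  have hstep : ∀ k : ℕ, ∃ p, M / 2 ≤ m.real (closedBall p (T / 2 ^ k)) := by
    intro k
    induction k with
    | zero =>
      refine ⟨0, ?_⟩
      have h1 : m.real (closedBall 0 T)ᶜ = 0 := by rw [Measure.real, hmT]; rfl
      have h2 := hcompl 0 T
      simp only [pow_zero, div_one]
      linarith
    | succ k ih =>
      obtain ⟨p, hp⟩ := ih
      set ρ := T / 2 ^ k with hρdef
      have hρ : 0 < ρ := by positivity
      have hsub : closedBall p ρ ⊆ ⋃ z ∈ t, closedBall (p + ρ • z) (ρ / 4) := by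
        intro y hy
        have hy' : ρ⁻¹ • (y - p) ∈ closedBall (0 : Ev n) 1 := by
          rw [mem_closedBall_zero_iff, norm_smul, norm_inv, Real.norm_of_nonneg hρ.le,
            inv_mul_le_one₀ hρ, ← dist_eq_norm]
          exact hy
        have := hcov hy'
        simp only [mem_iUnion] at this ⊢
        obtain ⟨z, hz, hyz⟩ := this
        refine ⟨z, hz, ?_⟩
        rw [mem_closedBall, dist_eq_norm] at hyz ⊢
        have e : y - (p + ρ • z) = ρ • (ρ⁻¹ • (y - p) - z) := by
          rw [smul_sub, smul_inv_smul₀ hρ.ne']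
          abel
        rw [e, norm_smul, Real.norm_of_nonneg hρ.le]
        nlinarith
      have hsum : ∑ _z ∈ t, M / (2 * t.card) ≤ ∑ z ∈ t, m.real (closedBall (p + ρ • z) (ρ / 4)) :=
        calc ∑ _z ∈ t, M / (2 * t.card) = M / 2 := by
              rw [Finset.sum_const, nsmul_eq_mul]
              field_simp
          _ ≤ m.real (⋃ z ∈ t, closedBall (p + ρ • z) (ρ / 4)) := hp.trans (measureReal_mono hsub (measure_ne_top _ _))
          _ ≤ _ := measureReal_biUnion_finset_le _ _
      obtain ⟨z, -, hz⟩ := Finset.exists_le_of_sum_le ht hsum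
      refine ⟨p + ρ • z, ?_⟩
      have h1 := hsplit (p + ρ • z) (ρ / 4) (by positivity)
      have e1 : T / 2 ^ (k + 1) = 2 * (ρ / 4) := by
        rw [hρdef, pow_succ]
        ring
      rw [e1]
      have h2 := hcompl (p + ρ • z) (2 * (ρ / 4))
      have h3 : 0 ≤ m.real (closedBall (p + ρ • z) (2 * (ρ / 4)))ᶜ := measureReal_nonneg
      have h4 : M / (2 * t.card) * m.real (closedBall (p + ρ • z) (2 * (ρ / 4)))ᶜ
          ≤ M / (2 * t.card) * (M / 2) := by
        refine (mul_le_mul_of_nonneg_right hz h3).trans (h1.trans (le_of_eq ?_))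
        field_simp
        norm_num
      have h5 := le_of_mul_le_mul_left h4 (by positivity)
      linarith
  choose p hp using hstep
  have hbd : ∀ k, p k ∈ closedBall (0 : Ev n) (2 * T) := by
    intro k
    have hne : (closedBall (p k) (T / 2 ^ k) ∩ closedBall 0 T).Nonempty := by
      by_contra h
      rw [not_nonempty_iff_eq_empty, ← disjoint_iff_inter_eq_empty] at h
      have h0 : m (closedBall (p k) (T / 2 ^ k)) = 0 :=
        measure_mono_null h.subset_compl_right hmT
      have := hp k
      rw [Measure.real, h0, ENNReal.toReal_zero] at this
      linarith
    obtain ⟨y, hy1, hy2⟩ := hne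
    rw [mem_closedBall] at *
    have h2 : T / 2 ^ k ≤ T := div_le_self hT.le (one_le_pow₀ one_le_two)
    have h3 := dist_triangle (p k) y 0
    rw [dist_comm] at hy1
    linarith
  obtain ⟨q, -, ns, hns, hq⟩ := (isCompact_closedBall (0 : Ev n) (2 * T)).tendsto_subseq hbd
  refine ⟨q, fun h0 => ?_⟩
  obtain ⟨U, hqU, hU, hUm⟩ := Set.exists_isOpen_lt_of_lt {q} (ENNReal.ofReal (M / 2))
    (by rw [h0]; exact ENNReal.ofReal_pos.2 (by positivity))
  obtain ⟨ε, hε, hεU⟩ := Metric.isOpen_iff.1 hU q (hqU rfl)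
  have hlim : Tendsto (fun k : ℕ => T / 2 ^ k) atTop (𝓝 0) := by
    have := (tendsto_pow_atTop_nhds_zero_of_lt_one (r := (1 / 2 : ℝ)) (by norm_num)
      (by norm_num)).const_mul T
    simpa [div_eq_mul_inv] using this
  have h1 := (hlim.comp hns.tendsto_atTop).eventually (gt_mem_nhds (half_pos hε))
  have h2 := hq.eventually (ball_mem_nhds q (half_pos hε))
  obtain ⟨j, hj1, hj2⟩ := (h1.and h2).exists
  have hsub : closedBall (p (ns j)) (T / 2 ^ ns j) ⊆ U := by
    refine Subset.trans (fun y hy => ?_) hεU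
    rw [mem_closedBall] at hy
    simp only [Function.comp_apply, mem_ball] at hj1 hj2 ⊢
    linarith [dist_triangle y (p (ns j)) q]
  have h3 := (measure_mono hsub).trans_lt hUm
  have h4 := hp (ns j)
  rw [ENNReal.lt_ofReal_iff_toReal_lt (measure_ne_top _ _)] at h3
  exact absurd h4 (not_le.2 h3)

/-- Separated level sets of `f` in a ball are controlled by the measure `κ`. -/
def LevelSetControl (Ω : Set (Ev n)) (f : Ev n → Ev n) (κ : Measure (Ev n)) (K : ℝ≥0∞) : Prop :=
  ∀ (x : Ev n) (r : ℝ), 0 < r → ball x (2 * r) ⊆ Ω → ∀ (p : Ev n) (δ : ℝ), 0 < δ →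
    volume (ball x r ∩ f ⁻¹' closedBall p δ) * volume (ball x r \ f ⁻¹' closedBall p (2 * δ))
      ≤ K * (volume (ball (0 : Ev n) (2 * r)) * (ENNReal.ofReal (2 * r) *
        κ (ball x (2 * r) ∩ f ⁻¹' closedBall p (2 * δ)) ^ (((n : ℝ) - 1) / n)))

lemma exists_levelSetControl {Ω Ω' : Set (Ev n)} {f : Ev n → Ev n}
    {R : Fin n → Ev n → Ev n} (hn : 2 ≤ n) (hΩ : IsOpen Ω) (hΩ'b : Bornology.IsBounded Ω')
    (hf : Measurable f) (hfl : LocallyIntegrableOn f Ω) (hR : ∀ i, Measurable (R i))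
    (hw : ∀ i, IsWeakGrad Ω (fun x => f x i) (R i)) (hRi : ∀ i, IntegrableOn (R i) Ω)
    {C₁ : ℝ≥0∞} (hC₁ : C₁ ≠ ⊤)
    (hK : ∀ u : Ev n → ℝ, ContDiff ℝ ∞ u → HasCompactSupport u →
      ∫⁻ x in Ω, ‖chainGrad u f R x‖ₑ ≤ C₁ * eLpNorm (gradient u) n (volume.restrict Ω')) :
    ∃ (κ : Measure (Ev n)) (K : ℝ≥0∞), IsFiniteMeasure κ ∧ K ≠ ⊤ ∧
      (∀ N, MeasurableSet N → volume (N ∩ Ω') = 0 → gradMeasure Ω R (f ⁻¹' N) = 0) ∧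
      κ ≪ gradMeasure Ω R ∧ LevelSetControl Ω f κ K := by
  obtain ⟨κ, hκ, hnull, hac, hctrl⟩ := exists_controlling_measure hn hΩ'b hf hR hRi hC₁ hK
  obtain ⟨c, hc0, hc⟩ := exists_volume_mul_volume_le n
  set w₀ := volume (ball (0 : Ev n) 1) with hw₀
  have hw₀_top : w₀ ≠ ⊤ := measure_ball_lt_top.ne
  have hn0 : (n : ℝ) ≠ 0 := by positivity
  refine ⟨κ, ENNReal.ofReal (2 * c) * w₀ ^ (1 / (n : ℝ)), hκ, by finiteness, hnull, hac, ?_⟩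
  intro x r hr hball p δ hδ
  refine (hc hΩ hf hR hfl hw hRi x hr hball p hδ).trans ?_
  set A := ball x (2 * r) ∩ f ⁻¹' closedBall p (2 * δ)
  have h1 := hctrl A (closedBall p (2 * δ)) measurableSet_closedBall inter_subset_right
  have h2 : volume (closedBall p (2 * δ)) ^ (1 / (n : ℝ))
      = ENNReal.ofReal (2 * δ) * w₀ ^ (1 / (n : ℝ)) := by
    rw [Measure.addHaar_closedBall _ _ (by positivity), finrank_euclideanSpace_fin,
      ENNReal.mul_rpow_of_nonneg _ _ (by positivity), ENNReal.ofReal_rpow_of_nonneg (by positivity)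
        (by positivity), ← Real.rpow_natCast, ← Real.rpow_mul (by positivity),
      mul_one_div_cancel hn0, Real.rpow_one]
  have h3 : ENNReal.ofReal (c / δ) * ENNReal.ofReal (2 * δ) = ENNReal.ofReal (2 * c) := by
    rw [← ENNReal.ofReal_mul (by positivity)]
    congr 1
    field_simp
  rw [h2] at h1
  calc volume (ball (0 : Ev n) (2 * r)) * (ENNReal.ofReal (2 * r) * (ENNReal.ofReal (c / δ) *
          gradMeasure Ω R A))
      ≤ volume (ball (0 : Ev n) (2 * r)) * (ENNReal.ofReal (2 * r) * (ENNReal.ofReal (c / δ) *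
          (κ A ^ (((n : ℝ) - 1) / n) * (ENNReal.ofReal (2 * δ) * w₀ ^ (1 / (n : ℝ)))))) := by gcongr
    _ = (ENNReal.ofReal (c / δ) * ENNReal.ofReal (2 * δ)) * w₀ ^ (1 / (n : ℝ)) *
        (volume (ball (0 : Ev n) (2 * r)) * (ENNReal.ofReal (2 * r) *
          κ A ^ (((n : ℝ) - 1) / n))) := by ring
    _ = _ := by rw [h3]

/-- A point of density zero for `κ` produces a level set of positive volume. -/
lemma LevelSetControl.exists_volume_preimage_ne_zero {Ω : Set (Ev n)} {f : Ev n → Ev n}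
    {κ : Measure (Ev n)} {K : ℝ≥0∞} (h : LevelSetControl Ω f κ K) (hn : 2 ≤ n) (hΩ : IsOpen Ω)
    (hf : Measurable f) {T : ℝ} (hT : ∀ x, ‖f x‖ ≤ T) (hK : K ≠ ⊤) {x : Ev n} (hx : x ∈ Ω)
    (hκ : Tendsto (fun r => κ (closedBall x r) / volume (closedBall x r)) (𝓝[>] 0) (𝓝 0)) :
    ∃ p, volume (Ω ∩ f ⁻¹' {p}) ≠ 0 := by
  obtain ⟨N, hN, hatom⟩ := exists_measure_singleton_ne_zero n
  have hn0 : (0 : ℝ) < n := by positivity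
  have hn1 : (0 : ℝ) < (n : ℝ) - 1 := by
    have : (2 : ℝ) ≤ n := by exact_mod_cast hn
    linarith
  set s := ((n : ℝ) - 1) / n with hs
  have hs0 : 0 < s := by positivity
  set w₀ := volume (ball (0 : Ev n) 1) with hw₀
  have hw₀_top : w₀ ≠ ⊤ := measure_ball_lt_top.ne
  have hw₀_pos : w₀ ≠ 0 := (measure_ball_pos _ _ one_pos).ne'
  have hvol : ∀ (y : Ev n) (ρ : ℝ), 0 < ρ → volume (ball y ρ) = ENNReal.ofReal ρ ^ n * w₀ := by
    intro y ρ hρ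
    rw [Measure.addHaar_ball_of_pos _ _ hρ, finrank_euclideanSpace_fin,
      ENNReal.ofReal_pow hρ.le]
  have hvol' : ∀ (y : Ev n) (ρ : ℝ), 0 < ρ →
      volume (closedBall y ρ) = ENNReal.ofReal ρ ^ n * w₀ := by
    intro y ρ hρ
    rw [Measure.addHaar_closedBall _ _ hρ.le, finrank_euclideanSpace_fin,
      ENNReal.ofReal_pow hρ.le]
  have hNe : (4 * N : ℝ≥0∞) ≠ 0 := by simp [hN.ne']
  have hlim : Tendsto (fun r => K * (w₀ * w₀ ^ s * 4 ^ n) *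
      (κ (closedBall x r) / volume (closedBall x r)) ^ s) (𝓝[>] 0) (𝓝 0) := by
    have h1 := (ENNReal.continuous_rpow_const (y := s)).tendsto 0 |>.comp hκ
    rw [ENNReal.zero_rpow_of_pos hs0] at h1
    have h2 := ENNReal.Tendsto.const_mul (a := K * (w₀ * w₀ ^ s * 4 ^ n)) h1
      (Or.inr (by finiteness))
    simpa using h2
  have hpos : (0 : ℝ≥0∞) < w₀ ^ 2 / (4 * N) :=
    ENNReal.div_pos (pow_ne_zero _ hw₀_pos) (by finiteness)
  have hev := hlim.eventually (gt_mem_nhds hpos)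
  obtain ⟨ε, hε, hball⟩ := Metric.isOpen_iff.1 hΩ x hx
  have hev2 : ∀ᶠ r : ℝ in 𝓝[>] 0, r < ε := nhdsWithin_le_nhds (gt_mem_nhds hε)
  obtain ⟨r₂, ⟨hr₂, hr₂ε⟩, hr₂0⟩ := ((hev.and hev2).and self_mem_nhdsWithin).exists
  obtain ⟨r, rfl⟩ : ∃ r, r₂ = 2 * r := ⟨r₂ / 2, by ring⟩
  have hr : 0 < r := by linarith
  have hsub : ball x (2 * r) ⊆ Ω := (ball_subset_ball hr₂ε.le).trans hball
  have hsub' : ball x r ⊆ Ω := (ball_subset_ball (by linarith)).trans hsub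
  set a := κ (closedBall x (2 * r)) / volume (closedBall x (2 * r)) with ha
  set ρ := ENNReal.ofReal r with hρ
  have hρ2 : ENNReal.ofReal (2 * r) = 2 * ρ := by
    rw [ENNReal.ofReal_mul zero_le_two, ENNReal.ofReal_ofNat]
  have hκa : κ (closedBall x (2 * r)) = a * ((2 * ρ) ^ n * w₀) := by
    rw [← hρ2, ← hvol' x _ hr₂0, ha, ENNReal.div_mul_cancel]
    · exact (measure_closedBall_pos _ _ hr₂0).ne'
    · exact measure_closedBall_lt_top.ne
  have hpow : ((2 * ρ) ^ n) ^ s = (2 * ρ) ^ (n - 1) := by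
    rw [← ENNReal.rpow_natCast, ← ENNReal.rpow_natCast, ← ENNReal.rpow_mul, hs,
      mul_div_cancel₀ _ hn0.ne', Nat.cast_sub (by omega), Nat.cast_one]
  let m : Measure (Ev n) := (volume.restrict (ball x r)).map f
  have hmap : ∀ S, MeasurableSet S → m S = volume (ball x r ∩ f ⁻¹' S) := by
    intro S hS
    rw [Measure.map_apply hf hS, Measure.restrict_apply (hf hS), inter_comm]
  have : IsFiniteMeasure (volume.restrict (ball x r)) := ⟨by simp [measure_ball_lt_top]⟩
  have : IsFiniteMeasure m := inferInstance
  have hmuniv : m univ = ρ ^ n * w₀ := by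
    rw [hmap _ MeasurableSet.univ, preimage_univ, inter_univ, hvol x r hr]
  have hρ0 : ρ ≠ 0 := (ENNReal.ofReal_pos.2 hr).ne'
  have hkey : ∀ p δ, 0 < δ → m (closedBall p δ) * m (closedBall p (2 * δ))ᶜ
      ≤ m univ ^ 2 / (4 * N) := by
    intro p δ hδ
    rw [hmap _ measurableSet_closedBall, hmap _ measurableSet_closedBall.compl, preimage_compl,
      ← sdiff_eq, hmuniv]
    refine (h x r hr hsub p δ hδ).trans ?_
    calc K * (volume (ball (0 : Ev n) (2 * r)) * (ENNReal.ofReal (2 * r) *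
          κ (ball x (2 * r) ∩ f ⁻¹' closedBall p (2 * δ)) ^ s))
        ≤ K * (((2 * ρ) ^ n * w₀) * ((2 * ρ) * (a * ((2 * ρ) ^ n * w₀)) ^ s)) := by
          rw [hvol _ _ hr₂0, hρ2, ← hκa]
          gcongr
          exact inter_subset_left.trans ball_subset_closedBall
      _ = K * (w₀ * w₀ ^ s) * a ^ s * ((2 * ρ) ^ n * ((2 * ρ) * (2 * ρ) ^ (n - 1))) := by
          rw [ENNReal.mul_rpow_of_nonneg _ _ hs0.le, ENNReal.mul_rpow_of_nonneg _ _ hs0.le, hpow]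
          ring
      _ = K * (w₀ * w₀ ^ s * 4 ^ n) * a ^ s * (ρ ^ n) ^ 2 := by
          have e4 : (4 : ℝ≥0∞) = 2 * 2 := by norm_num
          rw [mul_pow_sub_one (by omega), mul_pow, e4, mul_pow]
          ring
      _ ≤ w₀ ^ 2 / (4 * N) * (ρ ^ n) ^ 2 := by gcongr
      _ = (ρ ^ n * w₀) ^ 2 / (4 * N) := by
          rw [div_eq_mul_inv, div_eq_mul_inv]
          ring
  obtain ⟨p, hp⟩ := hatom m (by rw [hmuniv]; positivity) T (by
      rw [hmap _ measurableSet_closedBall.compl]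
      refine measure_mono_null (fun y hy => ?_) (measure_empty (μ := volume))
      exact hy.2 (mem_closedBall_zero_iff.2 (hT y))) (by
      intro p δ hδ
      have h1 := ENNReal.toReal_mono (by
        refine (ENNReal.div_lt_top ?_ hNe).ne
        finiteness) (hkey p δ hδ)
      simpa [Measure.real] using h1)
  refine ⟨p, fun h0 => hp ?_⟩
  rw [hmap _ (measurableSet_singleton p)]
  exact measure_mono_null (inter_subset_inter_left _ hsub') h0

/-- If a level set has positive volume and is not charged by `κ`, then `f` is constant. -/
lemma LevelSetControl.volume_sdiff_eq_zero {Ω : Set (Ev n)} {f : Ev n → Ev n}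
    {κ : Measure (Ev n)} [IsFiniteMeasure κ] {K : ℝ≥0∞} (h : LevelSetControl Ω f κ K)
    (hn : 2 ≤ n) (hΩ : IsOpen Ω) (hΩc : IsPreconnected Ω) (hf : Measurable f) (hK : K ≠ ⊤)
    {p : Ev n} (hp : volume (Ω ∩ f ⁻¹' {p}) ≠ 0) (hκ : κ (f ⁻¹' {p}) = 0) :
    volume (Ω \ f ⁻¹' {p}) = 0 := by
  have hn0 : (0 : ℝ) < n := by positivity
  have hn1 : (0 : ℝ) < (n : ℝ) - 1 := by
    have : (2 : ℝ) ≤ n := by exact_mod_cast hn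
    linarith
  have hs0 : 0 < ((n : ℝ) - 1) / n := by positivity
  set F := f ⁻¹' {p} with hF
  have hprod : ∀ x r, 0 < r → ball x (2 * r) ⊆ Ω → ∀ δ₀ : ℝ, 0 < δ₀ →
      volume (ball x r ∩ F) * volume (ball x r \ f ⁻¹' closedBall p (2 * δ₀)) = 0 := by
    intro x r hr hball δ₀ hδ₀
    have hle : ∀ ε : ℝ≥0∞, 0 < ε →
        volume (ball x r ∩ F) * volume (ball x r \ f ⁻¹' closedBall p (2 * δ₀))
          ≤ K * (volume (ball (0 : Ev n) (2 * r)) * (ENNReal.ofReal (2 * r) *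
            ε ^ (((n : ℝ) - 1) / n))) := by
      intro ε hε
      have h0 : κ.map f {p} < ε := by
        rw [Measure.map_apply hf (measurableSet_singleton p), hκ]
        exact hε
      obtain ⟨U, hpU, hU, hUm⟩ := Set.exists_isOpen_lt_of_lt {p} ε h0
      obtain ⟨η, hη, hηU⟩ := Metric.isOpen_iff.1 hU p (hpU rfl)
      set δ := min δ₀ (η / 4)
      have hδ : 0 < δ := by positivity
      have hδη : 2 * δ < η := by
        have := min_le_right δ₀ (η / 4)
        linarith
      have hsub : closedBall p (2 * δ) ⊆ U := (closedBall_subset_ball hδη).trans hηU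
      have h1 : κ (f ⁻¹' closedBall p (2 * δ)) ≤ ε := by
        rw [← Measure.map_apply hf measurableSet_closedBall]
        exact (measure_mono hsub).trans hUm.le
      calc volume (ball x r ∩ F) * volume (ball x r \ f ⁻¹' closedBall p (2 * δ₀))
          ≤ volume (ball x r ∩ f ⁻¹' closedBall p δ) *
            volume (ball x r \ f ⁻¹' closedBall p (2 * δ)) := by
            gcongr
            · exact preimage_mono (singleton_subset_iff.2 (mem_closedBall_self hδ.le))
            · exact min_le_left _ _
        _ ≤ _ := h x r hr hball p δ hδ
        _ ≤ _ := by
            gcongr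
            exact (measure_mono inter_subset_right).trans h1
    have hlim : Tendsto (fun ε : ℝ≥0∞ => K * (volume (ball (0 : Ev n) (2 * r)) *
        (ENNReal.ofReal (2 * r) * ε ^ (((n : ℝ) - 1) / n)))) (𝓝[>] 0) (𝓝 0) := by
      have h1 := ((ENNReal.continuous_rpow_const (y := ((n : ℝ) - 1) / n)).tendsto 0).mono_left
        (nhdsWithin_le_nhds (s := Ioi 0))
      rw [ENNReal.zero_rpow_of_pos hs0] at h1
      have h2 := ENNReal.Tendsto.const_mul (a := K * (volume (ball (0 : Ev n) (2 * r)) *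
        ENNReal.ofReal (2 * r))) h1
        (Or.inr (ENNReal.mul_ne_top hK (ENNReal.mul_ne_top measure_ball_lt_top.ne
          ENNReal.ofReal_ne_top)))
      simpa [mul_assoc] using h2
    exact le_antisymm (ge_of_tendsto hlim
      (eventually_nhdsWithin_of_forall hle)) zero_le
  have hdich : ∀ x r, 0 < r → ball x (2 * r) ⊆ Ω →
      volume (ball x r ∩ F) = 0 ∨ volume (ball x r \ F) = 0 := by
    intro x r hr hball
    by_cases h0 : volume (ball x r ∩ F) = 0
    · exact Or.inl h0
    · right
      have hsub : ball x r \ F ⊆ ⋃ k : ℕ, ball x r \ f ⁻¹' closedBall p (2 * (1 / ((k : ℝ) + 1))) := by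
        rintro y ⟨hy, hyF⟩
        have hd : 0 < dist (f y) p := dist_pos.2 hyF
        obtain ⟨k, hk⟩ := exists_nat_one_div_lt (half_pos hd)
        refine mem_iUnion.2 ⟨k, hy, fun hyk => ?_⟩
        rw [mem_preimage, mem_closedBall] at hyk
        linarith
      refine measure_mono_null hsub (measure_iUnion_null fun k => ?_)
      exact (mul_eq_zero.1 (hprod x r hr hball _ (by positivity))).resolve_left h0
  let U : Set (Ev n) := {x | ∃ O, IsOpen O ∧ x ∈ O ∧ volume (O ∩ F) = 0}
  let V : Set (Ev n) := {x | ∃ O, IsOpen O ∧ x ∈ O ∧ volume (O \ F) = 0}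
  have hU : IsOpen U := isOpen_iff_forall_mem_open.2 fun x ⟨O, hO, hxO, h0⟩ =>
    ⟨O, fun y hy => ⟨O, hO, hy, h0⟩, hO, hxO⟩
  have hV : IsOpen V := isOpen_iff_forall_mem_open.2 fun x ⟨O, hO, hxO, h0⟩ =>
    ⟨O, fun y hy => ⟨O, hO, hy, h0⟩, hO, hxO⟩
  have hUV : Ω ⊆ U ∪ V := by
    intro x hx
    obtain ⟨ε, hε, hball⟩ := Metric.isOpen_iff.1 hΩ x hx
    have hsub : ball x (2 * (ε / 2)) ⊆ Ω := by rwa [mul_div_cancel₀ _ two_ne_zero]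
    have hxm : x ∈ ball x (ε / 2) := mem_ball_self (by positivity)
    rcases hdich x (ε / 2) (by positivity) hsub with h0 | h0
    · exact Or.inl ⟨_, isOpen_ball, hxm, h0⟩
    · exact Or.inr ⟨_, isOpen_ball, hxm, h0⟩
  have hdisj : U ∩ V = ∅ := by
    rw [eq_empty_iff_forall_notMem]
    rintro x ⟨⟨O₁, hO₁, hx₁, h₁⟩, O₂, hO₂, hx₂, h₂⟩
    have hsub : O₁ ∩ O₂ ⊆ (O₁ ∩ F) ∪ (O₂ \ F) := by
      rintro y ⟨hy₁, hy₂⟩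
      by_cases hy : y ∈ F
      · exact Or.inl ⟨hy₁, hy⟩
      · exact Or.inr ⟨hy₂, hy⟩
    have h0 := measure_mono_null hsub (measure_union_null h₁ h₂)
    exact ((hO₁.inter hO₂).measure_pos volume ⟨x, hx₁, hx₂⟩).ne' h0
  rcases isPreconnected_iff_subset_of_disjoint.1 hΩc U V hU hV hUV
    (by rw [hdisj, inter_empty]) with hsub | hsub
  · refine absurd (measure_null_of_locally_null _ fun x hx => ?_) hp
    obtain ⟨O, hO, hxO, h0⟩ := hsub hx.1
    refine ⟨_, inter_mem_nhdsWithin _ (hO.mem_nhds hxO), measure_mono_null ?_ h0⟩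
    exact fun y hy => ⟨hy.2, hy.1.2⟩
  · refine measure_null_of_locally_null _ fun x hx => ?_
    obtain ⟨O, hO, hxO, h0⟩ := hsub hx.1
    refine ⟨_, inter_mem_nhdsWithin _ (hO.mem_nhds hxO), measure_mono_null ?_ h0⟩
    exact fun y hy => ⟨hy.2, hy.1.2⟩

/-- Either `f` takes values in `Ω'` almost everywhere, or `f` is constant almost everywhere. -/
lemma LevelSetControl.ae_mem_or_exists_ae_eq {Ω Ω' : Set (Ev n)} {f : Ev n → Ev n}
    {κ : Measure (Ev n)} [IsFiniteMeasure κ] {K : ℝ≥0∞} (h : LevelSetControl Ω f κ K)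
    (hn : 2 ≤ n) (hΩ : IsOpen Ω) (hΩc : IsPreconnected Ω) (hΩ' : IsOpen Ω') (hf : Measurable f)
    {T : ℝ} (hT : ∀ x, ‖f x‖ ≤ T) (hK : K ≠ ⊤)
    (hnull : ∀ N, MeasurableSet N → volume (N ∩ Ω') = 0 → κ (f ⁻¹' N) = 0) :
    (∀ᵐ x ∂volume.restrict Ω, f x ∈ Ω') ∨ ∃ p, ∀ᵐ x ∂volume.restrict Ω, f x = p := by
  rw [or_iff_not_imp_left]
  intro hE
  have : NeZero n := ⟨by omega⟩
  set E := Ω ∩ f ⁻¹' Ω'ᶜ with hEdef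
  have hEm : MeasurableSet (f ⁻¹' Ω'ᶜ) := hf hΩ'.measurableSet.compl
  have hE0 : volume E ≠ 0 := by
    intro h0
    refine hE ?_
    rw [ae_restrict_iff' hΩ.measurableSet, ae_iff]
    convert h0 using 2
    ext x
    simp [hEdef]
  have hκE : κ E = 0 := measure_mono_null inter_subset_right
    (hnull _ hΩ'.measurableSet.compl (by simp))
  have hrn : ∀ᵐ x ∂volume.restrict E, κ.rnDeriv volume x = 0 := by
    have h1 := (Measure.setLIntegral_rnDeriv_le (μ := κ) (ν := volume) E).trans_eq hκE
    have h2 := (lintegral_eq_zero_iff (Measure.measurable_rnDeriv κ volume)).1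
      (le_antisymm h1 zero_le)
    exact h2
  rw [ae_restrict_iff' (hΩ.measurableSet.inter hEm)] at hrn
  have hB := hrn.and (Besicovitch.ae_tendsto_rnDeriv κ (volume : Measure (Ev n)))
  have hex : ∃ x ∈ E, (x ∈ E → κ.rnDeriv volume x = 0) ∧
      Tendsto (fun r => κ (closedBall x r) / volume (closedBall x r)) (𝓝[>] 0)
        (𝓝 (κ.rnDeriv volume x)) := by
    by_contra hcon
    push Not at hcon
    have hsub : E ⊆ {x | ¬((x ∈ E → κ.rnDeriv volume x = 0) ∧
        Tendsto (fun r => κ (closedBall x r) / volume (closedBall x r)) (𝓝[>] 0)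
          (𝓝 (κ.rnDeriv volume x)))} := fun x hx hx' => hcon x hx hx'.1 hx'.2
    exact hE0 (measure_mono_null hsub (ae_iff.1 hB))
  obtain ⟨x, hxE, hx0, hxlim⟩ := hex
  rw [hx0 hxE] at hxlim
  obtain ⟨p, hp⟩ := h.exists_volume_preimage_ne_zero hn hΩ hf hT hK hxE.1 hxlim
  refine ⟨p, ?_⟩
  have hκp : κ (f ⁻¹' {p}) = 0 := hnull _ (measurableSet_singleton p)
    (measure_mono_null inter_subset_left (measure_singleton p))
  have h0 := h.volume_sdiff_eq_zero hn hΩ hΩc hf hK hp hκp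
  rw [ae_restrict_iff' hΩ.measurableSet, ae_iff]
  convert h0 using 2
  ext x
  simp

end Dichotomy

end Paper

namespace Paper

section LipschitzApproximation

open scoped ContDiff Convolution

variable {n : ℕ}

lemma IsWeakGrad.congr {Ω : Set (Ev n)} {v v' : Ev n → ℝ} {G G' : Ev n → Ev n}
    (h : IsWeakGrad Ω v G) (hv : v =ᵐ[volume.restrict Ω] v')
    (hG : G =ᵐ[volume.restrict Ω] G') : IsWeakGrad Ω v' G' := by
  refine ⟨fun j => ?_, fun η hη hηs hηΩ j => ?_⟩
  · intro x hx
    obtain ⟨s, hs, hs'⟩ := h.1 j x hx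
    refine ⟨s ∩ Ω, inter_mem hs self_mem_nhdsWithin, ?_⟩
    refine (hs'.mono_set inter_subset_left).congr_fun_ae ?_
    have h1 : G =ᵐ[volume.restrict (s ∩ Ω)] G' :=
      ae_mono (Measure.restrict_mono inter_subset_right le_rfl) hG
    filter_upwards [h1] with y hy
    rw [hy]
  · have h1 := h.2 η hη hηs hηΩ j
    calc ∫ x in Ω, v' x * fderiv ℝ η x (EuclideanSpace.single j 1)
        = ∫ x in Ω, v x * fderiv ℝ η x (EuclideanSpace.single j 1) := by
          refine integral_congr_ae ?_
          filter_upwards [hv] with x hx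
          rw [hx]
      _ = - ∫ x in Ω, G x j * η x := h1
      _ = - ∫ x in Ω, G' x j * η x := by
          congr 1
          refine integral_congr_ae ?_
          filter_upwards [hG] with x hx
          rw [hx]

/-- The gradient of a smooth function is its weak gradient. -/
lemma isWeakGrad_gradient (Ω : Set (Ev n)) {u : Ev n → ℝ} (hu : ContDiff ℝ ∞ u) :
    IsWeakGrad Ω u (gradient u) := by
  have hc : ∀ j : Fin n, Continuous fun x => fderiv ℝ u x (EuclideanSpace.single j 1) := fun j =>
    (hu.continuous_fderiv (by simp)).clm_apply continuous_const
  refine ⟨fun j => ?_, fun η hη hηs hηΩ j => ?_⟩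
  · simp only [gradient_apply]
    exact (hc j).locallyIntegrable.locallyIntegrableOn Ω
  · have hd : Continuous fun x => fderiv ℝ η x (EuclideanSpace.single j 1) :=
      (hη.continuous_fderiv (by simp)).clm_apply continuous_const
    have hds : HasCompactSupport fun x => fderiv ℝ η x (EuclideanSpace.single j 1) :=
      hηs.fderiv_apply ℝ _
    simp only [gradient_apply]
    rw [setIntegral_eq_integral_of_forall_compl_eq_zero fun x hx => ?_,
      setIntegral_eq_integral_of_forall_compl_eq_zero fun x hx => ?_]
    · refine integral_mul_fderiv_eq_neg_fderiv_mul_of_integrable ?_ ?_ ?_ ?_ ?_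
      · exact ((hc j).mul hη.continuous).integrable_of_hasCompactSupport hηs.mul_left
      · exact (hu.continuous.mul hd).integrable_of_hasCompactSupport hds.mul_left
      · exact (hu.continuous.mul hη.continuous).integrable_of_hasCompactSupport hηs.mul_left
      · exact fun x _ => hu.differentiable (by simp) x
      · exact fun x _ => hη.differentiable (by simp) x
    · rw [image_eq_zero_of_notMem_tsupport fun h => hx (hηΩ h), mul_zero]
    · have : fderiv ℝ η x = 0 := image_eq_zero_of_notMem_tsupport fun h =>
        hx (hηΩ (tsupport_fderiv_subset ℝ h))
      rw [this, _root_.zero_apply, mul_zero]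

lemma lipschitzWith_moll {g : Ev n → ℝ} {L : ℝ≥0} (hg : LipschitzWith L g) (m : ℕ) :
    LipschitzWith L (moll m g) := by
  have h_integrable : ∀ x, Integrable fun t => mollKer n m t • g (x - t) := fun x =>
    ((continuous_mollKer m).smul (hg.continuous.comp (continuous_const.sub
      continuous_id))).integrable_of_hasCompactSupport (hasCompactSupport_mollKer m).smul_right
  refine LipschitzWith.of_dist_le_mul fun x y => ?_
  have e : moll m g x - moll m g y = ∫ t, mollKer n m t • (g (x - t) - g (y - t)) := by
    simp only [smul_sub]
    rw [integral_sub (h_integrable x) (h_integrable y)]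
    rfl
  rw [dist_eq_norm, e]
  refine (norm_integral_le_of_norm_le ((integrable_mollKer m).mul_const (L * dist x y))
    (ae_of_all _ fun t => ?_)).trans_eq ?_
  · rw [norm_smul, Real.norm_of_nonneg (mollKer_nonneg m t), ← dist_eq_norm]
    refine mul_le_mul_of_nonneg_left ?_ (mollKer_nonneg m t)
    simpa using hg.dist_le_mul (x - t) (y - t)
  · rw [integral_mul_const, integral_mollKer, one_mul]

lemma tendsto_moll_of_continuous {g : Ev n → ℝ} (hg : Continuous g) (x : Ev n) :
    Tendsto (fun m => moll m g x) atTop (𝓝 (g x)) :=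
  ContDiffBump.convolution_tendsto_right_of_continuous (φ := mollBump n)
    tendsto_one_div_add_atTop_nhds_zero_nat hg x

/-- Smooth approximation of a Lipschitz function on a bounded open set. -/
lemma exists_smooth_approx {Ω' : Set (Ev n)} (hΩ' : IsOpen Ω') (hΩ'b : Bornology.IsBounded Ω')
    {u : Ev n → ℝ} {Du : Ev n → Ev n} {L : ℝ≥0} (hu : LipschitzOnWith L u Ω')
    (hDu : IsWeakGrad Ω' u Du) (hDui : IntegrableOn Du Ω') :
    ∃ (w : ℕ → Ev n → ℝ) (B : ℝ), (∀ m, ContDiff ℝ ∞ (w m)) ∧ (∀ m, HasCompactSupport (w m)) ∧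
      (∀ m, ∀ y ∈ Ω', ‖w m y‖ ≤ B) ∧ (∀ m, ∀ y ∈ Ω', ‖fderiv ℝ (w m) y‖ ≤ L) ∧
      (∀ y ∈ Ω', Tendsto (fun m => w m y) atTop (𝓝 (u y))) ∧
      ∀ᵐ y ∂volume.restrict Ω', Tendsto (fun m => gradient (w m) y) atTop (𝓝 (Du y)) := by
  obtain ⟨g, hg, hug⟩ := hu.extend_real
  obtain ⟨T, hT, hΩT⟩ : ∃ T : ℝ, 0 < T ∧ Ω' ⊆ ball 0 T := by
    obtain ⟨T, hT⟩ := hΩ'b.subset_ball 0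
    exact ⟨max T 1, by positivity, hT.trans (ball_subset_ball (le_max_left _ _))⟩
  let χ : ContDiffBump (0 : Ev n) := ⟨T, T + 1, hT, by linarith⟩
  have hgl : LocallyIntegrable g := hg.continuous.locallyIntegrable
  have hχ1 : ∀ m, ∀ y ∈ ball (0 : Ev n) T, χ y * moll m g y = moll m g y := by
    intro m y hy
    rw [χ.one_of_mem_closedBall (ball_subset_closedBall hy), one_mul]
  have hχ : ∀ m, ∀ y ∈ Ω', (fun y => χ y * moll m g y) =ᶠ[𝓝 y] moll m g := by
    intro m y hy
    filter_upwards [isOpen_ball.mem_nhds (hΩT hy)] with z hz using hχ1 m z hz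
  obtain ⟨B₀, hB₀⟩ := (isBounded_iff_forall_norm_le.1 (Metric.isBounded_range_of_tendsto _
    (tendsto_moll_of_continuous hg.continuous (0 : Ev n))))
  refine ⟨fun m y => χ y * moll m g y, B₀ + L * T, fun m => χ.contDiff.mul (contDiff_moll m hgl),
    fun m => χ.hasCompactSupport.mul_right, fun m y hy => ?_, fun m y hy => ?_, fun y hy => ?_, ?_⟩
  · beta_reduce
    rw [hχ1 m y (hΩT hy)]
    have h1 := (lipschitzWith_moll hg m).dist_le_mul y 0
    have h2 := hB₀ _ (mem_range_self m)
    have h3 : dist y 0 ≤ T := (hΩT hy).le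
    rw [dist_eq_norm] at h1
    have h4 : (L : ℝ) * dist y 0 ≤ L * T := by gcongr
    calc ‖moll m g y‖ ≤ ‖moll m g 0‖ + ‖moll m g y - moll m g 0‖ := norm_le_insert' _ _
      _ ≤ B₀ + L * T := add_le_add h2 (h1.trans h4)
  · beta_reduce
    rw [(hχ m y hy).fderiv_eq]
    exact norm_fderiv_le_of_lipschitz ℝ (lipschitzWith_moll hg m)
  · simp only [hχ1 _ y (hΩT hy), hug hy]
    exact tendsto_moll_of_continuous hg.continuous y
  · have hwg : IsWeakGrad Ω' g Du := hDu.congr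
      ((ae_restrict_mem hΩ'.measurableSet).mono fun y hy => hug hy) (ae_eq_refl _)
    have hgi : IntegrableOn g Ω' :=
      (hg.continuous.continuousOn.integrableOn_compact
        (isCompact_closedBall (0 : Ev n) T)).mono_set (hΩT.trans ball_subset_closedBall)
    have hlim := tendsto_moll_ae (hDui.integrable_indicator hΩ'.measurableSet).locallyIntegrable
    filter_upwards [ae_restrict_of_ae hlim, ae_restrict_mem hΩ'.measurableSet] with y hy hyΩ
    rw [indicator_of_mem hyΩ] at hy
    refine hy.congr' ?_
    obtain ⟨ε, hε, hball⟩ := Metric.isOpen_iff.1 hΩ' y hyΩ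
    filter_upwards [tendsto_one_div_add_atTop_nhds_zero_nat.eventually (gt_mem_nhds (half_pos hε))]
      with m hm
    have hsub : ∀ z ∈ ball y (ε / 2), closedBall z (1 / ((m : ℝ) + 1)) ⊆ Ω' := by
      intro z hz t ht
      refine hball ?_
      rw [mem_ball, mem_closedBall] at *
      linarith [dist_triangle t z y]
    rw [← gradient_moll hΩ'.measurableSet hΩ'.measurableSet subset_rfl hgi hDui hwg
      (hsub y (mem_ball_self (half_pos hε)))]
    have heq : moll m (Ω'.indicator g) =ᶠ[𝓝 y] fun y => χ y * moll m g y := by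
      filter_upwards [hχ m y hyΩ, ball_mem_nhds y (half_pos hε)] with z hz hz'
      rw [hz]
      exact moll_congr fun t ht => indicator_of_mem (hsub z hz' ht) _
    exact heq.gradient_eq

end LipschitzApproximation

end Paper

namespace Paper

section LimitOperator

open scoped ContDiff

variable {n : ℕ}

/-- The norm bound of the composition operators passes to the limit on smooth functions. -/
lemma eLpNorm_chainGrad_le_of_tendsto {Ω Ω' : Set (Ev n)} (hΩ : IsOpen Ω)
    (hΩ' : Bornology.IsBounded Ω') {φ : ℕ → Ev n → Ev n} {f : Ev n → Ev n}
    {R : Fin n → Ev n → Ev n} {ρ : ℝ} (hρ : 1 ≤ ρ) {C : ℝ≥0∞}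
    (hφm : ∀ k, AEStronglyMeasurable (φ k) (volume.restrict Ω))
    (hφf : ∀ᵐ x ∂volume.restrict Ω, Tendsto (fun k => φ k x) atTop (𝓝 (f x)))
    (hf : LocallyIntegrableOn f Ω) (hR : ∀ i, IsWeakGrad Ω (fun x => f x i) (R i))
    (hcomp : ∀ k, CompOpBoundedLip Ω Ω' (φ k) (n : ℝ≥0∞) (ENNReal.ofReal ρ) C)
    {u : Ev n → ℝ} (hu : ContDiff ℝ ∞ u) (hus : HasCompactSupport u) :
    eLpNorm (chainGrad u f R) (ENNReal.ofReal ρ) (volume.restrict Ω)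
      ≤ C * eLpNorm (gradient u) n (volume.restrict Ω') := by
  obtain ⟨L, hL⟩ := ContDiff.lipschitzWith_of_hasCompactSupport hus hu (by simp)
  have : IsFiniteMeasure (volume.restrict Ω') := ⟨by simpa using hΩ'.measure_lt_top⟩
  obtain ⟨A, hA⟩ := bounded_fderiv_of_hasCompactSupport hu hus
  have hgm : AEStronglyMeasurable (gradient u) (volume.restrict Ω') :=
    (isWeakGrad_gradient univ hu).aestronglyMeasurable.mono_measure
      (by rw [Measure.restrict_univ]; exact Measure.restrict_le_self)
  have hfin : eLpNorm (gradient u) n (volume.restrict Ω') < ⊤ :=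
    (MemLp.of_bound hgm A (ae_of_all _ fun y => (norm_gradient u y).trans_le (hA y))).2
  choose G hG hGC using fun k =>
    hcomp k u (gradient u) L hL.lipschitzOnWith (isWeakGrad_gradient Ω' hu) hfin
  obtain ⟨B, hB⟩ := hus.exists_bound_of_continuous hu.continuous
  refine IsWeakGrad.eLpNorm_le_of_tendsto hΩ hρ hG (isWeakGrad_comp hΩ hf hR hu hus)
    (fun θ hθ hθs _ => ?_) hGC
  have hθi : Integrable θ (volume.restrict Ω) :=
    (hθ.continuous.integrable_of_hasCompactSupport hθs).restrict
  refine tendsto_integral_of_dominated_convergence (fun x => B * ‖θ x‖)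
    (fun k => (hu.continuous.comp_aestronglyMeasurable (hφm k)).mul hθi.1) (hθi.norm.const_mul B)
    (fun k => ae_of_all _ fun x => ?_) ?_
  · rw [norm_mul]
    gcongr
    exact hB _
  · filter_upwards [hφf] with x hx
    exact ((hu.continuous.tendsto _).comp hx).mul_const _

lemma integrable_sum_norm {Ω : Set (Ev n)} {R : Fin n → Ev n → Ev n}
    (hRi : ∀ i, IntegrableOn (R i) Ω) : IntegrableOn (fun x => ∑ i, ‖R i x‖) Ω :=
  integrable_finsetSum _ fun i _ => (hRi i).norm

lemma norm_chainGrad_le {u : Ev n → ℝ} {f : Ev n → Ev n} {R : Fin n → Ev n → Ev n} {x : Ev n}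
    {c : ℝ} (h : ‖fderiv ℝ u (f x)‖ ≤ c) : ‖chainGrad u f R x‖ ≤ c * ∑ i, ‖R i x‖ := by
  rw [chainGrad, Finset.mul_sum]
  refine (norm_sum_le _ _).trans (Finset.sum_le_sum fun i _ => ?_)
  rw [norm_smul]
  gcongr
  refine (ContinuousLinearMap.le_opNorm _ _).trans ?_
  simpa using h

/-- A gradient bound on smooth functions extends to Lipschitz functions on `Ω'`. -/
lemma exists_isWeakGrad_comp_of_lipschitz {Ω Ω' : Set (Ev n)} (hn : 1 ≤ n) (hΩ : IsOpen Ω)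
    (hΩ' : IsOpen Ω')
    (hΩ'b : Bornology.IsBounded Ω') {f : Ev n → Ev n} {R : Fin n → Ev n → Ev n} {q C : ℝ≥0∞}
    (hf : Measurable f) (hfl : LocallyIntegrableOn f Ω) (hRm : ∀ i, Measurable (R i))
    (hRi : ∀ i, IntegrableOn (R i) Ω) (hR : ∀ i, IsWeakGrad Ω (fun x => f x i) (R i))
    (hfΩ' : ∀ᵐ x ∂volume.restrict Ω, f x ∈ Ω')
    (hnull : ∀ N, MeasurableSet N → volume (N ∩ Ω') = 0 → gradMeasure Ω R (f ⁻¹' N) = 0)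
    (hC : ∀ u : Ev n → ℝ, ContDiff ℝ ∞ u → HasCompactSupport u →
      eLpNorm (chainGrad u f R) q (volume.restrict Ω)
        ≤ C * eLpNorm (gradient u) n (volume.restrict Ω')) (hCt : C ≠ ⊤)
    {u : Ev n → ℝ} {Du : Ev n → Ev n} {L : ℝ≥0} (hu : LipschitzOnWith L u Ω')
    (hDu : IsWeakGrad Ω' u Du) (hDun : eLpNorm Du n (volume.restrict Ω') < ⊤) :
    ∃ Dv : Ev n → Ev n, IsWeakGrad Ω (u ∘ f) Dv ∧
      eLpNorm Dv q (volume.restrict Ω) ≤ C * eLpNorm Du n (volume.restrict Ω') := by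
  have hfin : IsFiniteMeasure (volume.restrict Ω') := ⟨by simpa using hΩ'b.measure_lt_top⟩
  have hDui : IntegrableOn Du Ω' :=
    (show MemLp Du n (volume.restrict Ω') from ⟨hDu.aestronglyMeasurable, hDun⟩).integrable
      (by exact_mod_cast hn)
  obtain ⟨w, B, hw, hws, hwB, hwL, hwu, hwD⟩ := exists_smooth_approx hΩ' hΩ'b hu hDu hDui
  let Dv : Ev n → Ev n := fun x => ∑ i, Du (f x) i • R i x
  have hae : ∀ᵐ x ∂volume.restrict Ω,
      Tendsto (fun m => chainGrad (w m) f R x) atTop (𝓝 (Dv x)) := by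
    set N := toMeasurable (volume.restrict Ω')
      {y | ¬ Tendsto (fun m => gradient (w m) y) atTop (𝓝 (Du y))} with hN
    have hNm : MeasurableSet N := measurableSet_toMeasurable _ _
    have hN0 : volume (N ∩ Ω') = 0 := by
      rw [← Measure.restrict_apply hNm, hN, measure_toMeasurable]
      exact ae_iff.1 hwD
    have h0 := hnull N hNm hN0
    rw [gradMeasure, withDensity_apply_eq_zero (measurable_sum_enorm hRm), ← compl_compl (_ ∩ _)]
      at h0
    have h1 : ∀ᵐ x ∂volume.restrict Ω, x ∈ ({x | ∑ i, ‖R i x‖ₑ ≠ 0} ∩ f ⁻¹' N)ᶜ := h0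
    filter_upwards [h1] with x hx
    by_cases hxN : f x ∈ N
    · have hx0 : ∑ i, ‖R i x‖ₑ = 0 := by
        by_contra hne
        exact hx ⟨hne, hxN⟩
      have hR0 : ∀ i, R i x = 0 := fun i => by
        simpa using (Finset.sum_eq_zero_iff.1 hx0) i (Finset.mem_univ i)
      simp [chainGrad, Dv, hR0]
    · have hlim : Tendsto (fun m => gradient (w m) (f x)) atTop (𝓝 (Du (f x))) := by
        by_contra hne
        exact hxN (subset_toMeasurable _ _ hne)
      refine tendsto_finsetSum _ fun i _ => Tendsto.smul_const ?_ _
      simp only [← gradient_apply]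
      exact ((EuclideanSpace.proj i : Ev n →L[ℝ] ℝ).continuous.tendsto _).comp hlim
  have hcm : ∀ m, AEStronglyMeasurable (chainGrad (w m) f R) (volume.restrict Ω) := fun m =>
    (measurable_chainGrad hf hRm (hw m)).aestronglyMeasurable
  have hDvm : AEStronglyMeasurable Dv (volume.restrict Ω) :=
    aestronglyMeasurable_of_tendsto_ae atTop hcm hae
  have hbd : ∀ m, ∀ᵐ x ∂volume.restrict Ω, ‖chainGrad (w m) f R x‖ ≤ L * ∑ i, ‖R i x‖ := by
    intro m
    filter_upwards [hfΩ'] with x hx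
    exact norm_chainGrad_le (hwL m _ hx)
  have h_integrable : IntegrableOn (fun x => L * ∑ i, ‖R i x‖) Ω :=
    (integrable_sum_norm hRi).const_mul _
  have hDvi : IntegrableOn Dv Ω := by
    refine Integrable.mono' h_integrable hDvm ?_
    filter_upwards [ae_all_iff.2 hbd, hae] with x hx hx'
    exact le_of_tendsto' hx'.norm hx
  refine ⟨Dv, ⟨fun j => (LocallyIntegrableOn.coord hDvi.locallyIntegrableOn j), ?_⟩, ?_⟩
  · intro η hη hηs hηΩ j
    have hd : Continuous fun x => fderiv ℝ η x (EuclideanSpace.single j 1) :=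
      (hη.continuous_fderiv (by simp)).clm_apply continuous_const
    have hdi : Integrable (fun x => fderiv ℝ η x (EuclideanSpace.single j 1))
        (volume.restrict Ω) :=
      (hd.integrable_of_hasCompactSupport (hηs.fderiv_apply ℝ _)).restrict
    obtain ⟨A, hA⟩ := hηs.exists_bound_of_continuous hη.continuous
    have hleft : Tendsto (fun m => ∫ x in Ω, (w m ∘ f) x *
        fderiv ℝ η x (EuclideanSpace.single j 1)) atTop
        (𝓝 (∫ x in Ω, (u ∘ f) x * fderiv ℝ η x (EuclideanSpace.single j 1))) := by
      refine tendsto_integral_of_dominated_convergence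
        (fun x => B * ‖fderiv ℝ η x (EuclideanSpace.single j 1)‖) (fun m => ?_)
        (hdi.norm.const_mul B) (fun m => ?_) ?_
      · exact ((hw m).continuous.measurable.comp hf).aestronglyMeasurable.mul hdi.1
      · filter_upwards [hfΩ'] with x hx
        rw [norm_mul]
        gcongr
        exact hwB m _ hx
      · filter_upwards [hfΩ'] with x hx
        exact (hwu _ hx).mul_const _
    have hright : Tendsto (fun m => ∫ x in Ω, chainGrad (w m) f R x j * η x) atTop
        (𝓝 (∫ x in Ω, Dv x j * η x)) := by
      refine tendsto_integral_of_dominated_convergence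
        (fun x => (L * ∑ i, ‖R i x‖) * A) (fun m => ?_) (h_integrable.mul_const A) (fun m => ?_) ?_
      · exact ((EuclideanSpace.proj j : Ev n →L[ℝ] ℝ).continuous.comp_aestronglyMeasurable
          (hcm m)).mul hη.continuous.aestronglyMeasurable
      · filter_upwards [hbd m] with x hx
        rw [norm_mul]
        have h1 : ‖chainGrad (w m) f R x j‖ ≤ L * ∑ i, ‖R i x‖ := (PiLp.norm_apply_le _ j).trans hx
        exact mul_le_mul h1 (hA x) (norm_nonneg _) ((norm_nonneg _).trans h1)
      · filter_upwards [hae] with x hx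
        exact (((EuclideanSpace.proj j : Ev n →L[ℝ] ℝ).continuous.tendsto _).comp hx).mul_const _
    refine tendsto_nhds_unique hleft ?_
    refine hright.neg.congr fun m => ?_
    exact ((isWeakGrad_comp hΩ hfl hR (hw m) (hws m)).2 η hη hηs hηΩ j).symm
  · have hn0 : (0 : ℝ) < n := by positivity
    have hne : ((n : ℝ≥0∞)) ≠ 0 := by
      have : n ≠ 0 := by omega
      simpa using this
    have hlim : Tendsto (fun m => eLpNorm (gradient (w m)) n (volume.restrict Ω')) atTop
        (𝓝 (eLpNorm Du n (volume.restrict Ω'))) := by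
      simp only [eLpNorm_eq_lintegral_rpow_enorm_toReal hne (ENNReal.natCast_ne_top n),
        ENNReal.toReal_natCast]
      refine ((ENNReal.continuous_rpow_const (y := 1 / (n : ℝ))).tendsto _).comp ?_
      refine tendsto_lintegral_of_dominated_convergence' (fun _ => (L : ℝ≥0∞) ^ (n : ℝ))
        (fun m => ?_) (fun m => ?_) ?_ ?_
      · exact ((isWeakGrad_gradient Ω' (hw m)).aestronglyMeasurable.enorm).pow_const _
      · filter_upwards [ae_restrict_mem hΩ'.measurableSet] with y hy
        gcongr
        rw [← ofReal_norm, norm_gradient]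
        refine (ENNReal.ofReal_le_ofReal (hwL m y hy)).trans_eq ?_
        simp
      · rw [lintegral_const]
        exact ENNReal.mul_ne_top (by finiteness) (measure_ne_top _ _)
      · filter_upwards [hwD] with y hy
        exact ((ENNReal.continuous_rpow_const (y := (n : ℝ))).tendsto _).comp hy.enorm
    calc eLpNorm Dv q (volume.restrict Ω)
        ≤ liminf (fun m => eLpNorm (chainGrad (w m) f R) q (volume.restrict Ω)) atTop :=
          Lp.eLpNorm_lim_le_liminf_eLpNorm hcm _ hae
      _ ≤ liminf (fun m => C * eLpNorm (gradient (w m)) n (volume.restrict Ω')) atTop :=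
          liminf_le_liminf (Eventually.of_forall fun m => hC _ (hw m) (hws m))
      _ = C * eLpNorm Du n (volume.restrict Ω') :=
          (ENNReal.Tendsto.const_mul hlim (Or.inr hCt)).liminf_eq

end LimitOperator

end Paper

namespace Paper

section Limit

open scoped ContDiff

variable {n : ℕ}

/-- Uniformly bounded composition operators on Lipschitz functions pass to the limit under
distributional convergence of the mappings. -/
lemma compOpBoundedLip_of_tendsto {Ω Ω' : Set (Ev n)} (hn : 2 ≤ n) (hΩ : IsBoundedDomain Ω)
    (hΩ' : IsBoundedDomain Ω') {φ : ℕ → Ev n → Ev n} {φ0 : Ev n → Ev n} {R₀ : Fin n → Ev n → Ev n}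
    {ρ : ℝ} (hρ : 1 ≤ ρ) {C : ℝ≥0∞} (hC : C ≠ ⊤) (hφc : ∀ k, ContinuousOn (φ k) Ω)
    (hφΩ' : ∀ k, MapsTo (φ k) Ω Ω') (hφ0 : LocallyIntegrableOn φ0 Ω)
    (hR₀ : ∀ i, IsWeakGrad Ω (fun x => φ0 x i) (R₀ i))
    (hconv : ∀ θ : Ev n → ℝ, ContDiff ℝ (⊤ : ℕ∞) θ → HasCompactSupport θ → tsupport θ ⊆ Ω →
      ∀ i, Tendsto (fun k => ∫ x in Ω, φ k x i * θ x) atTop (𝓝 (∫ x in Ω, φ0 x i * θ x)))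
    (hcomp : ∀ k, CompOpBoundedLip Ω Ω' (φ k) (n : ℝ≥0∞) (ENNReal.ofReal ρ) C) :
    CompOpBoundedLip Ω Ω' φ0 (n : ℝ≥0∞) (ENNReal.ofReal ρ) C := by
  obtain ⟨hΩo, hΩc, hΩb⟩ := hΩ
  obtain ⟨hΩ'o, hΩ'c, hΩ'b⟩ := hΩ'
  have hΩm := hΩo.measurableSet
  have hfinΩ : IsFiniteMeasure (volume.restrict Ω) := ⟨by simpa using hΩb.measure_lt_top⟩
  have hfinΩ' : IsFiniteMeasure (volume.restrict Ω') := ⟨by simpa using hΩ'b.measure_lt_top⟩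
  have hρ1 : (1 : ℝ≥0∞) ≤ ENNReal.ofReal ρ := by simpa using hρ
  set E : ℝ≥0∞ := volume.restrict Ω univ ^ (1 / (1 : ℝ≥0∞).toReal - 1 / (ENNReal.ofReal ρ).toReal)
    with hE
  have hEt : E ≠ ⊤ := by
    refine (ENNReal.rpow_lt_top_of_nonneg ?_ (measure_ne_top _ _)).ne
    rw [ENNReal.toReal_one, ENNReal.toReal_ofReal (by linarith), sub_nonneg, div_one]
    exact div_le_one_of_le₀ hρ (by linarith)
  have hL1 : ∀ G : Ev n → Ev n, AEStronglyMeasurable G (volume.restrict Ω) →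
      ∫⁻ x in Ω, ‖G x‖ₑ ≤ eLpNorm G (ENNReal.ofReal ρ) (volume.restrict Ω) * E := fun G hG => by
    rw [← eLpNorm_one_eq_lintegral_enorm]
    exact eLpNorm_le_eLpNorm_mul_rpow_measure_univ hρ1 hG
  set M : ℝ≥0∞ := C * eLpNorm (fun _ : Ev n => (1 : ℝ)) n (volume.restrict Ω') with hM
  have hM₁ : eLpNorm (fun _ : Ev n => (1 : ℝ)) n (volume.restrict Ω') < ⊤ := (memLp_const 1).2
  have hMt : M ≠ ⊤ := ENNReal.mul_ne_top hC hM₁.ne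
  have hcoord : ∀ k i, ∃ G, IsWeakGrad Ω (fun x => φ k x i) G ∧
      eLpNorm G (ENNReal.ofReal ρ) (volume.restrict Ω) ≤ M := by
    intro k i
    have hlip : LipschitzWith 1 fun y : Ev n => y i :=
      LipschitzWith.of_dist_le_mul fun y z => by
        simpa [dist_eq_norm] using PiLp.norm_apply_le (y - z) i
    have hsm : ContDiff ℝ ∞ fun y : Ev n => y i :=
      (EuclideanSpace.proj i : Ev n →L[ℝ] ℝ).contDiff
    have hle : eLpNorm (gradient fun y : Ev n => y i) n (volume.restrict Ω')
        ≤ eLpNorm (fun _ : Ev n => (1 : ℝ)) n (volume.restrict Ω') := by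
      refine eLpNorm_mono fun y => ?_
      rw [norm_gradient]
      simpa using norm_fderiv_le_of_lipschitz ℝ hlip (x₀ := y)
    obtain ⟨G, hG, hG'⟩ := hcomp k _ _ 1 hlip.lipschitzOnWith (isWeakGrad_gradient Ω' hsm)
      (hle.trans_lt hM₁)
    exact ⟨G, hG, hG'.trans (mul_le_mul' le_rfl hle)⟩
  choose G hG hGM using hcoord
  obtain ⟨T, hT⟩ := isBounded_iff_forall_norm_le.1 hΩ'b.closure
  have hφm : ∀ k, AEStronglyMeasurable (φ k) (volume.restrict Ω) := fun k =>
    (hφc k).aestronglyMeasurable hΩm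
  obtain ⟨ns, -, hns⟩ := exists_subseq_tendsto_ae_of_weakGrad hΩo hΩb hφm (R := T)
    (fun k x hx => hT _ (subset_closure (hφΩ' k hx))) hG hφ0 hconv (M := M * E)
    (ENNReal.mul_ne_top hMt hEt)
    (fun k i => (hL1 _ (hG k i).aestronglyMeasurable).trans (by gcongr; exact hGM k i))
  have hφ0m : AEStronglyMeasurable φ0 (volume.restrict Ω) := hφ0.aestronglyMeasurable
  have hcl : ∀ᵐ x ∂volume.restrict Ω, φ0 x ∈ closure Ω' := by
    filter_upwards [hns, ae_restrict_mem hΩm] with x hx hxΩ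
    exact mem_closure_of_tendsto hx (Eventually.of_forall fun k => hφΩ' _ hxΩ)
  obtain ⟨y₀, hy₀⟩ := hΩ'c.nonempty
  obtain ⟨f, hf, hfφ, hfT⟩ : ∃ f : Ev n → Ev n, Measurable f ∧ f =ᵐ[volume.restrict Ω] φ0 ∧
      ∀ x, ‖f x‖ ≤ T := by
    classical
    refine ⟨fun x => if hφ0m.mk φ0 x ∈ closure Ω' then hφ0m.mk φ0 x else y₀,
      Measurable.ite (hφ0m.stronglyMeasurable_mk.measurable isClosed_closure.measurableSet)
        hφ0m.stronglyMeasurable_mk.measurable measurable_const, ?_, fun x => ?_⟩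
    · filter_upwards [hφ0m.ae_eq_mk, hcl] with x hx hx'
      rw [← hx, if_pos hx']
    · beta_reduce
      split_ifs with h
      · exact hT _ h
      · exact hT _ (subset_closure hy₀)
  let R : Fin n → Ev n → Ev n := fun i => (hR₀ i).aestronglyMeasurable.mk
  have hRm : ∀ i, Measurable (R i) := fun i =>
    (hR₀ i).aestronglyMeasurable.stronglyMeasurable_mk.measurable
  have hR : ∀ i, IsWeakGrad Ω (fun x => f x i) (R i) := fun i =>
    (hR₀ i).congr (hfφ.symm.mono fun x hx => by simp only [hx])
      (hR₀ i).aestronglyMeasurable.ae_eq_mk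
  have hRM : ∀ i, eLpNorm (R i) (ENNReal.ofReal ρ) (volume.restrict Ω) ≤ M := fun i => by
    rw [← eLpNorm_congr_ae (hR₀ i).aestronglyMeasurable.ae_eq_mk]
    exact IsWeakGrad.eLpNorm_le_of_tendsto hΩo hρ (fun k => hG k i) (hR₀ i)
      (fun θ hθ hθs hθΩ => hconv θ hθ hθs hθΩ i) fun k => hGM k i
  have hRi : ∀ i, IntegrableOn (R i) Ω := fun i =>
    ⟨(hRm i).aestronglyMeasurable, (hL1 _ (hRm i).aestronglyMeasurable).trans_lt
      (ENNReal.mul_lt_top ((hRM i).trans_lt hMt.lt_top) hEt.lt_top)⟩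
  have hfl : LocallyIntegrableOn f Ω :=
    (show IntegrableOn f Ω from IntegrableOn.of_bound hΩb.measure_lt_top
      hf.aestronglyMeasurable T (ae_of_all _ hfT)).locallyIntegrableOn
  have hns' : ∀ᵐ x ∂volume.restrict Ω, Tendsto (fun k => φ (ns k) x) atTop (𝓝 (f x)) := by
    filter_upwards [hns, hfφ] with x hx hx'
    rwa [hx']
  have hsmooth : ∀ u : Ev n → ℝ, ContDiff ℝ ∞ u → HasCompactSupport u →
      eLpNorm (chainGrad u f R) (ENNReal.ofReal ρ) (volume.restrict Ω)
        ≤ C * eLpNorm (gradient u) n (volume.restrict Ω') := fun u hu hus =>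
    eLpNorm_chainGrad_le_of_tendsto hΩo hΩ'b hρ (fun k => hφm (ns k)) hns' hfl hR
      (fun k => hcomp (ns k)) hu hus
  obtain ⟨κ, K, hκ, hK, hnull, hac, hctrl⟩ := exists_levelSetControl hn hΩo hΩ'b hf hfl hRm hR hRi
    (C₁ := C * E) (ENNReal.mul_ne_top hC hEt) fun u hu hus => by
      refine (hL1 _ (measurable_chainGrad hf hRm hu).aestronglyMeasurable).trans ?_
      rw [mul_right_comm]
      gcongr
      exact hsmooth u hu hus
  intro u Du L hu hDu hDun
  suffices h : ∃ Dv : Ev n → Ev n, IsWeakGrad Ω (u ∘ f) Dv ∧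
      eLpNorm Dv (ENNReal.ofReal ρ) (volume.restrict Ω)
        ≤ C * eLpNorm Du n (volume.restrict Ω') by
    obtain ⟨Dv, hDv, hle⟩ := h
    exact ⟨Dv, hDv.congr (hfφ.mono fun x hx => congrArg u hx) (ae_eq_refl _), hle⟩
  rcases hctrl.ae_mem_or_exists_ae_eq hn hΩo hΩc.isPreconnected hΩ'o hf hfT hK
    (fun N hN h0 => hac (hnull N hN h0)) with hmem | ⟨p, hp⟩
  · exact exists_isWeakGrad_comp_of_lipschitz (by omega) hΩo hΩ'o hΩ'b hf hfl hRm hRi hR hmem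
      hnull hsmooth hC hu hDu hDun
  · have hconst : IsWeakGrad Ω (fun _ => u p) (gradient fun _ : Ev n => u p) :=
      isWeakGrad_gradient Ω contDiff_const
    refine ⟨gradient fun _ : Ev n => u p, hconst.congr ?_ (ae_eq_refl _), ?_⟩
    · filter_upwards [hp] with x hx
      simp only [Function.comp_apply, hx]
    · have h0 : (gradient fun _ : Ev n => u p) = 0 := by
        ext x j
        simp
      rw [h0, eLpNorm_zero]
      exact zero_le

end Limit

end Paper

namespace Paper

/-- Lemma 2.6.  In the setting of Theorem 2.1 (uniformly bounded
pullback operators, whence each `φ_k` induces a bounded composition operator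
`φ_k* : L¹_n(Ω') → L¹_ρ(Ω)` with `‖φ_k*‖ ≤ C`), the weak limit `φ₀` induces a bounded
composition operator `φ₀* : L¹_n(Ω') ∩ Lip(Ω') → L¹_ρ(Ω)`,
`ρ = r/((n−1)² − r(n−2)) ≥ 1`, with `‖φ₀*‖ ≤ C`. -/
theorem statement3 (n : ℕ) (hn : 2 ≤ n)
    (Ω Ω' : Set (Ev n))
    (hΩ : IsBoundedDomain Ω) (hΩ' : IsBoundedDomain Ω')
    (hΩlip : HasLipschitzBoundary Ω) (hΩ'lip : HasLipschitzBoundary Ω')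
    (φ : ℕ → Ev n → Ev n) (Dφ : ℕ → Ev n → Mat n)
    (φ0 : Ev n → Ev n) (Dφ0 : Ev n → Mat n)
    (hhomeo : ∀ k, IsHomeo (φ k) Ω Ω')
    (hsob : ∀ k, MemW1loc ((n : ℝ) - 1) Ω (φ k) (Dφ k))
    (hJk : ∀ k, ∀ᵐ x ∂(volume.restrict Ω), 0 ≤ (Dφ k x).det)
    (hweak : WeakConvW1loc ((n : ℝ) - 1) Ω φ Dφ φ0 Dφ0)
    (hJ0 : ∀ᵐ x ∂(volume.restrict Ω), 0 ≤ (Dφ0 x).det)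
    (r : ℝ) (hr1 : (n : ℝ) - 1 ≤ r) (hr2 : r ≤ n)
    (C : ℝ≥0∞) (hC : C < ⊤)
    (hpb : ∀ k, PullbackBounded Ω Ω' (φ k) (Dφ k)
      (ENNReal.ofReal ((n : ℝ) / ((n : ℝ) - 1))) (ENNReal.ofReal (r / ((n : ℝ) - 1))) C)
    -- so that each `φ_k` induces a bounded composition operator
    -- `φ_k* : L¹_n(Ω') → L¹_ρ(Ω)` with `‖φ_k*‖ ≤ C`:
    (hcomp : ∀ k, CompOpBoundedLip Ω Ω' (φ k) ((n : ℝ≥0∞))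
      (ENNReal.ofReal (r / (((n : ℝ) - 1) ^ 2 - r * ((n : ℝ) - 2)))) C) :
    1 ≤ r / (((n : ℝ) - 1) ^ 2 - r * ((n : ℝ) - 2)) ∧
    CompOpBoundedLip Ω Ω' φ0 ((n : ℝ≥0∞))
      (ENNReal.ofReal (r / (((n : ℝ) - 1) ^ 2 - r * ((n : ℝ) - 2)))) C := by
  have hn' : (2 : ℝ) ≤ n := by exact_mod_cast hn
  have hden : 0 < ((n : ℝ) - 1) ^ 2 - r * ((n : ℝ) - 2) := by nlinarith
  have hρ : 1 ≤ r / (((n : ℝ) - 1) ^ 2 - r * ((n : ℝ) - 2)) := by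
    rw [one_le_div₀ hden]
    nlinarith
  obtain ⟨-, hφ0, -, hconv⟩ := hweak
  obtain ⟨hφ0l, ⟨hDl, hDφ0⟩, -⟩ := hφ0
  refine ⟨hρ, compOpBoundedLip_of_tendsto hn hΩ hΩ' (R₀ := fun i x => WithLp.toLp 2 (Dφ0 x i)) hρ
    hC.ne (fun k => ?_) (fun k => ?_) hφ0l
    (fun i => ⟨fun j => hDl i j, fun η hη hηs hηΩ j => hDφ0 η hη hηs hηΩ i j⟩)
    (fun θ hθ hθs hθΩ i => ?_) hcomp⟩
  · obtain ⟨ψ, hψ⟩ := hhomeo k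
    exact hψ.cont
  · obtain ⟨ψ, hψ⟩ := hhomeo k
    exact hψ.mapsTo
  · simpa only [mul_comm] using (hconv θ hθ hθs hθΩ).1 i

end Paper
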